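/- Theorem 1 (linear convergence of SHGD with O(ε₀⁻²μ²κ⁴r²log n) samples). There exist universal constants C, c₁, c₂ > 0 and ε̄ ∈ (0,1) such that for every ε₀ ∈ (0, ε̄] the following holds. Let n_s, r ≥ 1, n = 2n_s − 1, y ∈ ℂⁿ, and suppose M⋆ = 𝒢y = U⋆Σ⋆U⋆ᵀ, where U⋆ ∈ ℂ^{n_s×r} has orthonormal columns, Σ⋆ = diag(σ₁ ≥ … ≥ σ_r) with σ_r > 0, and ‖U⋆‖_{2,∞} ≤ √(2μ₀r/n) for some μ₀ > 0 (μ₀-incoherence). Set Z⋆ = U⋆Σ⋆^{1/2}, κ = σ₁/σ_r; fix μ ≥ μ₀, η′ ∈ (0, 1/54], η = η′/σ₁, K ≥ 0, and an integer m̂ ≥ C·ε₀⁻²·μ²·κ⁴·r²·log n. Let (a_{k,j}) for 0 ≤ k ≤ K+1, 1 ≤ j ≤ m̂ be independent random indices, each uniform on {0,…,n−1}. Suppose M⁰ ∈ ℂ^{n_s×n_s} has rank at most r and minimizes ‖M⁰ − (n/m̂)·Σ_{j=1}^{m̂} y_{a_{0,j}}·𝒢(e_{a_{0,j}})‖ (spectral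 norm) over matrices of rank at most r; write M⁰ = U⁰Σ⁰(U⁰)ᵀ with U⁰ ∈ ℂ^{n_s×r} having orthonormal columns and Σ⁰ diagonal nonnegative; set Z̃⁰ = U⁰(Σ⁰)^{1/2}, σ = σ₁(M⁰)/(1 − ε₀), τ = 2√(μrσ/n), Z⁰ = P_C(Z̃⁰), and for 0 ≤ k ≤ K define Z^{k+1} = P_C(Z^k − η·∇f^{(k)}(Z^k)), where ∇f^{(k)}(Z) = (n/m̂)·𝒢(Σ_{j=1}^{m̂} (𝒢*(ZZᵀ) − y)_{a_{k+1,j}}·e_{a_{k+1,j}})·conj(Z) + (ZZᵀ − 𝒢(𝒢*(ZZᵀ)))·conj(Z). Then, with probability at least 1 − c₂·(K+2)·n⁻² (over the random indices), for every 0 ≤ k ≤ K+1: dist_P(Z^k, Z⋆) ≤ (1 − 11η′/(100κ))^k · c₁ · σ_r^{1/2}. -/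

import Mathlib

open Matrix
open scoped BigOperators Classical

noncomputable section

/-- Frobenius norm of a complex matrix. -/
def frobNorm {m n : ℕ} (A : Matrix (Fin m) (Fin n) ℂ) : ℝ :=
  Real.sqrt (∑ i, ∑ j, ‖A i j‖ ^ 2)

/-- Euclidean (ℓ₂) norm of a complex vector. -/
def vecNorm {n : ℕ} (v : Fin n → ℂ) : ℝ :=
  Real.sqrt (∑ i, ‖v i‖ ^ 2)

/-- Spectral norm (largest singular value). -/
def specNorm {m n : ℕ} (A : Matrix (Fin m) (Fin n) ℂ) : ℝ :=
  sSup {t : ℝ | ∃ v : Fin n → ℂ, vecNorm v = 1 ∧ t = vecNorm (A.mulVec v)}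

/-- `‖A‖_{2,∞}`: the largest ℓ₂ norm of the rows of `A`. -/
def norm2inf {m n : ℕ} (A : Matrix (Fin m) (Fin n) ℂ) : ℝ :=
  ⨆ i, vecNorm (A i)

/-- Entrywise complex conjugate of a matrix. -/
def conjM {m n : ℕ} (A : Matrix (Fin m) (Fin n) ℂ) : Matrix (Fin m) (Fin n) ℂ :=
  A.map (starRingEnd ℂ)

/-- Distance via alignment over invertible matrices. -/
def distP {ns r : ℕ} (Z Zs : Matrix (Fin ns) (Fin r) ℂ) : ℝ :=
  sInf {t : ℝ | ∃ P : Matrix (Fin r) (Fin r) ℂ, IsUnit P ∧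
    t = Real.sqrt (frobNorm (Z - Zs * P) ^ 2 + frobNorm (Z - Zs * (P⁻¹)ᵀ) ^ 2)}

/-- `w_a`: the length of the `a`-th skew diagonal of an `n_s × n_s` matrix. -/
def hw (ns : ℕ) (a : ℕ) : ℕ :=
  (Finset.univ.filter (fun p : Fin ns × Fin ns => (p.1 : ℕ) + (p.2 : ℕ) = a)).card

/-- The normalized Hankel lifting `𝒢`. -/
def Gop (ns : ℕ) (z : Fin (2 * ns - 1) → ℂ) : Matrix (Fin ns) (Fin ns) ℂ :=
  fun i j => z ⟨(i : ℕ) + (j : ℕ), by have := i.isLt; have := j.isLt; omega⟩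
    / ((Real.sqrt (hw ns ((i : ℕ) + (j : ℕ))) : ℝ) : ℂ)

/-- The adjoint `𝒢*`. -/
def Gadj (ns : ℕ) (M : Matrix (Fin ns) (Fin ns) ℂ) : Fin (2 * ns - 1) → ℂ :=
  fun a => (1 / ((Real.sqrt (hw ns (a : ℕ)) : ℝ) : ℂ))
    * ∑ i : Fin ns, ∑ j : Fin ns, if (i : ℕ) + (j : ℕ) = (a : ℕ) then M i j else 0

/-- The row-wise clipping projection `P_C` with row bound `τ`. -/
def projC {ns r : ℕ} (τ : ℝ) (Z : Matrix (Fin ns) (Fin r) ℂ) :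
    Matrix (Fin ns) (Fin r) ℂ :=
  fun i j => if vecNorm (Z i) ≤ τ then Z i j else ((τ / vecNorm (Z i) : ℝ) : ℂ) * Z i j

/-- The sampled gradient of the SHGD loss. -/
def gradf (ns r mhat : ℕ) (y : Fin (2 * ns - 1) → ℂ)
    (ω : Fin mhat → Fin (2 * ns - 1)) (Z : Matrix (Fin ns) (Fin r) ℂ) :
    Matrix (Fin ns) (Fin r) ℂ :=
  (((2 * ns - 1 : ℕ) : ℝ) / (mhat : ℝ)) •
      (Gop ns (∑ j : Fin mhat,
          (Gadj ns (Z * Zᵀ) - y) (ω j)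
            • (Pi.single (ω j) (1 : ℂ) : Fin (2 * ns - 1) → ℂ)) * conjM Z)
    + (Z * Zᵀ - Gop ns (Gadj ns (Z * Zᵀ))) * conjM Z

/-- `s ↦ cosh √s` is convex, in terms of square roots. -/
theorem cosh_le_of_sq_eq_convex_comb {p q A B t : ℝ} (hp : 0 ≤ p) (hq : 0 ≤ q) (hpq : p + q = 1)
    (ht : t ^ 2 = p * A ^ 2 + q * B ^ 2) :
    Real.cosh t ≤ p * Real.cosh A + q * Real.cosh B := by
  refine hasSum_le (fun k => ?_) (Real.hasSum_cosh t)
    (((Real.hasSum_cosh A).mul_left p).add ((Real.hasSum_cosh B).mul_left q))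
  have h := (convexOn_pow k).2 (show A ^ 2 ∈ Set.Ici (0 : ℝ) from sq_nonneg A)
    (show B ^ 2 ∈ Set.Ici (0 : ℝ) from sq_nonneg B) hp hq hpq
  simp only [smul_eq_mul] at h
  rw [pow_mul, ht, pow_mul, pow_mul, ← mul_div_assoc, ← mul_div_assoc, ← add_div]
  gcongr

/-- Second order upper bound for `cosh ‖·‖` in an inner product space. -/
theorem cosh_norm_add_le {E : Type*} [NormedAddCommGroup E] [InnerProductSpace ℝ E] (x h : E) :
    Real.cosh ‖x + h‖ ≤ Real.cosh ‖x‖ + Real.sinh ‖x‖ / ‖x‖ * inner ℝ x h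
      + (Real.exp ‖h‖ - 1 - ‖h‖) * Real.cosh ‖x‖ := by
  have hsh : ‖h‖ ≤ Real.sinh ‖h‖ := Real.self_le_sinh_iff.2 (norm_nonneg h)
  have hc := Real.cosh_add_sinh ‖h‖
  have hlt : Real.sinh ‖x‖ ≤ Real.cosh ‖x‖ := (Real.sinh_lt_cosh _).le
  have hsx : 0 ≤ Real.sinh ‖x‖ := Real.sinh_nonneg_iff.2 (norm_nonneg x)
  have key : ∀ s : ℝ, (s = 1 ∨ s = -1) →
      Real.cosh (‖x‖ + s * ‖h‖) ≤ Real.cosh ‖x‖ + s * (Real.sinh ‖x‖ * ‖h‖)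
        + (Real.exp ‖h‖ - 1 - ‖h‖) * Real.cosh ‖x‖ := by
    rintro s (rfl | rfl)
    · rw [one_mul, Real.cosh_add]; nlinarith
    · rw [neg_one_mul, Real.cosh_add, Real.cosh_neg, Real.sinh_neg]; nlinarith
  rcases eq_or_ne x 0 with rfl | hx
  · have := key 1 (Or.inl rfl)
    simpa using this
  rcases eq_or_ne h 0 with rfl | hh
  · simp
  have hxp : 0 < ‖x‖ := norm_pos_iff.2 hx
  have hhp : 0 < ‖h‖ := norm_pos_iff.2 hh
  set θ : ℝ := inner ℝ x h / (‖x‖ * ‖h‖) with hθ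
  have hin : inner ℝ x h = θ * (‖x‖ * ‖h‖) := by rw [hθ]; field_simp
  have habs : |θ| ≤ 1 := abs_real_inner_div_norm_mul_norm_le_one x h
  obtain ⟨h1, h2⟩ := abs_le.1 habs
  have hsq : ‖x + h‖ ^ 2 = (1 + θ) / 2 * (‖x‖ + 1 * ‖h‖) ^ 2
      + (1 - θ) / 2 * (‖x‖ + (-1) * ‖h‖) ^ 2 := by
    rw [norm_add_sq_real, hin]; ring
  have hconv := cosh_le_of_sq_eq_convex_comb (by linarith) (by linarith) (by ring) hsq
  have k1 := mul_le_mul_of_nonneg_left (key 1 (Or.inl rfl)) (show 0 ≤ (1 + θ) / 2 by linarith)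
  have k2 := mul_le_mul_of_nonneg_left (key (-1) (Or.inr rfl)) (show 0 ≤ (1 - θ) / 2 by linarith)
  have : Real.sinh ‖x‖ / ‖x‖ * inner ℝ x h = θ * (Real.sinh ‖x‖ * ‖h‖) := by
    rw [hin]; field_simp
  rw [this]
  linarith

section Bernstein

variable {E : Type*} [NormedAddCommGroup E] [InnerProductSpace ℝ E] {ι : Type*} [Fintype ι]

theorem sum_cosh_norm_add_le (f : ι → E) (hf : ∑ a, f a = 0) (h1 : ∀ a, ‖f a‖ ≤ 1) (x : E) :
    ∑ a, Real.cosh ‖x + f a‖ ≤ Real.cosh ‖x‖ * (Fintype.card ι + ∑ a, ‖f a‖ ^ 2) := by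
  have hc := Real.cosh_pos ‖x‖
  calc ∑ a, Real.cosh ‖x + f a‖
      ≤ ∑ a, (Real.cosh ‖x‖ + Real.sinh ‖x‖ / ‖x‖ * inner ℝ x (f a)
          + ‖f a‖ ^ 2 * Real.cosh ‖x‖) := by
        refine Finset.sum_le_sum fun a _ => (cosh_norm_add_le x (f a)).trans ?_
        have := (abs_le.1 (Real.abs_exp_sub_one_sub_id_le
          (x := ‖f a‖) (by rw [abs_norm]; exact h1 a))).2
        gcongr
    _ = _ := by
        rw [Finset.sum_add_distrib, Finset.sum_add_distrib, ← Finset.mul_sum, ← inner_sum, hf,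
          ← Finset.sum_mul]
        simp; ring

theorem sum_cosh_norm_sum_le (f : ι → E) (hf : ∑ a, f a = 0) (h1 : ∀ a, ‖f a‖ ≤ 1) (m : ℕ) :
    ∑ ω : Fin m → ι, Real.cosh ‖∑ j, f (ω j)‖ ≤ (Fintype.card ι + ∑ a, ‖f a‖ ^ 2) ^ m := by
  induction m with
  | zero => simp
  | succ m ih =>
    rw [← (Fin.consEquiv (fun _ : Fin (m + 1) => ι)).sum_comp, Fintype.sum_prod_type_right]
    have hS : 0 ≤ (Fintype.card ι + ∑ a, ‖f a‖ ^ 2 : ℝ) := by positivity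
    calc ∑ ω : Fin m → ι, ∑ a : ι,
          Real.cosh ‖∑ j, f ((Fin.consEquiv (fun _ : Fin (m + 1) => ι)) (a, ω) j)‖
        = ∑ ω : Fin m → ι, ∑ a : ι, Real.cosh ‖∑ j, f (ω j) + f a‖ := by
          refine Finset.sum_congr rfl fun ω _ => Finset.sum_congr rfl fun a _ => ?_
          simp [Fin.consEquiv, Fin.sum_univ_succ, add_comm]
      _ ≤ ∑ ω : Fin m → ι, Real.cosh ‖∑ j, f (ω j)‖ * (Fintype.card ι + ∑ a, ‖f a‖ ^ 2) :=
          Finset.sum_le_sum fun ω _ => sum_cosh_norm_add_le f hf h1 _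
      _ ≤ _ := by
          rw [← Finset.sum_mul, pow_succ]
          gcongr

theorem card_norm_sum_ge_le [Nonempty ι] (f : ι → E) (hf : ∑ a, f a = 0) (h1 : ∀ a, ‖f a‖ ≤ 1)
    (m : ℕ) (T : ℝ) :
    ((Finset.univ.filter fun ω : Fin m → ι => T ≤ ‖∑ j, f (ω j)‖).card : ℝ)
      ≤ 2 * Real.exp (m * ((∑ a, ‖f a‖ ^ 2) / Fintype.card ι) - T)
        * (Fintype.card ι : ℝ) ^ m := by
  rcases le_total T 0 with hT | hT
  · have hcard : ((Finset.univ.filter fun ω : Fin m → ι => T ≤ ‖∑ j, f (ω j)‖).card : ℝ)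
        ≤ (Fintype.card ι : ℝ) ^ m := by
      refine (Nat.cast_le.2 (Finset.card_le_univ _)).trans ?_
      simp
    refine hcard.trans (le_mul_of_one_le_left (by positivity) ?_)
    have : 1 ≤ Real.exp (m * ((∑ a, ‖f a‖ ^ 2) / Fintype.card ι) - T) := by
      apply Real.one_le_exp
      have : 0 ≤ m * ((∑ a, ‖f a‖ ^ 2) / (Fintype.card ι : ℝ)) := by positivity
      linarith
    linarith
  have hN : (0 : ℝ) < Fintype.card ι := by exact_mod_cast Fintype.card_pos
  have h2 := sum_cosh_norm_sum_le f hf h1 m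
  set S := ∑ a, ‖f a‖ ^ 2
  set B := Finset.univ.filter fun ω : Fin m → ι => T ≤ ‖∑ j, f (ω j)‖
  have hS : 0 ≤ S := by positivity
  have hmark : (B.card : ℝ) * (Real.exp T / 2) ≤ (Fintype.card ι + S) ^ m := by
    refine le_trans ?_ h2
    calc (B.card : ℝ) * (Real.exp T / 2) = ∑ ω ∈ B, Real.exp T / 2 := by simp
      _ ≤ ∑ ω ∈ B, Real.cosh ‖∑ j, f (ω j)‖ := by
          refine Finset.sum_le_sum fun ω hω => ?_
          have hω' : T ≤ ‖∑ j, f (ω j)‖ := (Finset.mem_filter.1 hω).2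
          have : Real.cosh T ≤ Real.cosh ‖∑ j, f (ω j)‖ := by
            rw [Real.cosh_le_cosh, abs_of_nonneg hT, abs_norm]; exact hω'
          refine le_trans ?_ this
          rw [Real.cosh_eq]
          have := Real.exp_pos (-T)
          linarith
      _ ≤ _ := Finset.sum_le_sum_of_subset_of_nonneg (Finset.subset_univ _)
          fun _ _ _ => (Real.cosh_pos _).le
  have hpow : (Fintype.card ι + S) ^ m
      ≤ (Fintype.card ι : ℝ) ^ m * Real.exp (m * (S / Fintype.card ι)) := by
    have : (Fintype.card ι + S : ℝ) = Fintype.card ι * (S / Fintype.card ι + 1) := by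
      field_simp; ring
    rw [this, mul_pow, Real.exp_nat_mul]
    gcongr
    exact Real.add_one_le_exp _
  rw [Real.exp_sub]
  have he := Real.exp_pos T
  have : (B.card : ℝ) = (B.card : ℝ) * (Real.exp T / 2) * (2 / Real.exp T) := by field_simp
  rw [this]
  calc _ ≤ (Fintype.card ι : ℝ) ^ m * Real.exp (m * (S / Fintype.card ι)) * (2 / Real.exp T) := by
        exact mul_le_mul_of_nonneg_right (hmark.trans hpow) (by positivity)
    _ = _ := by ring

/-- Bernstein's inequality for sampling with replacement, for vectors of an inner product space,
at the deviation level `δ` with `m δ² = 12 log n`. -/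
theorem card_sampling_deviation_le [Nonempty ι] (g : ι → E) {L V δ : ℝ} {m : ℕ} (hm : 0 < m)
    (hV : 0 < V) (hδ : 0 ≤ δ) (hL : ∀ a, ‖g a‖ ≤ L) (hgV : ∑ a, ‖g a‖ ^ 2 ≤ Fintype.card ι * V)
    (hLV : δ * L ≤ √V) (hδm : m * δ ^ 2 = 12 * Real.log (Fintype.card ι)) :
    ((Finset.univ.filter fun ω : Fin m → ι => Fintype.card ι * δ * √V
        < ‖((Fintype.card ι : ℝ) / m) • ∑ j, g (ω j) - ∑ a, g a‖).card : ℝ)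
      ≤ 2 / (Fintype.card ι : ℝ) ^ 3 * (Fintype.card ι : ℝ) ^ m := by
  have hN : (0 : ℝ) < Fintype.card ι := by exact_mod_cast Fintype.card_pos
  have hm' : (0 : ℝ) < m := by exact_mod_cast hm
  set N : ℝ := (Fintype.card ι : ℝ) with hNdef
  set gm : E := (1 / N) • ∑ a, g a with hgm
  have hVs : √V ^ 2 = V := Real.sq_sqrt hV.le
  have hVp : 0 < √V := Real.sqrt_pos.2 hV
  set lam : ℝ := δ / (2 * √V) with hlam
  have hlam0 : 0 ≤ lam := by positivity
  have hL0 : 0 ≤ L := (norm_nonneg _).trans (hL (Classical.arbitrary ι))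
  have hgmL : ‖gm‖ ≤ L := by
    rw [hgm, norm_smul, Real.norm_of_nonneg (by positivity)]
    have : ‖∑ a, g a‖ ≤ N * L := by
      refine (norm_sum_le _ _).trans ?_
      refine (Finset.sum_le_sum fun a _ => hL a).trans ?_
      simp [hNdef]
    calc 1 / N * ‖∑ a, g a‖ ≤ 1 / N * (N * L) := by gcongr
      _ = L := by field_simp
  set f : ι → E := fun a => lam • (g a - gm) with hf
  have hsum0 : ∑ a, (g a - gm) = 0 := by
    rw [Finset.sum_sub_distrib, Finset.sum_const, Finset.card_univ, ← Nat.cast_smul_eq_nsmul ℝ,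
      hgm, smul_smul, ← hNdef]
    rw [mul_one_div_cancel hN.ne', one_smul, sub_self]
  have hf0 : ∑ a, f a = 0 := by rw [hf, ← Finset.smul_sum, hsum0, smul_zero]
  have hf1 : ∀ a, ‖f a‖ ≤ 1 := by
    intro a
    rw [hf, norm_smul, Real.norm_of_nonneg hlam0]
    have : ‖g a - gm‖ ≤ 2 * L := (norm_sub_le _ _).trans (by linarith [hL a])
    calc lam * ‖g a - gm‖ ≤ lam * (2 * L) := by gcongr
      _ = δ * L / √V := by rw [hlam]; field_simp
      _ ≤ 1 := by rw [div_le_one hVp]; exact hLV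
  have hvar : ∑ a, ‖g a - gm‖ ^ 2 ≤ N * V := by
    refine le_trans ?_ hgV
    have : ∀ a, ‖g a - gm‖ ^ 2 = ‖g a‖ ^ 2 - 2 * inner ℝ gm (g a - gm) - ‖gm‖ ^ 2 := by
      intro a
      rw [norm_sub_sq_real, inner_sub_right, real_inner_self_eq_norm_sq, real_inner_comm]; ring
    rw [Finset.sum_congr rfl fun a _ => this a, Finset.sum_sub_distrib, Finset.sum_sub_distrib,
      ← Finset.mul_sum, ← inner_sum, hsum0, inner_zero_right]
    have : 0 ≤ ∑ _a : ι, ‖gm‖ ^ 2 := by positivity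
    linarith
  have hS : (∑ a, ‖f a‖ ^ 2) / N ≤ δ ^ 2 / 4 := by
    have : ∑ a, ‖f a‖ ^ 2 = lam ^ 2 * ∑ a, ‖g a - gm‖ ^ 2 := by
      rw [Finset.mul_sum]
      refine Finset.sum_congr rfl fun a _ => ?_
      rw [hf, norm_smul, mul_pow, Real.norm_of_nonneg hlam0]
    rw [this, div_le_iff₀ hN]
    calc lam ^ 2 * ∑ a, ‖g a - gm‖ ^ 2 ≤ lam ^ 2 * (N * V) := by gcongr
      _ = δ ^ 2 / 4 * N := by rw [hlam, div_pow, mul_pow, hVs]; field_simp; ring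
  have hT := card_norm_sum_ge_le f hf0 hf1 m (m * δ ^ 2 / 2)
  refine le_trans ?_ (hT.trans ?_)
  · refine Nat.cast_le.2 (Finset.card_le_card fun ω hω => ?_)
    rw [Finset.mem_filter] at hω ⊢
    refine ⟨Finset.mem_univ _, ?_⟩
    have e1 : ∑ j, f (ω j) = (lam * m / N) • ((N / m) • ∑ j, g (ω j) - ∑ a, g a) := by
      rw [hf, ← Finset.smul_sum, Finset.sum_sub_distrib, Finset.sum_const, Finset.card_univ,
        Fintype.card_fin, ← Nat.cast_smul_eq_nsmul ℝ, hgm, smul_smul, smul_sub, smul_sub, smul_smul,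
        smul_smul]
      congr 2 <;> field_simp
    rw [e1, norm_smul, Real.norm_of_nonneg (by positivity)]
    calc m * δ ^ 2 / 2 = lam * m / N * (N * δ * √V) := by rw [hlam]; field_simp
      _ ≤ _ := by gcongr; exact hω.2.le
  · have hexp : Real.exp (m * ((∑ a, ‖f a‖ ^ 2) / N) - m * δ ^ 2 / 2) ≤ 1 / N ^ 3 := by
      calc Real.exp (m * ((∑ a, ‖f a‖ ^ 2) / N) - m * δ ^ 2 / 2)
          ≤ Real.exp (-(3 * Real.log N)) := by
            apply Real.exp_le_exp.2
            have : m * ((∑ a, ‖f a‖ ^ 2) / N) ≤ m * (δ ^ 2 / 4) := by gcongr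
            linarith
        _ = 1 / N ^ 3 := by
            rw [Real.exp_neg, one_div]
            congr 1
            rw [show (3 : ℝ) * Real.log N = ((3 : ℕ) : ℝ) * Real.log N by norm_num,
              Real.exp_nat_mul, Real.exp_log hN]
    calc _ ≤ 2 * (1 / N ^ 3) * N ^ m := by gcongr
      _ = _ := by ring

end Bernstein

/-! ### Euclidean and Frobenius norms -/

section Norms

variable {l m n k : ℕ}

theorem vecNorm_eq_norm (v : Fin n → ℂ) : vecNorm v = ‖WithLp.toLp 2 v‖ := by
  rw [EuclideanSpace.norm_eq]; rfl

theorem vecNorm_nonneg (v : Fin n → ℂ) : 0 ≤ vecNorm v := Real.sqrt_nonneg _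

theorem vecNorm_sq (v : Fin n → ℂ) : vecNorm v ^ 2 = ∑ i, ‖v i‖ ^ 2 :=
  Real.sq_sqrt (Finset.sum_nonneg fun _ _ => sq_nonneg _)

theorem vecNorm_add_le (v w : Fin n → ℂ) : vecNorm (v + w) ≤ vecNorm v + vecNorm w := by
  simp only [vecNorm_eq_norm, WithLp.toLp_add]; exact norm_add_le _ _

theorem vecNorm_sub_le (v w : Fin n → ℂ) : vecNorm (v - w) ≤ vecNorm v + vecNorm w := by
  simp only [vecNorm_eq_norm, WithLp.toLp_sub]; exact norm_sub_le _ _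

theorem vecNorm_smul (c : ℂ) (v : Fin n → ℂ) : vecNorm (c • v) = ‖c‖ * vecNorm v := by
  simp only [vecNorm_eq_norm, WithLp.toLp_smul]; exact norm_smul _ _

theorem vecNorm_zero : vecNorm (0 : Fin n → ℂ) = 0 := by
  simp [vecNorm]

theorem vecNorm_eq_zero {v : Fin n → ℂ} : vecNorm v = 0 ↔ v = 0 := by
  rw [vecNorm_eq_norm, norm_eq_zero]
  exact WithLp.toLp_eq_zero 2

theorem vecNorm_conj (v : Fin n → ℂ) : vecNorm (star v) = vecNorm v := by
  simp [vecNorm]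

theorem norm_dotProduct_le (v w : Fin n → ℂ) : ‖v ⬝ᵥ w‖ ≤ vecNorm v * vecNorm w := by
  have h1 : ‖v ⬝ᵥ w‖ ≤ ∑ i, ‖v i‖ * ‖w i‖ := by
    refine (norm_sum_le _ _).trans (Finset.sum_le_sum fun i _ => ?_)
    rw [norm_mul]
  exact h1.trans (Real.sum_mul_le_sqrt_mul_sqrt _ _ _)

theorem star_dotProduct_self (v : Fin n → ℂ) : star v ⬝ᵥ v = ((vecNorm v ^ 2 : ℝ) : ℂ) := by
  rw [vecNorm_sq, dotProduct, Complex.ofReal_sum]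
  refine Finset.sum_congr rfl fun i _ => ?_
  rw [Pi.star_apply, RCLike.star_def, ← Complex.normSq_eq_conj_mul_self, Complex.normSq_eq_norm_sq]

theorem frobNorm_nonneg (A : Matrix (Fin m) (Fin n) ℂ) : 0 ≤ frobNorm A := Real.sqrt_nonneg _

theorem frobNorm_sq (A : Matrix (Fin m) (Fin n) ℂ) : frobNorm A ^ 2 = ∑ i, ∑ j, ‖A i j‖ ^ 2 :=
  Real.sq_sqrt (Finset.sum_nonneg fun _ _ => Finset.sum_nonneg fun _ _ => sq_nonneg _)

theorem frobNorm_sq_eq_rows (A : Matrix (Fin m) (Fin n) ℂ) :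
    frobNorm A ^ 2 = ∑ i, vecNorm (A i) ^ 2 := by
  simp_rw [frobNorm_sq, vecNorm_sq]

/-- A matrix as a vector of a Euclidean space. -/
def flatten (A : Matrix (Fin m) (Fin n) ℂ) : EuclideanSpace ℂ (Fin m × Fin n) :=
  WithLp.toLp 2 fun p => A p.1 p.2

theorem flatten_add (A B : Matrix (Fin m) (Fin n) ℂ) :
    flatten (A + B) = flatten A + flatten B := rfl

theorem flatten_smul (c : ℝ) (A : Matrix (Fin m) (Fin n) ℂ) :
    flatten (c • A) = c • flatten A := rfl

theorem frobNorm_eq_norm (A : Matrix (Fin m) (Fin n) ℂ) : frobNorm A = ‖flatten A‖ := by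
  rw [EuclideanSpace.norm_eq, frobNorm]
  congr 1
  exact (Fintype.sum_prod_type (fun p : Fin m × Fin n => ‖A p.1 p.2‖ ^ 2)).symm

theorem frobNorm_add_le (A B : Matrix (Fin m) (Fin n) ℂ) :
    frobNorm (A + B) ≤ frobNorm A + frobNorm B := by
  rw [frobNorm_eq_norm, frobNorm_eq_norm, frobNorm_eq_norm, flatten_add]
  exact norm_add_le _ _

theorem frobNorm_smul (c : ℝ) (A : Matrix (Fin m) (Fin n) ℂ) :
    frobNorm (c • A) = |c| * frobNorm A := by
  rw [frobNorm_eq_norm, frobNorm_eq_norm, flatten_smul, norm_smul, Real.norm_eq_abs]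

theorem frobNorm_neg (A : Matrix (Fin m) (Fin n) ℂ) : frobNorm (-A) = frobNorm A := by
  simp [frobNorm]

theorem frobNorm_sub_le (A B : Matrix (Fin m) (Fin n) ℂ) :
    frobNorm (A - B) ≤ frobNorm A + frobNorm B := by
  rw [sub_eq_add_neg, ← frobNorm_neg B]; exact frobNorm_add_le _ _

theorem frobNorm_sub_comm (A B : Matrix (Fin m) (Fin n) ℂ) :
    frobNorm (A - B) = frobNorm (B - A) := by
  rw [← frobNorm_neg, neg_sub]

theorem frobNorm_transpose (A : Matrix (Fin m) (Fin n) ℂ) : frobNorm Aᵀ = frobNorm A := by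
  rw [frobNorm, frobNorm, Finset.sum_comm]; rfl

theorem frobNorm_conjM (A : Matrix (Fin m) (Fin n) ℂ) : frobNorm (conjM A) = frobNorm A := by
  simp [frobNorm, conjM]

theorem frobNorm_conjTranspose (A : Matrix (Fin m) (Fin n) ℂ) : frobNorm Aᴴ = frobNorm A := by
  rw [← frobNorm_transpose, ← frobNorm_conjM A]
  congr 1

theorem frobNorm_sq_eq_cols (A : Matrix (Fin m) (Fin n) ℂ) :
    frobNorm A ^ 2 = ∑ j, vecNorm (A.col j) ^ 2 := by
  rw [← frobNorm_transpose, frobNorm_sq_eq_rows]; rfl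

/-- The real Frobenius inner product. -/
def frobInner (A B : Matrix (Fin m) (Fin n) ℂ) : ℝ := ∑ i, ∑ j, (star (A i j) * B i j).re

theorem frobInner_add_left (A B D : Matrix (Fin m) (Fin n) ℂ) :
    frobInner (A + B) D = frobInner A D + frobInner B D := by
  simp only [frobInner, Matrix.add_apply, star_add, add_mul, Complex.add_re,
    Finset.sum_add_distrib]

theorem frobInner_add_right (A B D : Matrix (Fin m) (Fin n) ℂ) :
    frobInner A (B + D) = frobInner A B + frobInner A D := by
  simp only [frobInner, Matrix.add_apply, mul_add, Complex.add_re, Finset.sum_add_distrib]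

theorem frobInner_smul_right (c : ℝ) (A B : Matrix (Fin m) (Fin n) ℂ) :
    frobInner A (c • B) = c * frobInner A B := by
  simp only [frobInner, Matrix.smul_apply, Finset.mul_sum]
  refine Finset.sum_congr rfl fun i _ => Finset.sum_congr rfl fun j _ => ?_
  rw [mul_smul_comm, Complex.smul_re, smul_eq_mul]

theorem frobInner_comm (A B : Matrix (Fin m) (Fin n) ℂ) : frobInner A B = frobInner B A := by
  refine Finset.sum_congr rfl fun i _ => Finset.sum_congr rfl fun j _ => ?_
  simp [Complex.mul_re]; ring

theorem frobInner_self (A : Matrix (Fin m) (Fin n) ℂ) : frobInner A A = frobNorm A ^ 2 := by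
  rw [frobNorm_sq]
  refine Finset.sum_congr rfl fun i _ => Finset.sum_congr rfl fun j _ => ?_
  rw [RCLike.star_def, ← Complex.normSq_eq_conj_mul_self, Complex.ofReal_re,
    Complex.normSq_eq_norm_sq]

theorem frobNorm_add_sq (A B : Matrix (Fin m) (Fin n) ℂ) :
    frobNorm (A + B) ^ 2 = frobNorm A ^ 2 + 2 * frobInner A B + frobNorm B ^ 2 := by
  rw [← frobInner_self, ← frobInner_self, ← frobInner_self, frobInner_add_left,
    frobInner_add_right, frobInner_add_right, frobInner_comm B A]; ring

theorem frobNorm_sub_smul_sq (A B : Matrix (Fin m) (Fin n) ℂ) (c : ℝ) :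
    frobNorm (A - c • B) ^ 2
      = frobNorm A ^ 2 - 2 * c * frobInner A B + c ^ 2 * frobNorm B ^ 2 := by
  rw [sub_eq_add_neg, ← neg_smul, frobNorm_add_sq, frobInner_smul_right, frobNorm_smul, mul_pow,
    sq_abs]; ring

theorem abs_frobInner_le (A B : Matrix (Fin m) (Fin n) ℂ) :
    |frobInner A B| ≤ frobNorm A * frobNorm B := by
  have h1 : |frobInner A B| ≤ ∑ p : Fin m × Fin n, ‖A p.1 p.2‖ * ‖B p.1 p.2‖ := by
    rw [frobInner, ← Fintype.sum_prod_type
      (fun p : Fin m × Fin n => (star (A p.1 p.2) * B p.1 p.2).re)]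
    refine (Finset.abs_sum_le_sum_abs _ _).trans (Finset.sum_le_sum fun p _ => ?_)
    refine (Complex.abs_re_le_norm _).trans ?_
    rw [norm_mul, norm_star]
  refine h1.trans ((Real.sum_mul_le_sqrt_mul_sqrt _ _ _).trans (le_of_eq ?_))
  rw [frobNorm, frobNorm, Fintype.sum_prod_type, Fintype.sum_prod_type]

theorem frobInner_eq_trace (A B : Matrix (Fin m) (Fin n) ℂ) :
    frobInner A B = (Aᴴ * B).trace.re := by
  rw [frobInner, Finset.sum_comm, Matrix.trace]
  simp only [Complex.re_sum, Matrix.diag_apply, Matrix.mul_apply, Matrix.conjTranspose_apply]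

theorem frobInner_mul_conjM (G : Matrix (Fin m) (Fin n) ℂ) (Z : Matrix (Fin n) (Fin k) ℂ)
    (W : Matrix (Fin m) (Fin k) ℂ) :
    frobInner (G * conjM Z) W = frobInner G (W * Zᵀ) := by
  rw [frobInner_eq_trace, frobInner_eq_trace, Matrix.conjTranspose_mul, Matrix.mul_assoc,
    Matrix.trace_mul_comm, Matrix.mul_assoc]
  congr 4
  ext i j; simp [conjM]

theorem frobInner_transpose (A B : Matrix (Fin m) (Fin n) ℂ) :
    frobInner Aᵀ Bᵀ = frobInner A B := by
  rw [frobInner, frobInner, Finset.sum_comm]; rfl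

/-! ### Operator bounds -/

/-- `A` has operator norm at most `s`. -/
def OpLe (A : Matrix (Fin m) (Fin n) ℂ) (s : ℝ) : Prop :=
  ∀ v, vecNorm (A *ᵥ v) ≤ s * vecNorm v

/-- All singular values of `A` (as a map) are at least `s`. -/
def OpGe (A : Matrix (Fin m) (Fin n) ℂ) (s : ℝ) : Prop :=
  ∀ v, s * vecNorm v ≤ vecNorm (A *ᵥ v)

theorem OpLe.mono {A : Matrix (Fin m) (Fin n) ℂ} {s t : ℝ} (h : OpLe A s) (hst : s ≤ t) :
    OpLe A t := fun v =>
  (h v).trans (mul_le_mul_of_nonneg_right hst (vecNorm_nonneg v))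

theorem OpGe.mono {A : Matrix (Fin m) (Fin n) ℂ} {s t : ℝ} (h : OpGe A s) (hst : t ≤ s) :
    OpGe A t := fun v =>
  (mul_le_mul_of_nonneg_right hst (vecNorm_nonneg v)).trans (h v)

theorem OpLe.mul {A : Matrix (Fin l) (Fin m) ℂ} {B : Matrix (Fin m) (Fin n) ℂ} {s t : ℝ}
    (hs : 0 ≤ s) (hA : OpLe A s) (hB : OpLe B t) : OpLe (A * B) (s * t) := fun v => by
  rw [← Matrix.mulVec_mulVec]
  refine (hA _).trans ?_
  rw [mul_assoc]
  exact mul_le_mul_of_nonneg_left (hB v) hs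

theorem OpGe.mul {A : Matrix (Fin l) (Fin m) ℂ} {B : Matrix (Fin m) (Fin n) ℂ} {s t : ℝ}
    (hs : 0 ≤ s) (hA : OpGe A s) (hB : OpGe B t) : OpGe (A * B) (s * t) := fun v => by
  rw [← Matrix.mulVec_mulVec]
  refine le_trans ?_ (hA _)
  rw [mul_assoc]
  exact mul_le_mul_of_nonneg_left (hB v) hs

theorem OpLe.add {A B : Matrix (Fin m) (Fin n) ℂ} {s t : ℝ} (hA : OpLe A s) (hB : OpLe B t) :
    OpLe (A + B) (s + t) := fun v => by
  rw [Matrix.add_mulVec, add_mul]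
  exact (vecNorm_add_le _ _).trans (add_le_add (hA v) (hB v))

theorem OpLe.sub {A B : Matrix (Fin m) (Fin n) ℂ} {s t : ℝ} (hA : OpLe A s) (hB : OpLe B t) :
    OpLe (A - B) (s + t) := fun v => by
  rw [Matrix.sub_mulVec, add_mul]
  exact (vecNorm_sub_le _ _).trans (add_le_add (hA v) (hB v))

theorem OpGe.sub {A B : Matrix (Fin m) (Fin n) ℂ} {s t : ℝ} (hA : OpGe A s) (hB : OpLe B t) :
    OpGe (A - B) (s - t) := fun v => by
  have h := vecNorm_add_le ((A - B) *ᵥ v) (B *ᵥ v)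
  rw [← Matrix.add_mulVec, sub_add_cancel] at h
  rw [sub_mul]
  linarith [hA v, hB v]

theorem frobNorm_mul_le {A : Matrix (Fin l) (Fin m) ℂ} {s : ℝ} (hs : 0 ≤ s) (hA : OpLe A s)
    (B : Matrix (Fin m) (Fin n) ℂ) : frobNorm (A * B) ≤ s * frobNorm B := by
  refine le_of_sq_le_sq ?_ (mul_nonneg hs (frobNorm_nonneg _))
  rw [mul_pow, frobNorm_sq_eq_cols, frobNorm_sq_eq_cols, Finset.mul_sum]
  refine Finset.sum_le_sum fun j _ => ?_
  rw [← mul_pow]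
  exact pow_le_pow_left₀ (vecNorm_nonneg _) (hA (B.col j)) 2

theorem le_frobNorm_mul {A : Matrix (Fin l) (Fin m) ℂ} {s : ℝ} (hs : 0 ≤ s) (hA : OpGe A s)
    (B : Matrix (Fin m) (Fin n) ℂ) : s * frobNorm B ≤ frobNorm (A * B) := by
  refine le_of_sq_le_sq ?_ (frobNorm_nonneg _)
  rw [mul_pow, frobNorm_sq_eq_cols, frobNorm_sq_eq_cols, Finset.mul_sum]
  refine Finset.sum_le_sum fun j _ => ?_
  rw [← mul_pow]
  exact pow_le_pow_left₀ (mul_nonneg hs (vecNorm_nonneg _)) (hA (B.col j)) 2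

theorem frobNorm_mul_transpose_le {B : Matrix (Fin l) (Fin m) ℂ} {s : ℝ} (hs : 0 ≤ s)
    (hB : OpLe B s) (A : Matrix (Fin n) (Fin m) ℂ) : frobNorm (A * Bᵀ) ≤ s * frobNorm A := by
  rw [← frobNorm_transpose, Matrix.transpose_mul, Matrix.transpose_transpose,
    ← frobNorm_transpose A]
  exact frobNorm_mul_le hs hB _

theorem le_frobNorm_mul_transpose {B : Matrix (Fin l) (Fin m) ℂ} {s : ℝ} (hs : 0 ≤ s)
    (hB : OpGe B s) (A : Matrix (Fin n) (Fin m) ℂ) : s * frobNorm A ≤ frobNorm (A * Bᵀ) := by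
  rw [← frobNorm_transpose (A * Bᵀ), Matrix.transpose_mul, Matrix.transpose_transpose,
    ← frobNorm_transpose A]
  exact le_frobNorm_mul hs hB _

theorem opLe_frobNorm (A : Matrix (Fin m) (Fin n) ℂ) : OpLe A (frobNorm A) := fun v => by
  refine le_of_sq_le_sq ?_ (mul_nonneg (frobNorm_nonneg _) (vecNorm_nonneg _))
  rw [mul_pow, frobNorm_sq_eq_rows, vecNorm_sq, Finset.sum_mul]
  refine Finset.sum_le_sum fun i _ => ?_
  rw [← mul_pow]
  exact pow_le_pow_left₀ (norm_nonneg _) (norm_dotProduct_le _ _) 2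

theorem OpLe.conjTranspose {A : Matrix (Fin m) (Fin n) ℂ} {s : ℝ} (hs : 0 ≤ s) (hA : OpLe A s) :
    OpLe Aᴴ s := fun w => by
  set v := Aᴴ *ᵥ w with hv
  have h1 : vecNorm v ^ 2 ≤ vecNorm w * (s * vecNorm v) := by
    have e : star v ⬝ᵥ v = star w ⬝ᵥ (A *ᵥ v) := by
      conv_lhs => rw [hv, Matrix.star_mulVec, Matrix.conjTranspose_conjTranspose, ← hv]
      rw [← Matrix.dotProduct_mulVec]
    have h2 := norm_dotProduct_le (star w) (A *ᵥ v)
    rw [← e, star_dotProduct_self, Complex.norm_real, Real.norm_of_nonneg (sq_nonneg _),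
      vecNorm_conj] at h2
    exact h2.trans (mul_le_mul_of_nonneg_left (hA v) (vecNorm_nonneg _))
  rcases (vecNorm_nonneg v).eq_or_lt with h0 | h0
  · rw [← h0]; exact mul_nonneg hs (vecNorm_nonneg _)
  · nlinarith

theorem conjM_mulVec (A : Matrix (Fin m) (Fin n) ℂ) (v : Fin n → ℂ) :
    conjM A *ᵥ v = star (A *ᵥ star v) := by
  ext i
  simp [conjM, Matrix.mulVec, dotProduct]

theorem OpLe.conjM {A : Matrix (Fin m) (Fin n) ℂ} {s : ℝ} (hA : OpLe A s) :
    OpLe (conjM A) s := fun v => by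
  rw [conjM_mulVec, vecNorm_conj, ← vecNorm_conj v]; exact hA _

theorem conjM_conjTranspose (A : Matrix (Fin m) (Fin n) ℂ) : conjM Aᴴ = Aᵀ := by
  ext i j; simp [conjM]

theorem transpose_conjM (A : Matrix (Fin m) (Fin n) ℂ) : (conjM A)ᵀ = Aᴴ := by
  ext i j; simp [conjM]

theorem OpLe.transpose {A : Matrix (Fin m) (Fin n) ℂ} {s : ℝ} (hs : 0 ≤ s) (hA : OpLe A s) :
    OpLe Aᵀ s := by
  rw [← conjM_conjTranspose]; exact (hA.conjTranspose hs).conjM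

theorem vecNorm_mulVec_of_orthonormal {U : Matrix (Fin m) (Fin n) ℂ} (hU : Uᴴ * U = 1)
    (v : Fin n → ℂ) : vecNorm (U *ᵥ v) = vecNorm v := by
  have : vecNorm (U *ᵥ v) ^ 2 = vecNorm v ^ 2 := by
    have h := star_dotProduct_self (U *ᵥ v)
    rw [Matrix.star_mulVec, ← Matrix.dotProduct_mulVec, Matrix.mulVec_mulVec, hU,
      Matrix.one_mulVec, star_dotProduct_self] at h
    exact_mod_cast h.symm
  exact (pow_left_inj₀ (vecNorm_nonneg _) (vecNorm_nonneg _) two_ne_zero).1 this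

theorem opLe_of_orthonormal {U : Matrix (Fin m) (Fin n) ℂ} (hU : Uᴴ * U = 1) : OpLe U 1 :=
  fun v => by rw [vecNorm_mulVec_of_orthonormal hU, one_mul]

theorem opGe_of_orthonormal {U : Matrix (Fin m) (Fin n) ℂ} (hU : Uᴴ * U = 1) : OpGe U 1 :=
  fun v => by rw [vecNorm_mulVec_of_orthonormal hU, one_mul]

theorem vecNorm_diagonal_mulVec_sq (d : Fin n → ℂ) (v : Fin n → ℂ) :
    vecNorm (Matrix.diagonal d *ᵥ v) ^ 2 = ∑ i, ‖d i‖ ^ 2 * ‖v i‖ ^ 2 := by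
  rw [vecNorm_sq]
  simp only [Matrix.mulVec_diagonal, norm_mul, mul_pow]

theorem opLe_diagonal {d : Fin n → ℂ} {s : ℝ} (hs : 0 ≤ s) (hd : ∀ i, ‖d i‖ ≤ s) :
    OpLe (Matrix.diagonal d) s := fun v => by
  refine le_of_sq_le_sq ?_ (mul_nonneg hs (vecNorm_nonneg _))
  rw [vecNorm_diagonal_mulVec_sq, mul_pow, vecNorm_sq, Finset.mul_sum]
  gcongr with i
  exact hd i

theorem opGe_diagonal {d : Fin n → ℂ} {s : ℝ} (hs : 0 ≤ s) (hd : ∀ i, s ≤ ‖d i‖) :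
    OpGe (Matrix.diagonal d) s := fun v => by
  refine le_of_sq_le_sq ?_ (vecNorm_nonneg _)
  rw [vecNorm_diagonal_mulVec_sq, mul_pow, vecNorm_sq, Finset.mul_sum]
  gcongr with i
  exact hd i

theorem isUnit_of_opGe {A : Matrix (Fin n) (Fin n) ℂ} {s : ℝ} (hs : 0 < s) (hA : OpGe A s) :
    IsUnit A := by
  rw [← Matrix.mulVec_injective_iff_isUnit, ← Matrix.coe_mulVecLin, ← LinearMap.ker_eq_bot,
    LinearMap.ker_eq_bot']
  intro v hv
  have := hA v
  rw [Matrix.mulVecLin_apply] at hv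
  rw [hv, vecNorm_zero] at this
  refine vecNorm_eq_zero.1 (le_antisymm ?_ (vecNorm_nonneg _))
  by_contra h
  push Not at h
  nlinarith

/-- Rows of a product `U * Q`. -/
theorem vecNorm_row_mul_le {Q : Matrix (Fin m) (Fin n) ℂ} {s : ℝ} (hs : 0 ≤ s)
    (hQ : OpLe Q s) (U : Matrix (Fin l) (Fin m) ℂ) (i : Fin l) :
    vecNorm ((U * Q) i) ≤ vecNorm (U i) * s := by
  have : (U * Q) i = Qᵀ *ᵥ (U i) := by
    ext j; simp [Matrix.mul_apply, Matrix.mulVec, dotProduct, mul_comm]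
  rw [this, mul_comm]
  exact hQ.transpose hs _

/-- If `U` has orthonormal columns, `Q` inherits operator bounds from `U * Q`. -/
theorem OpLe.of_orthonormal_mul {U : Matrix (Fin l) (Fin m) ℂ} (hU : Uᴴ * U = 1)
    {Q : Matrix (Fin m) (Fin n) ℂ} {s : ℝ} (h : OpLe (U * Q) s) : OpLe Q s := fun v => by
  have := h v
  rwa [← Matrix.mulVec_mulVec, vecNorm_mulVec_of_orthonormal hU] at this

theorem OpGe.of_orthonormal_mul {U : Matrix (Fin l) (Fin m) ℂ} (hU : Uᴴ * U = 1)
    {Q : Matrix (Fin m) (Fin n) ℂ} {s : ℝ} (h : OpGe (U * Q) s) : OpGe Q s := fun v => by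
  have := h v
  rwa [← Matrix.mulVec_mulVec, vecNorm_mulVec_of_orthonormal hU] at this

end Norms

/-! ### The Hankel lifting -/

section Hankel

variable {ns r : ℕ}

/-- The skew diagonal on which an entry lies. -/
def skewIndex (p : Fin ns × Fin ns) : Fin (2 * ns - 1) :=
  ⟨(p.1 : ℕ) + (p.2 : ℕ), by have := p.1.isLt; have := p.2.isLt; omega⟩

/-- The entries of the `a`-th skew diagonal. -/
def skewDiag (a : Fin (2 * ns - 1)) : Finset (Fin ns × Fin ns) :=
  Finset.univ.filter fun p => skewIndex p = a

theorem mem_skewDiag {a : Fin (2 * ns - 1)} {p : Fin ns × Fin ns} :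
    p ∈ skewDiag a ↔ skewIndex p = a := by simp [skewDiag]

theorem card_skewDiag (a : Fin (2 * ns - 1)) : (skewDiag a).card = hw ns a := by
  rw [hw, skewDiag]
  congr 1
  ext p
  simp [skewIndex, Fin.ext_iff]

theorem hw_pos (a : Fin (2 * ns - 1)) : 0 < hw ns a := by
  rw [← card_skewDiag, Finset.card_pos]
  have := a.isLt
  refine ⟨(⟨min (a : ℕ) (ns - 1), by omega⟩, ⟨a - min (a : ℕ) (ns - 1), by omega⟩), ?_⟩
  rw [mem_skewDiag]
  ext
  simp [skewIndex]

theorem sum_skewDiag {E : Type*} [AddCommMonoid E] (f : Fin ns × Fin ns → E) :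
    ∑ a, ∑ p ∈ skewDiag a, f p = ∑ p, f p :=
  Finset.sum_fiberwise Finset.univ skewIndex f

theorem sum_skewDiag_fst_le (a : Fin (2 * ns - 1)) {f : Fin ns → ℝ} (hf : ∀ i, 0 ≤ f i) :
    ∑ p ∈ skewDiag a, f p.1 ≤ ∑ i, f i := by
  have hinj : Set.InjOn (fun p : Fin ns × Fin ns => p.1) (skewDiag a : Set _) := by
    rintro ⟨i, j⟩ hp ⟨i', j'⟩ hq (rfl : i = i')
    have h1 := mem_skewDiag.1 (Finset.mem_coe.1 hp)
    have h2 := mem_skewDiag.1 (Finset.mem_coe.1 hq)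
    rw [← h2] at h1
    simp only [skewIndex, Fin.mk.injEq] at h1
    ext <;> simp; omega
  rw [← Finset.sum_image (f := f) hinj]
  exact Finset.sum_le_sum_of_subset_of_nonneg (Finset.subset_univ _) fun i _ _ => hf i

theorem sum_skewDiag_snd_le (a : Fin (2 * ns - 1)) {f : Fin ns → ℝ} (hf : ∀ i, 0 ≤ f i) :
    ∑ p ∈ skewDiag a, f p.2 ≤ ∑ i, f i := by
  have hinj : Set.InjOn (fun p : Fin ns × Fin ns => p.2) (skewDiag a : Set _) := by
    rintro ⟨i, j⟩ hp ⟨i', j'⟩ hq (rfl : j = j')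
    have h1 := mem_skewDiag.1 (Finset.mem_coe.1 hp)
    have h2 := mem_skewDiag.1 (Finset.mem_coe.1 hq)
    rw [← h2] at h1
    simp only [skewIndex, Fin.mk.injEq] at h1
    ext <;> simp; omega
  rw [← Finset.sum_image (f := f) hinj]
  exact Finset.sum_le_sum_of_subset_of_nonneg (Finset.subset_univ _) fun i _ _ => hf i

theorem Gop_apply (z : Fin (2 * ns - 1) → ℂ) (p : Fin ns × Fin ns) :
    Gop ns z p.1 p.2 = z (skewIndex p) / (√(hw ns (skewIndex p)) : ℝ) := rfl

theorem Gadj_apply (M : Matrix (Fin ns) (Fin ns) ℂ) (a : Fin (2 * ns - 1)) :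
    Gadj ns M a = 1 / (√(hw ns a) : ℝ) * ∑ p ∈ skewDiag a, M p.1 p.2 := by
  rw [Gadj, skewDiag, Finset.sum_filter, Fintype.sum_prod_type]
  simp only [skewIndex, Fin.ext_iff]

theorem sqrt_hw_pos (a : Fin (2 * ns - 1)) : 0 < √(hw ns a : ℝ) :=
  Real.sqrt_pos.2 (by exact_mod_cast hw_pos a)

theorem sq_sqrt_hw (a : Fin (2 * ns - 1)) : √(hw ns a : ℝ) ^ 2 = hw ns a :=
  Real.sq_sqrt (Nat.cast_nonneg _)

theorem Gop_add (z w : Fin (2 * ns - 1) → ℂ) : Gop ns (z + w) = Gop ns z + Gop ns w := by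
  ext i j; simp [Gop, add_div]

theorem Gop_sub (z w : Fin (2 * ns - 1) → ℂ) : Gop ns (z - w) = Gop ns z - Gop ns w := by
  ext i j; simp [Gop, sub_div]

theorem Gop_smul (c : ℂ) (z : Fin (2 * ns - 1) → ℂ) : Gop ns (c • z) = c • Gop ns z := by
  ext i j; simp [Gop, mul_div_assoc]

theorem Gadj_add (A B : Matrix (Fin ns) (Fin ns) ℂ) :
    Gadj ns (A + B) = Gadj ns A + Gadj ns B := by
  ext a; simp [Gadj_apply, Finset.sum_add_distrib, mul_add]

theorem Gadj_sub (A B : Matrix (Fin ns) (Fin ns) ℂ) :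
    Gadj ns (A - B) = Gadj ns A - Gadj ns B := by
  ext a; simp [Gadj_apply, Finset.sum_sub_distrib, mul_sub]

theorem Gadj_transpose (A : Matrix (Fin ns) (Fin ns) ℂ) : Gadj ns Aᵀ = Gadj ns A := by
  ext a
  rw [Gadj, Gadj, Finset.sum_comm]
  simp only [Matrix.transpose_apply, add_comm]

theorem Gadj_Gop (z : Fin (2 * ns - 1) → ℂ) : Gadj ns (Gop ns z) = z := by
  ext a
  have h : ∀ p ∈ skewDiag a, Gop ns z p.1 p.2 = z a / (√(hw ns a) : ℝ) := by
    intro p hp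
    rw [Gop_apply, mem_skewDiag.1 hp]
  rw [Gadj_apply, Finset.sum_congr rfl h, Finset.sum_const, card_skewDiag, nsmul_eq_mul]
  have h0 : ((√(hw ns a : ℝ) : ℝ) : ℂ) ≠ 0 := by exact_mod_cast (sqrt_hw_pos a).ne'
  have h1 : ((hw ns a : ℕ) : ℂ) = ((√(hw ns a : ℝ) : ℝ) : ℂ) ^ 2 := by
    rw [← Complex.ofReal_pow, sq_sqrt_hw]; simp
  rw [h1]
  field_simp

theorem frobInner_Gop (z : Fin (2 * ns - 1) → ℂ) (M : Matrix (Fin ns) (Fin ns) ℂ) :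
    frobInner (Gop ns z) M = ∑ a, (star (z a) * Gadj ns M a).re := by
  rw [frobInner, ← Fintype.sum_prod_type
    (fun p : Fin ns × Fin ns => (star (Gop ns z p.1 p.2) * M p.1 p.2).re), ← sum_skewDiag]
  refine Finset.sum_congr rfl fun a _ => ?_
  rw [Gadj_apply, ← Complex.re_sum]
  congr 1
  rw [Finset.mul_sum, Finset.mul_sum]
  refine Finset.sum_congr rfl fun p hp => ?_
  rw [Gop_apply, mem_skewDiag.1 hp, star_div₀]
  simp only [RCLike.star_def, Complex.conj_ofReal]
  ring

theorem norm_Gadj_sq_le (M : Matrix (Fin ns) (Fin ns) ℂ) (a : Fin (2 * ns - 1)) :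
    ‖Gadj ns M a‖ ^ 2 ≤ 1 / hw ns a * (∑ p ∈ skewDiag a, ‖M p.1 p.2‖) ^ 2 := by
  rw [Gadj_apply, norm_mul, mul_pow, norm_div, norm_one, Complex.norm_real,
    Real.norm_of_nonneg (Real.sqrt_nonneg _), div_pow, one_pow, sq_sqrt_hw]
  gcongr
  exact norm_sum_le _ _

theorem inv_hw_mul_sq_sum_le (f : Fin ns × Fin ns → ℝ) (a : Fin (2 * ns - 1)) :
    1 / hw ns a * (∑ p ∈ skewDiag a, f p) ^ 2 ≤ ∑ p ∈ skewDiag a, f p ^ 2 := by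
  have h0 : (0 : ℝ) < hw ns a := by exact_mod_cast hw_pos a
  rw [one_div_mul_eq_div, div_le_iff₀ h0, mul_comm, ← card_skewDiag]
  exact sq_sum_le_card_mul_sum_sq

theorem norm_Gadj_sq_le_sum (M : Matrix (Fin ns) (Fin ns) ℂ) (a : Fin (2 * ns - 1)) :
    ‖Gadj ns M a‖ ^ 2 ≤ ∑ p ∈ skewDiag a, ‖M p.1 p.2‖ ^ 2 :=
  (norm_Gadj_sq_le M a).trans (inv_hw_mul_sq_sum_le _ a)

theorem sum_norm_Gadj_sq_le (M : Matrix (Fin ns) (Fin ns) ℂ) :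
    ∑ a, ‖Gadj ns M a‖ ^ 2 ≤ frobNorm M ^ 2 := by
  rw [frobNorm_sq, ← Fintype.sum_prod_type (fun p : Fin ns × Fin ns => ‖M p.1 p.2‖ ^ 2),
    ← sum_skewDiag]
  exact Finset.sum_le_sum fun a _ => norm_Gadj_sq_le_sum M a

theorem norm_mul_transpose_apply_le (W X : Matrix (Fin ns) (Fin r) ℂ) (i j : Fin ns) :
    ‖(W * Xᵀ) i j‖ ≤ vecNorm (W i) * vecNorm (X j) :=
  norm_dotProduct_le (W i) (X j)

theorem norm_Gadj_mul_transpose_sq_le (W X : Matrix (Fin ns) (Fin r) ℂ) (a : Fin (2 * ns - 1)) :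
    ‖Gadj ns (W * Xᵀ) a‖ ^ 2
      ≤ 1 / hw ns a * (∑ p ∈ skewDiag a, vecNorm (W p.1) * vecNorm (X p.2)) ^ 2 := by
  refine (norm_Gadj_sq_le _ a).trans ?_
  gcongr
  exact norm_mul_transpose_apply_le W X _ _

theorem norm_Gadj_mul_transpose_sq_le_sum (W X : Matrix (Fin ns) (Fin r) ℂ)
    (a : Fin (2 * ns - 1)) :
    ‖Gadj ns (W * Xᵀ) a‖ ^ 2
      ≤ ∑ p ∈ skewDiag a, vecNorm (W p.1) ^ 2 * vecNorm (X p.2) ^ 2 := by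
  refine (norm_Gadj_mul_transpose_sq_le W X a).trans ((inv_hw_mul_sq_sum_le _ a).trans ?_)
  simp only [mul_pow, le_refl]

theorem norm_Gadj_mul_transpose_sq_le_row (W X : Matrix (Fin ns) (Fin r) ℂ) {b : ℝ}
    (hX : ∀ i, vecNorm (X i) ^ 2 ≤ b) (a : Fin (2 * ns - 1)) :
    ‖Gadj ns (W * Xᵀ) a‖ ^ 2 ≤ frobNorm W ^ 2 * b := by
  refine (norm_Gadj_mul_transpose_sq_le_sum W X a).trans ?_
  calc ∑ p ∈ skewDiag a, vecNorm (W p.1) ^ 2 * vecNorm (X p.2) ^ 2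
      ≤ ∑ p ∈ skewDiag a, vecNorm (W p.1) ^ 2 * b := by
        gcongr with p _; exact hX p.2
    _ = (∑ p ∈ skewDiag a, vecNorm (W p.1) ^ 2) * b := by rw [Finset.sum_mul]
    _ ≤ frobNorm W ^ 2 * b := by
        have hb : skewDiag a = ∅ ∨ 0 ≤ b := by
          rcases (skewDiag a).eq_empty_or_nonempty with h | ⟨p, _⟩
          · exact Or.inl h
          · exact Or.inr ((sq_nonneg _).trans (hX p.2))
        have hb' : 0 ≤ b := hb.resolve_left fun h => by
          have := hw_pos a; rw [← card_skewDiag, h] at this; simp at this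
        gcongr
        rw [frobNorm_sq_eq_rows]
        exact sum_skewDiag_fst_le a (f := fun i => vecNorm (W i) ^ 2) fun i => sq_nonneg _

/-! ### Sampling weights -/

/-- The relative multiplicity with which `a` is sampled. -/
def sampleWeight {N m : ℕ} (ω : Fin m → Fin N) (a : Fin N) : ℝ :=
  (N : ℝ) / m * (Finset.univ.filter fun j => ω j = a).card

theorem sampleWeight_nonneg {N m : ℕ} (ω : Fin m → Fin N) (a : Fin N) : 0 ≤ sampleWeight ω a := by
  unfold sampleWeight; positivity

theorem sum_sampleWeight_smul {N m : ℕ} (ω : Fin m → Fin N) {E : Type*} [AddCommGroup E]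
    [Module ℝ E] (f : Fin N → E) :
    ∑ a, sampleWeight ω a • f a = ((N : ℝ) / m) • ∑ j, f (ω j) := by
  rw [← Finset.sum_fiberwise Finset.univ ω, Finset.smul_sum]
  refine Finset.sum_congr rfl fun a _ => ?_
  rw [Finset.sum_congr rfl (g := fun _ => f a) fun j hj => by rw [(Finset.mem_filter.1 hj).2],
    Finset.sum_const, sampleWeight, mul_smul, Nat.cast_smul_eq_nsmul]

theorem sampleWeight_smul_eq {N m : ℕ} (ω : Fin m → Fin N) (z : Fin N → ℂ) :
    ((N : ℝ) / m) • ∑ j, z (ω j) • (Pi.single (ω j) (1 : ℂ) : Fin N → ℂ)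
      = fun a => (sampleWeight ω a : ℂ) * z a := by
  rw [← sum_sampleWeight_smul ω (fun a => z a • (Pi.single a (1 : ℂ) : Fin N → ℂ))]
  ext b
  rw [Finset.sum_apply, Finset.sum_eq_single b]
  · simp
  · intro a _ hab; simp [hab.symm]
  · simp

theorem gradf_eq {m : ℕ} (y : Fin (2 * ns - 1) → ℂ) (ω : Fin m → Fin (2 * ns - 1))
    (Z : Matrix (Fin ns) (Fin r) ℂ) :
    gradf ns r m y ω Z = ((Z * Zᵀ - Gop ns y)
      + Gop ns (fun a => ((sampleWeight ω a - 1 : ℝ) : ℂ) * Gadj ns (Z * Zᵀ - Gop ns y) a))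
        * conjM Z := by
  set z := Gadj ns (Z * Zᵀ) - y with hz
  have hz' : Gadj ns (Z * Zᵀ - Gop ns y) = z := by rw [Gadj_sub, Gadj_Gop]
  have h1 := sampleWeight_smul_eq ω z
  have h2 : (fun a => ((sampleWeight ω a - 1 : ℝ) : ℂ) * z a)
      = (fun a => (sampleWeight ω a : ℂ) * z a) - z := by
    ext a; simp; ring
  have h3 : Gadj ns (Z * Zᵀ) = z + y := by rw [hz]; simp
  rw [gradf, hz', h2, Gop_sub, ← h1, h3, Gop_add, add_sub_cancel_right, ← Matrix.smul_mul,
    ← Matrix.add_mul]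
  congr 1
  have : ∀ (c : ℝ) (v : Fin (2 * ns - 1) → ℂ), Gop ns (c • v) = c • Gop ns v := by
    intro c v
    have := Gop_smul (c : ℂ) v
    rwa [Complex.coe_smul, Complex.coe_smul] at this
  rw [this]
  abel

/-- The gradient tested against a direction. -/
theorem frobInner_gradf {m : ℕ} (y : Fin (2 * ns - 1) → ℂ) (ω : Fin m → Fin (2 * ns - 1))
    (Z W : Matrix (Fin ns) (Fin r) ℂ) :
    frobInner (gradf ns r m y ω Z) W = frobInner (Z * Zᵀ - Gop ns y) (W * Zᵀ)
      + ∑ a, (sampleWeight ω a - 1)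
        * (star (Gadj ns (Z * Zᵀ - Gop ns y) a) * Gadj ns (W * Zᵀ) a).re := by
  rw [gradf_eq, frobInner_mul_conjM, frobInner_add_left, frobInner_Gop]
  congr 1
  refine Finset.sum_congr rfl fun a _ => ?_
  rw [star_mul', mul_assoc, RCLike.star_def, Complex.conj_ofReal, Complex.re_ofReal_mul]

end Hankel

/-! ### Fourier bound for Hankel forms -/

section Fourier

/-- The characters of `ℤ/N`. -/
def rootPow (N k a : ℕ) : ℂ := (Complex.exp (2 * Real.pi * Complex.I / N) ^ a) ^ k

theorem norm_rootPow (N k a : ℕ) : ‖rootPow N k a‖ = 1 := by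
  have : ‖Complex.exp (2 * Real.pi * Complex.I / N)‖ = 1 := by
    have h := Complex.norm_exp_ofReal_mul_I (2 * Real.pi / N)
    convert h using 3
    push_cast; ring
  rw [rootPow, norm_pow, norm_pow, this]; simp

theorem rootPow_add (N k a b : ℕ) : rootPow N k (a + b) = rootPow N k a * rootPow N k b := by
  rw [rootPow, pow_add, mul_pow]; rfl

theorem sum_rootPow_mul_star {N : ℕ} (a b : Fin N) :
    ∑ k : Fin N, rootPow N k a * star (rootPow N k b) = if a = b then (N : ℂ) else 0 := by
  have hN : N ≠ 0 := by have := a.isLt; omega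
  have hprim := Complex.isPrimitiveRoot_exp N hN
  set ζ := Complex.exp (2 * Real.pi * Complex.I / N) with hζ
  have hstar : ∀ x : ℂ, ‖x‖ = 1 → x * star x = 1 := fun x hx => by
    rw [RCLike.star_def, Complex.mul_conj, Complex.normSq_eq_norm_sq, hx]; simp
  have hnb : ‖ζ ^ (b : ℕ)‖ = 1 := by
    have := norm_rootPow N 1 b; rwa [rootPow, pow_one] at this
  set x := ζ ^ (a : ℕ) * star (ζ ^ (b : ℕ)) with hx
  have hterm : ∀ k : Fin N, rootPow N k a * star (rootPow N k b) = x ^ (k : ℕ) := by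
    intro k
    rw [hx, mul_pow, rootPow, rootPow, star_pow]
  rw [Finset.sum_congr rfl fun k _ => hterm k, Fin.sum_univ_eq_sum_range (fun k => x ^ k)]
  split_ifs with hab
  · have : x = 1 := by rw [hx, hab]; exact hstar _ hnb
    simp [this]
  · have hx1 : x ≠ 1 := by
      intro h
      have h2 : ζ ^ (a : ℕ) = ζ ^ (b : ℕ) := by
        have h3 : x * ζ ^ (b : ℕ) = ζ ^ (a : ℕ) := by
          rw [hx, mul_assoc, mul_comm (star _), hstar _ hnb, mul_one]
        rw [← h3, h, one_mul]
      exact hab (Fin.ext (hprim.pow_inj a.isLt b.isLt h2))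
    have hxN : x ^ N = 1 := by
      rw [hx, mul_pow, ← star_pow, ← pow_mul, ← pow_mul, mul_comm _ N, mul_comm _ N, pow_mul,
        pow_mul, hprim.pow_eq_one]
      simp
    have := geom_sum_mul x N
    rw [hxN, sub_self] at this
    exact (mul_eq_zero.1 this).resolve_right (sub_ne_zero.2 hx1)

theorem sum_norm_sq_dft {N n : ℕ} (hn : n ≤ N) (u : Fin n → ℂ) :
    ∑ k : Fin N, ‖∑ i, u i * rootPow N k i‖ ^ 2 = N * vecNorm u ^ 2 := by
  have hc : ((∑ k : Fin N, ‖∑ i, u i * rootPow N k i‖ ^ 2 : ℝ) : ℂ)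
      = ((N * vecNorm u ^ 2 : ℝ) : ℂ) := by
    have h1 : ∀ k : Fin N, ((‖∑ i, u i * rootPow N k i‖ ^ 2 : ℝ) : ℂ)
        = ∑ i, ∑ j, u i * star (u j) * (rootPow N k i * star (rootPow N k j)) := by
      intro k
      rw [← Complex.normSq_eq_norm_sq, ← Complex.mul_conj, map_sum, Finset.sum_mul_sum]
      refine Finset.sum_congr rfl fun i _ => Finset.sum_congr rfl fun j _ => ?_
      rw [map_mul]; simp only [RCLike.star_def]; ring
    rw [Complex.ofReal_sum, Finset.sum_congr rfl fun k _ => h1 k, Finset.sum_comm]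
    have h2 : ∀ i : Fin n, ∑ k : Fin N, ∑ j, u i * star (u j)
        * (rootPow N k i * star (rootPow N k j)) = N * ((‖u i‖ ^ 2 : ℝ) : ℂ) := by
      intro i
      rw [Finset.sum_comm, Finset.sum_eq_single i]
      · rw [← Finset.mul_sum]
        have := sum_rootPow_mul_star (i.castLE hn) (i.castLE hn)
        simp only [Fin.val_castLE, if_true] at this
        rw [this, RCLike.star_def, Complex.mul_conj, Complex.normSq_eq_norm_sq]; ring
      · intro j _ hj
        rw [← Finset.mul_sum]
        have := sum_rootPow_mul_star (i.castLE hn) (j.castLE hn)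
        simp only [Fin.val_castLE] at this
        rw [this, if_neg, mul_zero]
        intro h; exact hj ((Fin.castLE_injective hn h).symm)
      · simp
    rw [Finset.sum_congr rfl fun i _ => h2 i, ← Finset.mul_sum, ← Complex.ofReal_sum, vecNorm_sq]
    push_cast; rfl
  exact_mod_cast hc

/-- A Hankel form is bounded by the discrete Fourier transform of its symbol. -/
theorem norm_hankel_form_le {ns : ℕ} (h : Fin (2 * ns - 1) → ℂ) {B : ℝ}
    (hB : ∀ k : Fin (2 * ns - 1), ‖∑ a, h a * star (rootPow (2 * ns - 1) k a)‖ ≤ B)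
    (u v : Fin ns → ℂ) :
    ‖∑ p : Fin ns × Fin ns, h (skewIndex p) * (u p.1 * v p.2)‖ ≤ B * (vecNorm u * vecNorm v) := by
  rcases Nat.eq_zero_or_pos ns with rfl | hns
  · simp [vecNorm]
  have hN0 : (0 : ℝ) < (2 * ns - 1 : ℕ) := by exact_mod_cast (show 0 < 2 * ns - 1 by omega)
  have hB0 : 0 ≤ B := (norm_nonneg _).trans (hB ⟨0, by omega⟩)
  have hn : ns ≤ 2 * ns - 1 := by omega
  have inv : ∀ a : Fin (2 * ns - 1), ((2 * ns - 1 : ℕ) : ℂ) * h a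
      = ∑ k : Fin (2 * ns - 1),
        (∑ b, h b * star (rootPow (2 * ns - 1) k b)) * rootPow (2 * ns - 1) k a := by
    intro a
    simp_rw [Finset.sum_mul]
    rw [Finset.sum_comm, Finset.sum_eq_single a]
    · have := sum_rootPow_mul_star a a
      rw [if_pos rfl] at this
      rw [← this, Finset.sum_mul]
      exact Finset.sum_congr rfl fun k _ => by ring
    · intro b _ hb
      have := sum_rootPow_mul_star a b
      rw [if_neg hb.symm] at this
      rw [← mul_zero (h b), ← this, Finset.mul_sum]
      exact Finset.sum_congr rfl fun k _ => by ring
    · simp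
  have key : ((2 * ns - 1 : ℕ) : ℂ) * ∑ p : Fin ns × Fin ns, h (skewIndex p) * (u p.1 * v p.2)
      = ∑ k : Fin (2 * ns - 1), (∑ b, h b * star (rootPow (2 * ns - 1) k b))
        * ((∑ i, u i * rootPow (2 * ns - 1) k i) * (∑ j, v j * rootPow (2 * ns - 1) k j)) := by
    rw [Finset.mul_sum]
    have e : ∀ k : Fin (2 * ns - 1), (∑ i, u i * rootPow (2 * ns - 1) k i)
        * (∑ j, v j * rootPow (2 * ns - 1) k j) = ∑ p : Fin ns × Fin ns,
          u p.1 * rootPow (2 * ns - 1) k p.1 * (v p.2 * rootPow (2 * ns - 1) k p.2) :=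
      fun k => by rw [Finset.sum_mul_sum, Fintype.sum_prod_type]
    simp_rw [e]
    simp_rw [Finset.mul_sum]
    rw [Finset.sum_comm]
    refine Finset.sum_congr rfl fun p _ => ?_
    rw [← mul_assoc, inv, Finset.sum_mul]
    refine Finset.sum_congr rfl fun k _ => ?_
    rw [show ((skewIndex p : Fin (2 * ns - 1)) : ℕ) = p.1 + p.2 from rfl, rootPow_add]
    ring
  have hle : ((2 * ns - 1 : ℕ) : ℝ) * ‖∑ p : Fin ns × Fin ns, h (skewIndex p) * (u p.1 * v p.2)‖
      ≤ (2 * ns - 1 : ℕ) * (B * (vecNorm u * vecNorm v)) := by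
    calc ((2 * ns - 1 : ℕ) : ℝ) * ‖∑ p : Fin ns × Fin ns, h (skewIndex p) * (u p.1 * v p.2)‖
        = ‖((2 * ns - 1 : ℕ) : ℂ) * ∑ p : Fin ns × Fin ns, h (skewIndex p) * (u p.1 * v p.2)‖ := by
          rw [norm_mul, Complex.norm_natCast]
      _ ≤ ∑ k : Fin (2 * ns - 1),
          B * (‖∑ i, u i * rootPow (2 * ns - 1) k i‖ * ‖∑ j, v j * rootPow (2 * ns - 1) k j‖) := by
          rw [key]
          refine (norm_sum_le _ _).trans (Finset.sum_le_sum fun k _ => ?_)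
          rw [norm_mul, norm_mul]
          gcongr
          exact hB k
      _ ≤ B * (√(∑ k : Fin (2 * ns - 1), ‖∑ i, u i * rootPow (2 * ns - 1) k i‖ ^ 2)
            * √(∑ k : Fin (2 * ns - 1), ‖∑ j, v j * rootPow (2 * ns - 1) k j‖ ^ 2)) := by
          rw [← Finset.mul_sum]
          gcongr
          exact Real.sum_mul_le_sqrt_mul_sqrt _ _ _
      _ = (2 * ns - 1 : ℕ) * (B * (vecNorm u * vecNorm v)) := by
          rw [sum_norm_sq_dft hn, sum_norm_sq_dft hn, Real.sqrt_mul hN0.le, Real.sqrt_mul hN0.le,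
            Real.sqrt_sq (vecNorm_nonneg _), Real.sqrt_sq (vecNorm_nonneg _)]
          have := Real.mul_self_sqrt hN0.le
          linear_combination (B * vecNorm u * vecNorm v) * this
  exact le_of_mul_le_mul_left hle hN0

end Fourier

/-! ### Lengths of skew diagonals -/

section Windows

variable {ns : ℕ}

theorem succ_le_hw {a : Fin (2 * ns - 1)} (ha : (a : ℕ) < ns) : (a : ℕ) + 1 ≤ hw ns a := by
  rw [← card_skewDiag, ← Finset.card_range ((a : ℕ) + 1)]
  refine Finset.card_le_card_of_injOn
    (fun k => (⟨min k a, by omega⟩, ⟨(a : ℕ) - k, by omega⟩)) ?_ ?_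
  · intro k hk
    have := Finset.mem_range.1 (Finset.mem_coe.1 hk)
    rw [Finset.mem_coe, mem_skewDiag]
    ext; simp [skewIndex]; omega
  · intro k hk l hl h
    have h1 := Finset.mem_range.1 (Finset.mem_coe.1 hk)
    have h2 := Finset.mem_range.1 (Finset.mem_coe.1 hl)
    simp only [Prod.mk.injEq, Fin.mk.injEq] at h
    omega

theorem sub_le_hw {a : Fin (2 * ns - 1)} (ha : ns ≤ (a : ℕ) + 1) :
    2 * ns - 1 - (a : ℕ) ≤ hw ns a := by
  have hlt := a.isLt
  rw [← card_skewDiag, ← Finset.card_range (2 * ns - 1 - (a : ℕ))]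
  refine Finset.card_le_card_of_injOn
    (fun k => (⟨min ((a : ℕ) - (ns - 1) + k) (ns - 1), by omega⟩, ⟨ns - 1 - k, by omega⟩)) ?_ ?_
  · intro k hk
    have := Finset.mem_range.1 (Finset.mem_coe.1 hk)
    rw [Finset.mem_coe, mem_skewDiag]
    ext; simp [skewIndex]; omega
  · intro k hk l hl h
    have h1 := Finset.mem_range.1 (Finset.mem_coe.1 hk)
    have h2 := Finset.mem_range.1 (Finset.mem_coe.1 hl)
    simp only [Prod.mk.injEq, Fin.mk.injEq] at h
    omega

/-- Few skew diagonals are short. -/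
theorem card_short_skewDiag_le (w : ℝ) (hw0 : 0 ≤ w) :
    ((Finset.univ.filter fun a : Fin (2 * ns - 1) => (hw ns a : ℝ) ≤ w).card : ℝ) ≤ 2 * w := by
  set q := ⌊w⌋₊ with hq
  have hsub : (Finset.univ.filter fun a : Fin (2 * ns - 1) => (hw ns a : ℝ) ≤ w).image
      (fun a : Fin (2 * ns - 1) => (a : ℕ)) ⊆
        Finset.range q ∪ Finset.Ico (2 * ns - 1 - q) (2 * ns - 1) := by
    intro b hb
    obtain ⟨a, ha, rfl⟩ := Finset.mem_image.1 hb
    have h1 : hw ns a ≤ q := Nat.le_floor (Finset.mem_filter.1 ha).2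
    have hlt := a.isLt
    rw [Finset.mem_union, Finset.mem_range, Finset.mem_Ico]
    rcases lt_or_ge (a : ℕ) ns with h | h
    · have := succ_le_hw h; omega
    · have := sub_le_hw (a := a) (by omega); omega
  have hcard := Finset.card_le_card hsub
  rw [Finset.card_image_of_injective _ Fin.val_injective] at hcard
  have h2 := hcard.trans (Finset.card_union_le _ _)
  rw [Finset.card_range, Nat.card_Ico] at h2
  have h3 : (Finset.univ.filter fun a : Fin (2 * ns - 1) => (hw ns a : ℝ) ≤ w).card ≤ 2 * q := by
    omega
  calc _ ≤ ((2 * q : ℕ) : ℝ) := Nat.cast_le.2 h3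
    _ = 2 * (q : ℝ) := by push_cast; ring
    _ ≤ 2 * w := by gcongr; exact Nat.floor_le hw0

/-- The skew diagonals `a` on which the `i`-th row index dominates (is the more central one among
the two indices summing to `a`). -/
def InWindow (i : Fin ns) (a : Fin (2 * ns - 1)) : Prop :=
  ((a : ℕ) < ns ∧ (i : ℕ) ≤ a ∧ (a : ℕ) ≤ 2 * i)
    ∨ (ns ≤ (a : ℕ) ∧ 2 * (i : ℕ) ≤ a ∧ (a : ℕ) < ns + i)

theorem inWindow_or (p : Fin ns × Fin ns) :
    InWindow p.1 (skewIndex p) ∨ InWindow p.2 (skewIndex p) := by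
  have h1 := p.1.isLt
  have h2 := p.2.isLt
  simp only [InWindow, skewIndex]
  omega

theorem sum_window_inv_hw_le (i : Fin ns) :
    ∑ a, (if InWindow i a then 1 / (hw ns a : ℝ) else 0) ≤ 2 := by
  have hi := i.isLt
  have hlow : ∀ a ∈ Finset.univ.filter fun a : Fin (2 * ns - 1) =>
      (a : ℕ) < ns ∧ (i : ℕ) ≤ a ∧ (a : ℕ) ≤ 2 * i, 1 / (hw ns a : ℝ) ≤ 1 / ((i : ℕ) + 1 : ℕ) := by
    intro a ha
    obtain ⟨h1, h2, -⟩ := (Finset.mem_filter.1 ha).2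
    have := succ_le_hw h1
    gcongr; omega
  have hhigh : ∀ a ∈ Finset.univ.filter fun a : Fin (2 * ns - 1) =>
      ns ≤ (a : ℕ) ∧ 2 * (i : ℕ) ≤ a ∧ (a : ℕ) < ns + i,
      1 / (hw ns a : ℝ) ≤ 1 / (ns - i : ℕ) := by
    intro a ha
    obtain ⟨h1, h2, h3⟩ := (Finset.mem_filter.1 ha).2
    have := sub_le_hw (a := a) (by omega)
    have h4 : 0 < ns - (i : ℕ) := by omega
    gcongr; omega
  have c1 : (Finset.univ.filter fun a : Fin (2 * ns - 1) =>
      (a : ℕ) < ns ∧ (i : ℕ) ≤ a ∧ (a : ℕ) ≤ 2 * i).card ≤ (i : ℕ) + 1 := by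
    rw [← Finset.card_image_of_injective _ Fin.val_injective]
    have : ((i : ℕ) + 1) = (Finset.Icc (i : ℕ) (2 * i)).card := by rw [Nat.card_Icc]; omega
    rw [this]
    refine Finset.card_le_card fun b hb => ?_
    obtain ⟨a, ha, rfl⟩ := Finset.mem_image.1 hb
    have := (Finset.mem_filter.1 ha).2
    rw [Finset.mem_Icc]; omega
  have c2 : (Finset.univ.filter fun a : Fin (2 * ns - 1) =>
      ns ≤ (a : ℕ) ∧ 2 * (i : ℕ) ≤ a ∧ (a : ℕ) < ns + i).card ≤ ns - i := by
    rw [← Finset.card_image_of_injective _ Fin.val_injective]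
    have : ns - (i : ℕ) = (Finset.Ico (2 * i : ℕ) (ns + i)).card := by rw [Nat.card_Ico]; omega
    rw [this]
    refine Finset.card_le_card fun b hb => ?_
    obtain ⟨a, ha, rfl⟩ := Finset.mem_image.1 hb
    have := (Finset.mem_filter.1 ha).2
    rw [Finset.mem_Ico]; omega
  have s1 : ∑ a ∈ Finset.univ.filter (fun a : Fin (2 * ns - 1) =>
      (a : ℕ) < ns ∧ (i : ℕ) ≤ a ∧ (a : ℕ) ≤ 2 * i), 1 / (hw ns a : ℝ) ≤ 1 := by
    refine (Finset.sum_le_card_nsmul _ _ _ hlow).trans ?_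
    rw [nsmul_eq_mul, mul_one_div]
    exact div_le_one_of_le₀ (by exact_mod_cast c1) (Nat.cast_nonneg _)
  have s2 : ∑ a ∈ Finset.univ.filter (fun a : Fin (2 * ns - 1) =>
      ns ≤ (a : ℕ) ∧ 2 * (i : ℕ) ≤ a ∧ (a : ℕ) < ns + i), 1 / (hw ns a : ℝ) ≤ 1 := by
    refine (Finset.sum_le_card_nsmul _ _ _ hhigh).trans ?_
    rw [nsmul_eq_mul, mul_one_div]
    exact div_le_one_of_le₀ (by exact_mod_cast c2) (Nat.cast_nonneg _)
  rw [← Finset.sum_filter]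
  have : (Finset.univ.filter fun a => InWindow i a) =
      (Finset.univ.filter (fun a : Fin (2 * ns - 1) =>
      (a : ℕ) < ns ∧ (i : ℕ) ≤ a ∧ (a : ℕ) ≤ 2 * i)) ∪ Finset.univ.filter
      (fun a : Fin (2 * ns - 1) => ns ≤ (a : ℕ) ∧ 2 * (i : ℕ) ≤ a ∧ (a : ℕ) < ns + i) := by
    ext a
    rw [Finset.mem_union, Finset.mem_filter, Finset.mem_filter, Finset.mem_filter]
    simp only [Finset.mem_univ, true_and, InWindow]
  rw [this, Finset.sum_union]
  · linarith
  · rw [Finset.disjoint_filter]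
    intro a _ h1 h2; omega

end Windows

/-! ### Good samples -/

section Good

variable {ns r m : ℕ}

/-- The deterministic properties of a sample used by the convergence proof, for a matrix `U` with
rows of squared length at most `ν` and a symbol `h`. -/
structure GoodSample (U : Matrix (Fin ns) (Fin r) ℂ) (h : Fin (2 * ns - 1) → ℂ) (δ ν b : ℝ)
    (ω : Fin m → Fin (2 * ns - 1)) : Prop where
  symbol : ∀ k : Fin (2 * ns - 1), ‖∑ a, (sampleWeight ω a - 1) •
    (h a * star (rootPow (2 * ns - 1) k a))‖ ≤ b
  tangent : ∀ X : Matrix (Fin ns) (Fin r) ℂ,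
    |∑ a, (sampleWeight ω a - 1) * ‖Gadj ns (X * Uᵀ) a‖ ^ 2|
      ≤ (2 * ns - 1 : ℕ) * δ * ν * frobNorm X ^ 2
  short : ∑ a : Fin (2 * ns - 1),
    (if (hw ns a : ℝ) ≤ (2 * ns - 1 : ℕ) * δ then sampleWeight ω a else 0)
    ≤ 3 * ((2 * ns - 1 : ℕ) * δ)
  window : ∀ i : Fin ns, ∑ a, (if InWindow i a ∧ ((2 * ns - 1 : ℕ) * δ : ℝ) < hw ns a then
    sampleWeight ω a / hw ns a else 0) ≤ 3

theorem card_weighted_deviation_le {E : Type*} [NormedAddCommGroup E] [InnerProductSpace ℝ E]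
    {N : ℕ} (hN : 0 < N) (g : Fin N → E) {L V δ : ℝ} (hm : 0 < m)
    (hV : 0 < V) (hδ : 0 ≤ δ) (hL : ∀ a, ‖g a‖ ≤ L) (hgV : ∑ a, ‖g a‖ ^ 2 ≤ N * V)
    (hLV : δ * L ≤ √V) (hδm : m * δ ^ 2 = 12 * Real.log N) :
    ((Finset.univ.filter fun ω : Fin m → Fin N => N * δ * √V
        < ‖∑ a, (sampleWeight ω a - 1) • g a‖).card : ℝ) ≤ 2 / (N : ℝ) ^ 3 * (N : ℝ) ^ m := by
  have : Nonempty (Fin N) := ⟨⟨0, hN⟩⟩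
  have h := card_sampling_deviation_le g hm hV hδ hL (by simpa using hgV) hLV (by simpa using hδm)
  simp only [Fintype.card_fin] at h
  refine le_of_eq_of_le ?_ h
  congr 3
  ext ω
  rw [← sum_sampleWeight_smul, ← Finset.sum_sub_distrib]
  simp only [sub_smul, one_smul]

/-- `Gadj (X Uᵀ)` at `a` as a linear functional of `X`. -/
def tangentVec (U : Matrix (Fin ns) (Fin r) ℂ) (a : Fin (2 * ns - 1)) (p : Fin ns × Fin r) : ℂ :=
  1 / (√(hw ns a) : ℝ) * ∑ j : Fin ns, if (p.1 : ℕ) + (j : ℕ) = (a : ℕ) then U j p.2 else 0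

theorem Gadj_mul_transpose_eq (U X : Matrix (Fin ns) (Fin r) ℂ) (a : Fin (2 * ns - 1)) :
    Gadj ns (X * Uᵀ) a = ∑ p : Fin ns × Fin r, X p.1 p.2 * tangentVec U a p := by
  simp only [Gadj, tangentVec, Fintype.sum_prod_type, Finset.mul_sum]
  refine Finset.sum_congr rfl fun i _ => ?_
  rw [Finset.sum_comm]
  refine Finset.sum_congr rfl fun j _ => ?_
  split_ifs with h
  · rw [Matrix.mul_apply, Finset.mul_sum]
    exact Finset.sum_congr rfl fun k _ => by rw [Matrix.transpose_apply]; ring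
  · simp

theorem sum_norm_tangentVec_sq_le {U : Matrix (Fin ns) (Fin r) ℂ} {ν : ℝ}
    (hU : ∀ i, vecNorm (U i) ^ 2 ≤ ν) (a : Fin (2 * ns - 1)) :
    ∑ p, ‖tangentVec U a p‖ ^ 2 ≤ ν := by
  set X : Matrix (Fin ns) (Fin r) ℂ := fun i k => star (tangentVec U a (i, k)) with hX
  have hF : frobNorm X ^ 2 = ∑ p, ‖tangentVec U a p‖ ^ 2 := by
    rw [frobNorm_sq, Fintype.sum_prod_type]; simp [hX]
  have h1 := norm_Gadj_mul_transpose_sq_le_row X U hU a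
  have h2 : Gadj ns (X * Uᵀ) a = ((∑ p, ‖tangentVec U a p‖ ^ 2 : ℝ) : ℂ) := by
    rw [Gadj_mul_transpose_eq, Complex.ofReal_sum]
    refine Finset.sum_congr rfl fun p _ => ?_
    rw [hX, RCLike.star_def, ← Complex.normSq_eq_conj_mul_self, Complex.normSq_eq_norm_sq]
  rw [h2, Complex.norm_real, hF, Real.norm_eq_abs, sq_abs] at h1
  set S := ∑ p, ‖tangentVec U a p‖ ^ 2
  rcases (show 0 ≤ S by positivity).eq_or_lt with h0 | h0
  · rw [← h0]
    have ha := hw_pos a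
    rw [← card_skewDiag, Finset.card_pos] at ha
    exact (sq_nonneg _).trans (hU ha.choose.1)
  · rw [sq] at h1
    exact le_of_mul_le_mul_left h1 h0

/-- The rank one operators `ξ ξᴴ` attached to `tangentVec`. -/
def tangentOuter (U : Matrix (Fin ns) (Fin r) ℂ) (a : Fin (2 * ns - 1)) :
    EuclideanSpace ℂ ((Fin ns × Fin r) × (Fin ns × Fin r)) :=
  WithLp.toLp 2 fun q => tangentVec U a q.1 * star (tangentVec U a q.2)

theorem norm_tangentOuter (U : Matrix (Fin ns) (Fin r) ℂ) (a : Fin (2 * ns - 1)) :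
    ‖tangentOuter U a‖ = ∑ p, ‖tangentVec U a p‖ ^ 2 := by
  rw [EuclideanSpace.norm_eq, Fintype.sum_prod_type]
  simp only [tangentOuter, norm_mul, norm_star, mul_pow]
  rw [← Finset.sum_mul_sum, Real.sqrt_mul_self (by positivity)]

theorem abs_sum_tangent_le (U X : Matrix (Fin ns) (Fin r) ℂ) (d : Fin (2 * ns - 1) → ℝ) :
    |∑ a, d a * ‖Gadj ns (X * Uᵀ) a‖ ^ 2| ≤ ‖∑ a, d a • tangentOuter U a‖ * frobNorm X ^ 2 := by
  set T := ∑ a, d a • tangentOuter U a with hT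
  have hTq : ∀ q, T q = ∑ a, (d a : ℂ) * (tangentVec U a q.1 * star (tangentVec U a q.2)) := by
    intro q
    have : T q = ∑ a, (d a • tangentOuter U a) q := by
      simp only [hT, WithLp.ofLp_sum, Finset.sum_apply]
    rw [this]
    rfl
  have e : ((∑ a, d a * ‖Gadj ns (X * Uᵀ) a‖ ^ 2 : ℝ) : ℂ)
      = ∑ q : (Fin ns × Fin r) × (Fin ns × Fin r),
        T q * (X q.1.1 q.1.2 * star (X q.2.1 q.2.2)) := by
    have h1 : ∀ a, ((‖Gadj ns (X * Uᵀ) a‖ ^ 2 : ℝ) : ℂ)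
        = ∑ q : (Fin ns × Fin r) × (Fin ns × Fin r), (tangentVec U a q.1 * star (tangentVec U a q.2))
          * (X q.1.1 q.1.2 * star (X q.2.1 q.2.2)) := by
      intro a
      rw [← Complex.normSq_eq_norm_sq, ← Complex.mul_conj, Gadj_mul_transpose_eq, map_sum,
        Finset.sum_mul_sum]
      conv_rhs => rw [Fintype.sum_prod_type]
      refine Finset.sum_congr rfl fun i _ => Finset.sum_congr rfl fun j _ => ?_
      rw [map_mul]; simp only [RCLike.star_def]; ring
    rw [Complex.ofReal_sum]
    simp_rw [Complex.ofReal_mul, h1, Finset.mul_sum, hTq, Finset.sum_mul]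
    rw [Finset.sum_comm]
    exact Finset.sum_congr rfl fun q _ => Finset.sum_congr rfl fun a _ => by ring
  have h2 : |∑ a, d a * ‖Gadj ns (X * Uᵀ) a‖ ^ 2|
      ≤ ∑ q : (Fin ns × Fin r) × (Fin ns × Fin r), ‖T q‖ * (‖X q.1.1 q.1.2‖ * ‖X q.2.1 q.2.2‖) := by
    rw [← Real.norm_eq_abs, ← Complex.norm_real, e]
    refine (norm_sum_le _ _).trans (Finset.sum_le_sum fun q _ => ?_)
    rw [norm_mul, norm_mul, norm_star]
  refine h2.trans ((Real.sum_mul_le_sqrt_mul_sqrt _ _ _).trans (le_of_eq ?_))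
  rw [EuclideanSpace.norm_eq]
  congr 1
  rw [Fintype.sum_prod_type]
  simp only [mul_pow]
  have hF : frobNorm X ^ 2 = ∑ p : Fin ns × Fin r, ‖X p.1 p.2‖ ^ 2 := by
    rw [frobNorm_sq, Fintype.sum_prod_type]
  rw [← Finset.sum_mul_sum (f := fun p : Fin ns × Fin r => ‖X p.1 p.2‖ ^ 2), ← hF,
    Real.sqrt_mul_self (sq_nonneg _)]

end Good

section GoodCount

variable {ns r m : ℕ}

theorem sum_short_le {δ : ℝ} (hδ : 0 ≤ δ) (ω : Fin m → Fin (2 * ns - 1))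
    (h : ‖∑ a : Fin (2 * ns - 1), (sampleWeight ω a - 1) •
      (if (hw ns a : ℝ) ≤ (2 * ns - 1 : ℕ) * δ then (1 : ℝ) else 0)‖
        ≤ (2 * ns - 1 : ℕ) * δ * √1) :
    ∑ a : Fin (2 * ns - 1), (if (hw ns a : ℝ) ≤ (2 * ns - 1 : ℕ) * δ then sampleWeight ω a else 0)
      ≤ 3 * ((2 * ns - 1 : ℕ) * δ) := by
  have hc := card_short_skewDiag_le (ns := ns) ((2 * ns - 1 : ℕ) * δ) (by positivity)
  have e : ∑ a : Fin (2 * ns - 1), (sampleWeight ω a - 1) •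
      (if (hw ns a : ℝ) ≤ (2 * ns - 1 : ℕ) * δ then (1 : ℝ) else 0)
      = ∑ a : Fin (2 * ns - 1),
        (if (hw ns a : ℝ) ≤ (2 * ns - 1 : ℕ) * δ then sampleWeight ω a else 0)
        - (Finset.univ.filter fun a : Fin (2 * ns - 1) =>
          (hw ns a : ℝ) ≤ (2 * ns - 1 : ℕ) * δ).card := by
    rw [Finset.card_filter, Nat.cast_sum, ← Finset.sum_sub_distrib]
    refine Finset.sum_congr rfl fun a _ => ?_
    split_ifs <;> simp
  rw [e, Real.sqrt_one, mul_one, Real.norm_eq_abs] at h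
  have := (abs_le.1 h).2
  linarith

theorem sum_window_le {δ : ℝ} (ω : Fin m → Fin (2 * ns - 1)) (i : Fin ns)
    (h : ‖∑ a : Fin (2 * ns - 1), (sampleWeight ω a - 1) •
      (if InWindow i a ∧ ((2 * ns - 1 : ℕ) * δ : ℝ) < hw ns a then 1 / (hw ns a : ℝ) else 0)‖
        ≤ 1) :
    ∑ a : Fin (2 * ns - 1), (if InWindow i a ∧ ((2 * ns - 1 : ℕ) * δ : ℝ) < hw ns a then
      sampleWeight ω a / hw ns a else 0) ≤ 3 := by
  have hc := sum_window_inv_hw_le i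
  have e : ∑ a : Fin (2 * ns - 1), (sampleWeight ω a - 1) •
      (if InWindow i a ∧ ((2 * ns - 1 : ℕ) * δ : ℝ) < hw ns a then 1 / (hw ns a : ℝ) else 0)
      = ∑ a : Fin (2 * ns - 1), (if InWindow i a ∧ ((2 * ns - 1 : ℕ) * δ : ℝ) < hw ns a then
          sampleWeight ω a / hw ns a else 0)
        - ∑ a : Fin (2 * ns - 1), (if InWindow i a ∧ ((2 * ns - 1 : ℕ) * δ : ℝ) < hw ns a then
          1 / (hw ns a : ℝ) else 0) := by
    rw [← Finset.sum_sub_distrib]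
    refine Finset.sum_congr rfl fun a _ => ?_
    split_ifs
    · rw [smul_eq_mul]; ring
    · simp
  have h2 : ∑ a : Fin (2 * ns - 1), (if InWindow i a ∧ ((2 * ns - 1 : ℕ) * δ : ℝ) < hw ns a then
          1 / (hw ns a : ℝ) else 0) ≤ ∑ a, (if InWindow i a then 1 / (hw ns a : ℝ) else 0) := by
    refine Finset.sum_le_sum fun a _ => ?_
    by_cases h1 : InWindow i a <;> by_cases h2 : ((2 * ns - 1 : ℕ) * δ : ℝ) < hw ns a <;>
      simp [h1, h2]
  rw [e, Real.norm_eq_abs] at h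
  have := (abs_le.1 h).2
  linarith

/-- Most samples are good. -/
theorem card_not_goodSample_le (hns : 2 ≤ ns) (hm : 0 < m) {U : Matrix (Fin ns) (Fin r) ℂ}
    {h : Fin (2 * ns - 1) → ℂ} {δ ν L V : ℝ} (hδ : 0 < δ) (hδ2 : δ ≤ 1 / 2) (hν : 0 < ν)
    (hV : 0 < V)
    (hU : ∀ i, vecNorm (U i) ^ 2 ≤ ν) (hL : ∀ a, ‖h a‖ ≤ L)
    (hgV : ∑ a, ‖h a‖ ^ 2 ≤ (2 * ns - 1 : ℕ) * V) (hLV : δ * L ≤ √V)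
    (hδm : m * δ ^ 2 = 12 * Real.log (2 * ns - 1 : ℕ)) :
    ((Finset.univ.filter fun ω : Fin m → Fin (2 * ns - 1) =>
        ¬ GoodSample U h δ ν ((2 * ns - 1 : ℕ) * δ * √V) ω).card : ℝ)
      ≤ 8 / ((2 * ns - 1 : ℕ) : ℝ) ^ 2 * ((2 * ns - 1 : ℕ) : ℝ) ^ m := by
  have hδ1 : δ ≤ 1 := by linarith
  have hN : 0 < 2 * ns - 1 := by omega
  have hNR : (0 : ℝ) < (2 * ns - 1 : ℕ) := by exact_mod_cast hN
  have b1 := fun k : Fin (2 * ns - 1) => card_weighted_deviation_le hN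
    (fun a => h a * star (rootPow (2 * ns - 1) k a)) hm hV hδ.le
    (fun a => by rw [norm_mul, norm_star, norm_rootPow, mul_one]; exact hL a)
    (by simpa only [norm_mul, norm_star, norm_rootPow, mul_one] using hgV) hLV hδm
  have b3 := card_weighted_deviation_le hN (tangentOuter U) (L := ν) (V := ν ^ 2) hm (by positivity)
    hδ.le (fun a => by rw [norm_tangentOuter]; exact sum_norm_tangentVec_sq_le hU a)
    (by
      refine (Finset.sum_le_sum (g := fun _ => ν ^ 2) fun a _ => ?_).trans (by simp)
      rw [norm_tangentOuter]
      exact pow_le_pow_left₀ (by positivity) (sum_norm_tangentVec_sq_le hU a) 2)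
    (by rw [Real.sqrt_sq hν.le]; nlinarith) hδm
  have b4 := card_weighted_deviation_le hN (fun a : Fin (2 * ns - 1) =>
    (if (hw ns a : ℝ) ≤ (2 * ns - 1 : ℕ) * δ then (1 : ℝ) else 0)) (L := 1) (V := 1) hm one_pos hδ.le
    (fun a => by split_ifs <;> simp)
    (by
      refine (Finset.sum_le_sum (g := fun _ => 1) fun a _ => ?_).trans (by simp)
      split_ifs <;> simp) (by simpa using hδ1) hδm
  have b5 := fun i : Fin ns => card_weighted_deviation_le hN (fun a : Fin (2 * ns - 1) =>
    (if InWindow i a ∧ ((2 * ns - 1 : ℕ) * δ : ℝ) < hw ns a then 1 / (hw ns a : ℝ) else 0))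
    (L := 1 / ((2 * ns - 1 : ℕ) * δ)) (V := 2 / (((2 * ns - 1 : ℕ) : ℝ) ^ 2 * δ)) hm
    (by positivity) hδ.le
    (fun a => by
      split_ifs with hh
      · rw [Real.norm_of_nonneg (by positivity)]
        exact one_div_le_one_div_of_le (by positivity) hh.2.le
      · rw [norm_zero]; positivity)
    (by
      have hc := sum_window_inv_hw_le i
      calc ∑ a : Fin (2 * ns - 1), ‖(if InWindow i a ∧ ((2 * ns - 1 : ℕ) * δ : ℝ) < hw ns a
            then 1 / (hw ns a : ℝ) else 0)‖ ^ 2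
          ≤ ∑ a, 1 / ((2 * ns - 1 : ℕ) * δ)
              * (if InWindow i a then 1 / (hw ns a : ℝ) else 0) := by
            refine Finset.sum_le_sum fun a _ => ?_
            by_cases h1 : InWindow i a
            · by_cases h2 : ((2 * ns - 1 : ℕ) * δ : ℝ) < hw ns a
              · rw [if_pos ⟨h1, h2⟩, if_pos h1, Real.norm_of_nonneg (by positivity), sq]
                gcongr
              · rw [if_neg fun h3 => h2 h3.2, if_pos h1, norm_zero, zero_pow two_ne_zero]
                positivity
            · rw [if_neg fun h3 => h1 h3.1, if_neg h1]; simp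
        _ ≤ 1 / ((2 * ns - 1 : ℕ) * δ) * 2 := by
            rw [← Finset.mul_sum]; gcongr
        _ = _ := by field_simp)
    (by
      refine Real.le_sqrt_of_sq_le ?_
      rw [show δ * (1 / ((2 * ns - 1 : ℕ) * δ)) = 1 / ((2 * ns - 1 : ℕ) : ℝ) by field_simp, div_pow,
        one_pow, div_le_div_iff₀ (by positivity) (by positivity)]
      nlinarith [sq_nonneg ((2 * ns - 1 : ℕ) : ℝ), mul_pos hNR hNR]) hδm
  set t : ℝ := 2 / ((2 * ns - 1 : ℕ) : ℝ) ^ 3 * ((2 * ns - 1 : ℕ) : ℝ) ^ m with ht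
  have hsub : (Finset.univ.filter fun ω : Fin m → Fin (2 * ns - 1) =>
        ¬ GoodSample U h δ ν ((2 * ns - 1 : ℕ) * δ * √V) ω) ⊆
      ((Finset.univ.biUnion fun k : Fin (2 * ns - 1) => Finset.univ.filter
        fun ω : Fin m → Fin (2 * ns - 1) => (2 * ns - 1 : ℕ) * δ * √V < ‖∑ a, (sampleWeight ω a - 1) •
        (h a * star (rootPow (2 * ns - 1) k a))‖) ∪
      ((Finset.univ.filter fun ω : Fin m → Fin (2 * ns - 1) => (2 * ns - 1 : ℕ) * δ * √(ν ^ 2)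
        < ‖∑ a, (sampleWeight ω a - 1) • tangentOuter U a‖) ∪
      (Finset.univ.filter fun ω : Fin m → Fin (2 * ns - 1) => (2 * ns - 1 : ℕ) * δ * √1
        < ‖∑ a : Fin (2 * ns - 1), (sampleWeight ω a - 1) •
          (if (hw ns a : ℝ) ≤ (2 * ns - 1 : ℕ) * δ then (1 : ℝ) else 0)‖))) ∪
      (Finset.univ.biUnion fun i : Fin ns => Finset.univ.filter fun ω : Fin m → Fin (2 * ns - 1) =>
        (2 * ns - 1 : ℕ) * δ * √(2 / (((2 * ns - 1 : ℕ) : ℝ) ^ 2 * δ))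
        < ‖∑ a : Fin (2 * ns - 1), (sampleWeight ω a - 1) •
          (if InWindow i a ∧ ((2 * ns - 1 : ℕ) * δ : ℝ) < hw ns a then
            1 / (hw ns a : ℝ) else 0)‖) := by
    intro ω hω
    by_contra hno
    simp only [Finset.mem_union, Finset.mem_biUnion, Finset.mem_filter, Finset.mem_univ, true_and,
      not_or, not_exists, not_lt] at hno
    obtain ⟨⟨h1, h3, h4⟩, h5⟩ := hno
    refine (Finset.mem_filter.1 hω).2 ⟨h1, fun X => ?_, ?_, fun i => ?_⟩
    · refine (abs_sum_tangent_le U X _).trans ?_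
      rw [Real.sqrt_sq hν.le] at h3
      gcongr
    · exact sum_short_le hδ.le ω h4
    · refine sum_window_le ω i ((h5 i).trans ?_)
      refine le_of_sq_le_sq ?_ zero_le_one
      rw [mul_pow, Real.sq_sqrt (by positivity)]
      field_simp
      nlinarith
  have hbig := (Finset.card_le_card hsub).trans ((Finset.card_union_le _ _).trans
    (Nat.add_le_add ((Finset.card_union_le _ _).trans (Nat.add_le_add
      Finset.card_biUnion_le (Finset.card_union_le _ _))) Finset.card_biUnion_le))
  have hbigR := (Nat.cast_le (α := ℝ)).2 hbig
  push_cast only [Nat.cast_add, Nat.cast_sum] at hbigR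
  have s1 := Finset.sum_le_sum fun k (_ : k ∈ Finset.univ) => b1 k
  have s5 := Finset.sum_le_sum fun k (_ : k ∈ Finset.univ) => b5 k
  rw [Finset.sum_const, Finset.card_univ, Fintype.card_fin, nsmul_eq_mul] at s1 s5
  have ht0 : 0 ≤ t := by positivity
  have hns' : (2 : ℝ) + ns + (2 * ns - 1 : ℕ) ≤ 4 * (2 * ns - 1 : ℕ) := by
    have : 2 + ns + (2 * ns - 1) ≤ 4 * (2 * ns - 1) := by omega
    exact_mod_cast this
  calc _ ≤ (2 * ns - 1 : ℕ) * t + (t + t) + ns * t :=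
        hbigR.trans (add_le_add (add_le_add s1 (add_le_add b3 b4)) s5)
    _ = (2 + ns + (2 * ns - 1 : ℕ)) * t := by ring
    _ ≤ (4 * (2 * ns - 1 : ℕ)) * t := by gcongr
    _ = _ := by rw [ht]; field_simp; norm_num

/-- Independent repetitions of an event on a finite sample space. -/
theorem card_forall_ge {α : Type*} [Fintype α] (G : α → Prop) {p : ℝ}
    (hp : ((Finset.univ.filter fun ω => ¬ G ω).card : ℝ) ≤ p * Fintype.card α)
    (K : ℕ) :
    (1 - K * p) * Fintype.card (Fin K → α)
      ≤ ((Finset.univ.filter fun ω : Fin K → α => ∀ k, G (ω k)).card : ℝ) := by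
  have e : (Finset.univ.filter fun ω : Fin K → α => ∀ k, G (ω k))
      = Fintype.piFinset fun _ => Finset.univ.filter G := by
    ext ω; simp
  rw [e, Fintype.card_piFinset_const, Fintype.card_fun, Fintype.card_fin]
  have h1 : ((Finset.univ.filter G).card : ℝ) + (Finset.univ.filter fun ω => ¬ G ω).card
      = Fintype.card α := by
    exact_mod_cast Finset.card_filter_add_card_filter_not (s := Finset.univ) G
  push_cast
  rcases le_or_gt p 1 with hp1 | hp1
  · have hb := one_add_mul_le_pow (a := -p) (by linarith) K
    calc (1 - K * p) * (Fintype.card α : ℝ) ^ K ≤ (1 + -p) ^ K * (Fintype.card α : ℝ) ^ K := by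
          gcongr; linarith
      _ = ((1 - p) * Fintype.card α) ^ K := by rw [← mul_pow]; ring
      _ ≤ _ := by
          gcongr
          · have : (0 : ℝ) ≤ Fintype.card α := by positivity
            nlinarith
  · rcases Nat.eq_zero_or_pos K with rfl | hK
    · simp
    · have hK' : (1 : ℝ) ≤ K := by exact_mod_cast hK
      have : (1 - K * p) * (Fintype.card α : ℝ) ^ K ≤ 0 :=
        mul_nonpos_of_nonpos_of_nonneg (by nlinarith) (by positivity)
      exact this.trans (by positivity)

end GoodCount

section Clipping

variable {ns r : ℕ} {τ : ℝ}

theorem projC_row (Z : Matrix (Fin ns) (Fin r) ℂ) (i : Fin ns) :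
    projC τ Z i = if vecNorm (Z i) ≤ τ then Z i else ((τ / vecNorm (Z i) : ℝ) : ℂ) • Z i := by
  ext j
  unfold projC
  split_ifs <;> simp

theorem vecNorm_projC_row_le (hτ : 0 ≤ τ) (Z : Matrix (Fin ns) (Fin r) ℂ) (i : Fin ns) :
    vecNorm (projC τ Z i) ≤ τ := by
  rw [projC_row]
  split_ifs with h
  · exact h
  · have hv : 0 < vecNorm (Z i) := hτ.trans_lt (not_le.1 h)
    rw [vecNorm_smul, Complex.norm_real, Real.norm_of_nonneg (by positivity),
      div_mul_cancel₀ _ hv.ne']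

theorem norm_clip_sub_le {E : Type*} [NormedAddCommGroup E] [InnerProductSpace ℝ E] {v a : E}
    (hv : τ < ‖v‖) (ha : ‖a‖ ≤ τ) : ‖(τ / ‖v‖) • v - a‖ ≤ ‖v - a‖ := by
  have hτ : 0 ≤ τ := (norm_nonneg a).trans ha
  have hv0 : 0 < ‖v‖ := hτ.trans_lt hv
  refine le_of_sq_le_sq ?_ (norm_nonneg _)
  rw [norm_sub_sq_real, norm_sub_sq_real, real_inner_smul_left, norm_smul,
    Real.norm_of_nonneg (by positivity), div_mul_cancel₀ _ hv0.ne']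
  have h1 : inner ℝ v a ≤ ‖v‖ * τ := (real_inner_le_norm v a).trans (by gcongr)
  have hc : τ / ‖v‖ * ‖v‖ = τ := div_mul_cancel₀ _ hv0.ne'
  have hc1 : τ / ‖v‖ ≤ 1 := (div_le_one hv0).2 hv.le
  nlinarith [mul_le_mul_of_nonneg_left h1 (sub_nonneg.2 hc1), sq_nonneg (‖v‖ - τ)]

theorem frobNorm_projC_sub_le {A : Matrix (Fin ns) (Fin r) ℂ} (hA : ∀ i, vecNorm (A i) ≤ τ)
    (Z : Matrix (Fin ns) (Fin r) ℂ) : frobNorm (projC τ Z - A) ≤ frobNorm (Z - A) := by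
  refine le_of_sq_le_sq ?_ (frobNorm_nonneg _)
  rw [frobNorm_sq_eq_rows, frobNorm_sq_eq_rows]
  refine Finset.sum_le_sum fun i _ => pow_le_pow_left₀ (vecNorm_nonneg _) ?_ 2
  rw [show (projC τ Z - A) i = projC τ Z i - A i from rfl, show (Z - A) i = Z i - A i from rfl,
    projC_row]
  split_ifs with h
  · exact le_rfl
  · have h1 := hA i
    rw [not_le] at h
    simp only [vecNorm_eq_norm] at h h1 ⊢
    exact norm_clip_sub_le h h1

end Clipping

section SampledNorm

variable {ns r m : ℕ} {U : Matrix (Fin ns) (Fin r) ℂ} {h : Fin (2 * ns - 1) → ℂ} {δ ν b : ℝ}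
  {ω : Fin m → Fin (2 * ns - 1)}

theorem sq_skewDiag_le (x y : Fin ns → ℝ) (a : Fin (2 * ns - 1)) :
    (∑ p ∈ skewDiag a, x p.1 * y p.2) ^ 2
      ≤ 2 * ((∑ i, if InWindow i a then x i ^ 2 else 0) * ∑ j, y j ^ 2)
        + 2 * ((∑ i, x i ^ 2) * ∑ j, if InWindow j a then y j ^ 2 else 0) := by
  set x' : Fin ns → ℝ := fun i => if InWindow i a then x i else 0
  set y' : Fin ns → ℝ := fun j => if InWindow j a then y j else 0
  have hx' : ∀ i, x' i ^ 2 = if InWindow i a then x i ^ 2 else 0 := fun i => by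
    simp only [x']; split_ifs <;> simp
  have hy' : ∀ i, y' i ^ 2 = if InWindow i a then y i ^ 2 else 0 := fun i => by
    simp only [y']; split_ifs <;> simp
  have key : ∀ f g : Fin ns → ℝ, (∑ p ∈ skewDiag a, |f p.1| * |g p.2|) ^ 2
      ≤ (∑ i, f i ^ 2) * ∑ j, g j ^ 2 := fun f g => by
    refine (Finset.sum_mul_sq_le_sq_mul_sq _ (fun p : Fin ns × Fin ns => |f p.1|)
      (fun p => |g p.2|)).trans ?_
    simp only [sq_abs]
    exact mul_le_mul (sum_skewDiag_fst_le a fun i => sq_nonneg (f i))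
      (sum_skewDiag_snd_le a fun i => sq_nonneg (g i))
      (Finset.sum_nonneg fun _ _ => sq_nonneg _) (Finset.sum_nonneg fun _ _ => sq_nonneg _)
  have h1 : |∑ p ∈ skewDiag a, x p.1 * y p.2|
      ≤ (∑ p ∈ skewDiag a, |x' p.1| * |y p.2|) + ∑ p ∈ skewDiag a, |x p.1| * |y' p.2| := by
    rw [← Finset.sum_add_distrib]
    refine (Finset.abs_sum_le_sum_abs _ _).trans (Finset.sum_le_sum fun p hp => ?_)
    rw [abs_mul]
    have hw := inWindow_or p
    rw [mem_skewDiag.1 hp] at hw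
    rcases hw with hw | hw
    · have : x' p.1 = x p.1 := if_pos hw
      rw [this]
      linarith [mul_nonneg (abs_nonneg (x p.1)) (abs_nonneg (y' p.2))]
    · have : y' p.2 = y p.2 := if_pos hw
      rw [this]
      linarith [mul_nonneg (abs_nonneg (x' p.1)) (abs_nonneg (y p.2))]
  have h2 := key x' y
  have h3 := key x y'
  simp only [hx', hy'] at h2 h3
  rw [← sq_abs]
  refine (pow_le_pow_left₀ (abs_nonneg _) h1 2).trans ?_
  nlinarith [sq_nonneg ((∑ p ∈ skewDiag a, |x' p.1| * |y p.2|)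
    - ∑ p ∈ skewDiag a, |x p.1| * |y' p.2|)]

theorem GoodSample.sum_window_le (hω : GoodSample U h δ ν b ω) (x : Fin ns → ℝ) :
    ∑ a : Fin (2 * ns - 1), (if ((2 * ns - 1 : ℕ) * δ : ℝ) < hw ns a then
      sampleWeight ω a / hw ns a * ∑ i, (if InWindow i a then x i ^ 2 else 0) else 0)
        ≤ 3 * ∑ i, x i ^ 2 := by
  calc _ = ∑ i, x i ^ 2 * ∑ a, (if InWindow i a ∧ ((2 * ns - 1 : ℕ) * δ : ℝ) < hw ns a then
        sampleWeight ω a / hw ns a else 0) := by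
        simp only [Finset.mul_sum]
        rw [Finset.sum_comm]
        refine Finset.sum_congr rfl fun a _ => ?_
        split_ifs with h1
        · refine Finset.sum_congr rfl fun i _ => ?_
          by_cases h2 : InWindow i a
          · rw [if_pos h2, if_pos ⟨h2, h1⟩, mul_comm]
          · simp [h2]
        · simp [h1]
    _ ≤ ∑ i, x i ^ 2 * 3 := by
        gcongr with i _; exact hω.window i
    _ = _ := by rw [← Finset.sum_mul, mul_comm]

/-- Sampled energy of a product whose second factor has small rows. -/
theorem GoodSample.sum_Gadj_mul_transpose_le (hω : GoodSample U h δ ν b ω)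
    (W X : Matrix (Fin ns) (Fin r) ℂ) {c : ℝ} (hc : 0 ≤ c) (hX : ∀ i, vecNorm (X i) ^ 2 ≤ c) :
    ∑ a, sampleWeight ω a * ‖Gadj ns (W * Xᵀ) a‖ ^ 2
      ≤ frobNorm W ^ 2 * (3 * ((2 * ns - 1 : ℕ) * δ) * c + 12 * frobNorm X ^ 2) := by
  have hW := frobNorm_sq_eq_rows W
  have hX2 := frobNorm_sq_eq_rows X
  have h1 : ∀ a, sampleWeight ω a * ‖Gadj ns (W * Xᵀ) a‖ ^ 2
      ≤ (if (hw ns a : ℝ) ≤ (2 * ns - 1 : ℕ) * δ then sampleWeight ω a else 0)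
          * (frobNorm W ^ 2 * c)
        + (2 * frobNorm X ^ 2 * (if ((2 * ns - 1 : ℕ) * δ : ℝ) < hw ns a then
            sampleWeight ω a / hw ns a
              * ∑ i, (if InWindow i a then vecNorm (W i) ^ 2 else 0) else 0)
          + 2 * frobNorm W ^ 2 * (if ((2 * ns - 1 : ℕ) * δ : ℝ) < hw ns a then
            sampleWeight ω a / hw ns a
              * ∑ i, (if InWindow i a then vecNorm (X i) ^ 2 else 0) else 0)) := fun a => by
    have hc0 := sampleWeight_nonneg ω a
    rcases le_or_gt (hw ns a : ℝ) ((2 * ns - 1 : ℕ) * δ) with hs | hs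
    · rw [if_pos hs, if_neg hs.not_gt, if_neg hs.not_gt, mul_zero, mul_zero, add_zero, add_zero]
      exact mul_le_mul_of_nonneg_left (norm_Gadj_mul_transpose_sq_le_row W X hX a) hc0
    · rw [if_neg hs.not_ge, if_pos hs, if_pos hs, zero_mul, zero_add]
      calc _ ≤ sampleWeight ω a * (1 / hw ns a *
            (2 * ((∑ i, if InWindow i a then vecNorm (W i) ^ 2 else 0) * frobNorm X ^ 2)
              + 2 * (frobNorm W ^ 2 * ∑ i, if InWindow i a then vecNorm (X i) ^ 2 else 0))) := by
            refine mul_le_mul_of_nonneg_left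
              ((norm_Gadj_mul_transpose_sq_le W X a).trans ?_) hc0
            rw [hW, hX2]
            gcongr
            exact sq_skewDiag_le (fun i => vecNorm (W i)) (fun i => vecNorm (X i)) a
        _ = _ := by ring
  refine (Finset.sum_le_sum fun a _ => h1 a).trans ?_
  rw [Finset.sum_add_distrib, Finset.sum_add_distrib, ← Finset.sum_mul, ← Finset.mul_sum,
    ← Finset.mul_sum]
  have e1 := mul_le_mul_of_nonneg_right hω.short (by positivity : 0 ≤ frobNorm W ^ 2 * c)
  have e2 := mul_le_mul_of_nonneg_left (hω.sum_window_le fun i => vecNorm (W i))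
    (by positivity : 0 ≤ 2 * frobNorm X ^ 2)
  have e3 := mul_le_mul_of_nonneg_left (hω.sum_window_le fun i => vecNorm (X i))
    (by positivity : 0 ≤ 2 * frobNorm W ^ 2)
  beta_reduce at e2 e3
  rw [← hW] at e2
  rw [← hX2] at e3
  linarith

/-- Sampled energy on the tangent space. -/
theorem GoodSample.sum_tangent_le (hω : GoodSample U h δ ν b ω) (hU : Uᴴ * U = 1)
    (X : Matrix (Fin ns) (Fin r) ℂ) :
    ∑ a, sampleWeight ω a * ‖Gadj ns (X * Uᵀ) a‖ ^ 2
      ≤ (1 + (2 * ns - 1 : ℕ) * δ * ν) * frobNorm X ^ 2 := by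
  have h1 := (abs_le.1 (hω.tangent X)).2
  have h2 := sum_norm_Gadj_sq_le (X * Uᵀ)
  have h3 := frobNorm_mul_transpose_le zero_le_one (opLe_of_orthonormal hU) X
  have h4 := pow_le_pow_left₀ (frobNorm_nonneg _) h3 2
  simp only [sub_mul, one_mul, Finset.sum_sub_distrib] at h1 h4
  linarith

/-- Cauchy–Schwarz for a weighted sum of complex numbers. -/
theorem abs_sum_mul_re_le {ι : Type*} (s : Finset ι) {c : ι → ℝ} (hc : ∀ a, 0 ≤ c a)
    (u v : ι → ℂ) :
    |∑ a ∈ s, c a * (star (u a) * v a).re|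
      ≤ √(∑ a ∈ s, c a * ‖u a‖ ^ 2) * √(∑ a ∈ s, c a * ‖v a‖ ^ 2) := by
  have h1 : |∑ a ∈ s, c a * (star (u a) * v a).re|
      ≤ ∑ a ∈ s, (√(c a) * ‖u a‖) * (√(c a) * ‖v a‖) := by
    refine (Finset.abs_sum_le_sum_abs _ _).trans (Finset.sum_le_sum fun a _ => ?_)
    rw [abs_mul, abs_of_nonneg (hc a)]
    calc c a * |(star (u a) * v a).re| ≤ c a * (‖u a‖ * ‖v a‖) := by
          have := Complex.abs_re_le_norm (star (u a) * v a)
          rw [norm_mul, norm_star] at this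
          exact mul_le_mul_of_nonneg_left this (hc a)
      _ = √(c a) * √(c a) * (‖u a‖ * ‖v a‖) := by rw [Real.mul_self_sqrt (hc a)]
      _ = _ := by ring
  refine h1.trans ((Real.sum_mul_le_sqrt_mul_sqrt s _ _).trans_eq ?_)
  simp only [mul_pow, Real.sq_sqrt (hc _)]

theorem sum_weight_add_sq_le {ι : Type*} (s : Finset ι) {c : ι → ℝ} (hc : ∀ a, 0 ≤ c a)
    (u v : ι → ℂ) :
    ∑ a ∈ s, c a * ‖(u + v) a‖ ^ 2
      ≤ 2 * ∑ a ∈ s, c a * ‖u a‖ ^ 2 + 2 * ∑ a ∈ s, c a * ‖v a‖ ^ 2 := by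
  rw [Finset.mul_sum, Finset.mul_sum, ← Finset.sum_add_distrib]
  refine Finset.sum_le_sum fun a _ => ?_
  have h1 : ‖(u + v) a‖ ^ 2 ≤ 2 * ‖u a‖ ^ 2 + 2 * ‖v a‖ ^ 2 := by
    have h2 := pow_le_pow_left₀ (norm_nonneg _) (norm_add_le (u a) (v a)) 2
    rw [Pi.add_apply]
    nlinarith [sq_nonneg (‖u a‖ - ‖v a‖)]
  nlinarith [mul_le_mul_of_nonneg_left h1 (hc a)]

end SampledNorm

section Deviation

variable {ns r m : ℕ}

theorem abs_sum_sub_one_mul_le {N : ℕ} (ω : Fin m → Fin N) (t q : Fin N → ℂ) {α β e₁ e₂ e₃ θ : ℝ}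
    (hα : |α| ≤ 3) (hβ : |β| ≤ 2) (hθ : 0 < θ)
    (h₁ : |∑ a, (sampleWeight ω a - 1) * ‖t a‖ ^ 2| ≤ e₁)
    (h₂ : ∑ a, (sampleWeight ω a + 1) * ‖t a‖ ^ 2 ≤ e₂)
    (h₃ : ∑ a, (sampleWeight ω a + 1) * ‖q a‖ ^ 2 ≤ e₃) :
    |∑ a, (sampleWeight ω a - 1)
        * (‖t a‖ ^ 2 + α * (star (t a) * q a).re + β * ‖q a‖ ^ 2)|
      ≤ e₁ + 3 / 2 * θ * e₂ + (3 / 2 / θ + 2) * e₃ := by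
  have hcross : |∑ a, (sampleWeight ω a - 1) * (α * (star (t a) * q a).re + β * ‖q a‖ ^ 2)|
      ≤ ∑ a, (3 / 2 * θ * ((sampleWeight ω a + 1) * ‖t a‖ ^ 2)
        + (3 / 2 / θ + 2) * ((sampleWeight ω a + 1) * ‖q a‖ ^ 2)) := by
    refine (Finset.abs_sum_le_sum_abs _ _).trans (Finset.sum_le_sum fun a _ => ?_)
    have hc := sampleWeight_nonneg ω a
    have hd : |sampleWeight ω a - 1| ≤ sampleWeight ω a + 1 := abs_le.2 ⟨by linarith, by linarith⟩
    have h4 : |(star (t a) * q a).re| ≤ ‖t a‖ * ‖q a‖ := by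
      have := Complex.abs_re_le_norm (star (t a) * q a)
      rwa [norm_mul, norm_star] at this
    have h5 : ‖t a‖ * ‖q a‖ ≤ (θ * ‖t a‖ ^ 2 + ‖q a‖ ^ 2 / θ) / 2 := by
      have := sq_nonneg (θ * ‖t a‖ - ‖q a‖)
      rw [le_div_iff₀ two_pos, ← sub_nonneg]
      have e : θ * ‖t a‖ ^ 2 + ‖q a‖ ^ 2 / θ - ‖t a‖ * ‖q a‖ * 2
          = (θ * ‖t a‖ - ‖q a‖) ^ 2 / θ := by field_simp; ring
      rw [e]; positivity
    have h6 : |α * (star (t a) * q a).re + β * ‖q a‖ ^ 2|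
        ≤ 3 * ((θ * ‖t a‖ ^ 2 + ‖q a‖ ^ 2 / θ) / 2) + 2 * ‖q a‖ ^ 2 := by
      refine (abs_add_le _ _).trans (add_le_add ?_ ?_)
      · rw [abs_mul]; exact mul_le_mul hα (h4.trans h5) (abs_nonneg _) (by norm_num)
      · rw [abs_mul, abs_of_nonneg (sq_nonneg ‖q a‖)]; gcongr
    rw [abs_mul]
    calc _ ≤ (sampleWeight ω a + 1)
          * (3 * ((θ * ‖t a‖ ^ 2 + ‖q a‖ ^ 2 / θ) / 2) + 2 * ‖q a‖ ^ 2) :=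
          mul_le_mul hd h6 (abs_nonneg _) (by linarith)
      _ = _ := by ring
  rw [Finset.sum_add_distrib, ← Finset.mul_sum, ← Finset.mul_sum] at hcross
  have hsplit : ∑ a, (sampleWeight ω a - 1)
        * (‖t a‖ ^ 2 + α * (star (t a) * q a).re + β * ‖q a‖ ^ 2)
      = ∑ a, (sampleWeight ω a - 1) * ‖t a‖ ^ 2
        + ∑ a, (sampleWeight ω a - 1) * (α * (star (t a) * q a).re + β * ‖q a‖ ^ 2) := by
    rw [← Finset.sum_add_distrib]
    exact Finset.sum_congr rfl fun a _ => by ring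
  rw [hsplit]
  have h7 := mul_le_mul_of_nonneg_left h₂ (by positivity : 0 ≤ 3 / 2 * θ)
  have h8 := mul_le_mul_of_nonneg_left h₃ (by positivity : 0 ≤ 3 / 2 / θ + 2)
  linarith [abs_add_le (∑ a, (sampleWeight ω a - 1) * ‖t a‖ ^ 2)
    (∑ a, (sampleWeight ω a - 1) * (α * (star (t a) * q a).re + β * ‖q a‖ ^ 2))]

end Deviation

/-- The parameter regime in which the local analysis is carried out: `a ^ 2` and `b ^ 2` are the
extreme singular values of the lifted signal, `ν` is its incoherence level. -/
structure Regime {ns r : ℕ} (U : Matrix (Fin ns) (Fin r) ℂ) (δ ν a b τ : ℝ) : Prop where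
  orthonormal : Uᴴ * U = 1
  row_le : ∀ i, vecNorm (U i) ^ 2 ≤ ν
  b_pos : 0 < b
  b_le : b ≤ a
  δ_nonneg : 0 ≤ δ
  ν_nonneg : 0 ≤ ν
  τ_nonneg : 0 ≤ τ
  le_τ : 2 * (ν * a ^ 2) ≤ τ ^ 2
  τ_le : τ ^ 2 ≤ 22 / 10 * (ν * a ^ 2)
  sampling : (2 * ns - 1 : ℕ) * δ * ν * a ^ 4 ≤ b ^ 4 / 10 ^ 10

/-- A point `Z` near the factorization `(U * Q₁) * (U * Q₂)ᵀ`. -/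
structure Near {ns r : ℕ} (U : Matrix (Fin ns) (Fin r) ℂ) (y : Fin (2 * ns - 1) → ℂ) (a b τ : ℝ)
    (Q₁ Q₂ : Matrix (Fin r) (Fin r) ℂ) (Z : Matrix (Fin ns) (Fin r) ℂ) (g : ℝ) : Prop where
  factor : Gop ns y = U * Q₁ * (U * Q₂)ᵀ
  opLe : OpLe Z (11 / 10 * a)
  row_le : ∀ i, vecNorm (Z i) ≤ τ
  eq : frobNorm (Z - U * Q₁) ^ 2 + frobNorm (Z - U * Q₂) ^ 2 = g
  small : g * a ^ 4 ≤ b ^ 6 / 10 ^ 8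

section Local

variable {ns r m : ℕ} {U : Matrix (Fin ns) (Fin r) ℂ} {y h : Fin (2 * ns - 1) → ℂ}
  {δ ν a b τ e g : ℝ} {ω : Fin m → Fin (2 * ns - 1)} {Q₁ Q₂ : Matrix (Fin r) (Fin r) ℂ}
  {Z : Matrix (Fin ns) (Fin r) ℂ}

theorem Regime.a_pos (R : Regime U δ ν a b τ) : 0 < a := R.b_pos.trans_le R.b_le

theorem Regime.sq_le_sq (R : Regime U δ ν a b τ) : b ^ 2 ≤ a ^ 2 :=
  pow_le_pow_left₀ R.b_pos.le R.b_le 2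

theorem Regime.sampling_sq (R : Regime U δ ν a b τ) :
    (2 * ns - 1 : ℕ) * δ * ν * a ^ 2 ≤ b ^ 2 / 10 ^ 10 := by
  have ha := R.a_pos
  have h1 := R.sampling
  refine le_of_mul_le_mul_right ?_ (by positivity : 0 < a ^ 2)
  nlinarith [R.sq_le_sq, sq_nonneg b, mul_le_mul_of_nonneg_left R.sq_le_sq (sq_nonneg b)]

theorem Regime.sampling_one (R : Regime U δ ν a b τ) :
    (2 * ns - 1 : ℕ) * δ * ν ≤ 1 / 10 ^ 10 := by
  have ha := R.a_pos
  have h1 := R.sampling_sq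
  refine le_of_mul_le_mul_right ?_ (by positivity : 0 < a ^ 2)
  linarith [R.sq_le_sq]

theorem Near.symm (N : Near U y a b τ Q₁ Q₂ Z g) : Near U y a b τ Q₂ Q₁ Z g where
  factor := by
    have h1 : (Gop ns y)ᵀ = Gop ns y := by
      ext i j
      simp only [transpose_apply, Gop, add_comm]
    rw [← h1, N.factor, transpose_mul, transpose_transpose]
  opLe := N.opLe
  row_le := N.row_le
  eq := by rw [add_comm, N.eq]
  small := N.small

theorem Near.nonneg (N : Near U y a b τ Q₁ Q₂ Z g) : 0 ≤ g := by
  rw [← N.eq]; positivity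

theorem Near.small_sq (N : Near U y a b τ Q₁ Q₂ Z g) (R : Regime U δ ν a b τ) :
    g * a ^ 2 ≤ b ^ 4 / 10 ^ 8 := by
  have ha := R.a_pos
  have h1 := N.small
  refine le_of_mul_le_mul_right ?_ (by positivity : 0 < a ^ 2)
  nlinarith [mul_le_mul_of_nonneg_left R.sq_le_sq (by positivity : 0 ≤ b ^ 4)]

theorem Near.small_one (N : Near U y a b τ Q₁ Q₂ Z g) (R : Regime U δ ν a b τ) :
    g ≤ b ^ 2 / 10 ^ 8 := by
  have ha := R.a_pos
  have h1 := N.small_sq R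
  refine le_of_mul_le_mul_right ?_ (by positivity : 0 < a ^ 2)
  nlinarith [mul_le_mul_of_nonneg_left R.sq_le_sq (sq_nonneg b)]

theorem Near.frobNorm_sq_le (N : Near U y a b τ Q₁ Q₂ Z g) : frobNorm (Z - U * Q₁) ^ 2 ≤ g := by
  rw [← N.eq]; linarith [sq_nonneg (frobNorm (Z - U * Q₂))]

theorem Near.opLe_left (N : Near U y a b τ Q₁ Q₂ Z g) (R : Regime U δ ν a b τ) :
    OpLe (U * Q₁) (12 / 10 * a) := by
  have h1 : frobNorm (Z - U * Q₁) ≤ b / 10 ^ 4 := by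
    refine le_of_sq_le_sq ?_ (by have := R.b_pos; positivity)
    have := N.frobNorm_sq_le.trans (N.small_one R)
    rw [div_pow]; norm_num at this ⊢; exact this
  have h2 := N.opLe.sub (opLe_frobNorm (Z - U * Q₁))
  rw [sub_sub_cancel] at h2
  exact h2.mono (by linarith [R.b_le, R.a_pos])

theorem Near.row_left (N : Near U y a b τ Q₁ Q₂ Z g) (R : Regime U δ ν a b τ) (i : Fin ns) :
    vecNorm ((U * Q₁) i) ≤ τ := by
  have ha := R.a_pos
  have hQ : OpLe Q₁ (12 / 10 * a) := (N.opLe_left R).of_orthonormal_mul R.orthonormal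
  have h1 := vecNorm_row_mul_le (by positivity) hQ U i
  refine le_of_sq_le_sq ?_ R.τ_nonneg
  refine (pow_le_pow_left₀ (vecNorm_nonneg _) h1 2).trans (le_trans ?_ R.le_τ)
  rw [mul_pow]
  have := mul_le_mul_of_nonneg_right (R.row_le i) (sq_nonneg (12 / 10 * a))
  nlinarith [mul_nonneg R.ν_nonneg (sq_nonneg a)]

theorem Near.row_sub_left (N : Near U y a b τ Q₁ Q₂ Z g) (R : Regime U δ ν a b τ) (i : Fin ns) :
    vecNorm ((Z - U * Q₁) i) ^ 2 ≤ 4 * τ ^ 2 := by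
  have h1 := (vecNorm_sub_le (Z i) ((U * Q₁) i)).trans (add_le_add (N.row_le i) (N.row_left R i))
  have h2 := pow_le_pow_left₀ (vecNorm_nonneg _) h1 2
  refine h2.trans_eq (by ring)

/-- The residual splits into a tangent part and a second order part. -/
theorem Near.residual_eq (N : Near U y a b τ Q₁ Q₂ Z g) :
    Z * Zᵀ - Gop ns y = (U * Q₁) * (Z - U * Q₂)ᵀ + (Z - U * Q₁) * (U * Q₂)ᵀ
      + (Z - U * Q₁) * (Z - U * Q₂)ᵀ := by
  rw [N.factor]
  simp only [transpose_sub, Matrix.mul_sub, Matrix.sub_mul]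
  abel

theorem Gadj_tangent (U : Matrix (Fin ns) (Fin r) ℂ) (Q₁ Q₂ : Matrix (Fin r) (Fin r) ℂ)
    (Z : Matrix (Fin ns) (Fin r) ℂ) :
    Gadj ns ((U * Q₁) * (Z - U * Q₂)ᵀ + (Z - U * Q₁) * (U * Q₂)ᵀ)
      = Gadj ns (((Z - U * Q₂) * Q₁ᵀ + (Z - U * Q₁) * Q₂ᵀ) * Uᵀ) := by
  rw [Gadj_add, ← Gadj_transpose ((U * Q₁) * (Z - U * Q₂)ᵀ), transpose_mul, transpose_transpose,
    ← Gadj_add, transpose_mul, transpose_mul, Matrix.add_mul, Matrix.mul_assoc, Matrix.mul_assoc]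

theorem Near.frobNorm_tangent_sq_le (N : Near U y a b τ Q₁ Q₂ Z g) (R : Regime U δ ν a b τ) :
    frobNorm ((Z - U * Q₂) * Q₁ᵀ + (Z - U * Q₁) * Q₂ᵀ) ^ 2 ≤ 3 * a ^ 2 * g := by
  have ha := R.a_pos
  have hQ₁ : OpLe Q₁ (12 / 10 * a) := (N.opLe_left R).of_orthonormal_mul R.orthonormal
  have hQ₂ : OpLe Q₂ (12 / 10 * a) := (N.symm.opLe_left R).of_orthonormal_mul R.orthonormal
  have h1 := (frobNorm_add_le ((Z - U * Q₂) * Q₁ᵀ) ((Z - U * Q₁) * Q₂ᵀ)).trans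
    (add_le_add (frobNorm_mul_transpose_le (by positivity) hQ₁ (Z - U * Q₂))
      (frobNorm_mul_transpose_le (by positivity) hQ₂ (Z - U * Q₁)))
  refine (pow_le_pow_left₀ (frobNorm_nonneg _) h1 2).trans ?_
  rw [← N.eq]
  nlinarith [sq_nonneg (frobNorm (Z - U * Q₁) - frobNorm (Z - U * Q₂)), sq_nonneg a,
    mul_nonneg (sq_nonneg a) (sq_nonneg (frobNorm (Z - U * Q₁) - frobNorm (Z - U * Q₂))),
    mul_nonneg (sq_nonneg a) (sq_nonneg (frobNorm (Z - U * Q₁))),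
    mul_nonneg (sq_nonneg a) (sq_nonneg (frobNorm (Z - U * Q₂)))]

theorem Near.frobNorm_second_le (N : Near U y a b τ Q₁ Q₂ Z g) :
    frobNorm ((Z - U * Q₁) * (Z - U * Q₂)ᵀ) ≤ g / 2 := by
  have h1 := frobNorm_mul_transpose_le (frobNorm_nonneg _) (opLe_frobNorm (Z - U * Q₂)) (Z - U * Q₁)
  rw [← N.eq]
  nlinarith [sq_nonneg (frobNorm (Z - U * Q₁) - frobNorm (Z - U * Q₂))]

theorem Near.sum_second_le (N : Near U y a b τ Q₁ Q₂ Z g) (R : Regime U δ ν a b τ)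
    (hω : GoodSample U h δ ν e ω) :
    (∑ i, (sampleWeight ω i + 1) * ‖Gadj ns ((Z - U * Q₁) * (Z - U * Q₂)ᵀ) i‖ ^ 2) * a ^ 2
      ≤ 2 / 10 ^ 7 * b ^ 4 * g := by
  have ha := R.a_pos
  have hg := N.nonneg
  have h1 := hω.sum_Gadj_mul_transpose_le (Z - U * Q₁) (Z - U * Q₂) (by positivity : 0 ≤ 4 * τ ^ 2)
    (N.symm.row_sub_left R)
  have h2 := (sum_norm_Gadj_sq_le ((Z - U * Q₁) * (Z - U * Q₂)ᵀ)).trans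
    (pow_le_pow_left₀ (frobNorm_nonneg _) N.frobNorm_second_le 2)
  have h3 := N.frobNorm_sq_le
  have h4 := N.symm.frobNorm_sq_le
  have hNδ : 0 ≤ ((2 * ns - 1 : ℕ) : ℝ) * δ := mul_nonneg (Nat.cast_nonneg _) R.δ_nonneg
  have h5 : frobNorm (Z - U * Q₁) ^ 2 * (3 * ((2 * ns - 1 : ℕ) * δ) * (4 * τ ^ 2)
      + 12 * frobNorm (Z - U * Q₂) ^ 2)
      ≤ g * (27 * ((2 * ns - 1 : ℕ) * δ * ν * a ^ 2) + 12 * g) := by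
    refine mul_le_mul h3 ?_ (by positivity) hg
    have := mul_le_mul_of_nonneg_left R.τ_le hNδ
    have h0 : 0 ≤ (2 * ns - 1 : ℕ) * δ * (ν * a ^ 2) :=
      mul_nonneg hNδ (mul_nonneg R.ν_nonneg (sq_nonneg a))
    nlinarith
  simp only [add_mul, one_mul, Finset.sum_add_distrib] at h2 ⊢
  have h6 := R.sampling
  have h7 := N.small_sq R
  calc _ ≤ (g * (27 * ((2 * ns - 1 : ℕ) * δ * ν * a ^ 2) + 12 * g) + (g / 2) ^ 2) * a ^ 2 := by
        rw [← add_mul]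
        gcongr
        exact h1.trans h5
    _ = g * (27 * ((2 * ns - 1 : ℕ) * δ * ν * a ^ 4) + (12 + 1 / 4) * (g * a ^ 2)) := by ring
    _ ≤ g * (27 * (b ^ 4 / 10 ^ 10) + (12 + 1 / 4) * (b ^ 4 / 10 ^ 8)) := by gcongr
    _ ≤ _ := by nlinarith [mul_nonneg hg (by positivity : 0 ≤ b ^ 4)]

theorem Near.abs_deviation_le (N : Near U y a b τ Q₁ Q₂ Z g) (R : Regime U δ ν a b τ)
    (hω : GoodSample U h δ ν e ω) {α β : ℝ} (hα : |α| ≤ 3) (hβ : |β| ≤ 2)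
    {t q : Fin (2 * ns - 1) → ℂ}
    (ht : t = Gadj ns (((Z - U * Q₂) * Q₁ᵀ + (Z - U * Q₁) * Q₂ᵀ) * Uᵀ))
    (hq : q = Gadj ns ((Z - U * Q₁) * (Z - U * Q₂)ᵀ)) :
    |∑ i, (sampleWeight ω i - 1)
        * (‖t i‖ ^ 2 + α * (star (t i) * q i).re + β * ‖q i‖ ^ 2)| ≤ 2 / 100 * b ^ 2 * g := by
  have ha := R.a_pos
  have hb := R.b_pos
  have hg := N.nonneg
  set X := (Z - U * Q₂) * Q₁ᵀ + (Z - U * Q₁) * Q₂ᵀ with hX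
  have hXg : frobNorm X ^ 2 ≤ 3 * a ^ 2 * g := N.frobNorm_tangent_sq_le R
  have h0 : 0 ≤ ((2 * ns - 1 : ℕ) : ℝ) * δ * ν :=
    mul_nonneg (mul_nonneg (Nat.cast_nonneg _) R.δ_nonneg) R.ν_nonneg
  have h1 : |∑ i, (sampleWeight ω i - 1) * ‖t i‖ ^ 2| ≤ 3 / 10 ^ 10 * b ^ 2 * g := by
    rw [ht]
    refine (hω.tangent X).trans ?_
    calc _ ≤ (2 * ns - 1 : ℕ) * δ * ν * (3 * a ^ 2 * g) := by gcongr
      _ = 3 * g * ((2 * ns - 1 : ℕ) * δ * ν * a ^ 2) := by ring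
      _ ≤ 3 * g * (b ^ 2 / 10 ^ 10) := by gcongr; exact R.sampling_sq
      _ = _ := by ring
  have h2 : ∑ i, (sampleWeight ω i + 1) * ‖t i‖ ^ 2 ≤ 9 * a ^ 2 * g := by
    rw [ht]
    have e1 := hω.sum_tangent_le R.orthonormal X
    have e2 := sum_norm_Gadj_sq_le (X * Uᵀ)
    have e3 := pow_le_pow_left₀ (frobNorm_nonneg _)
      (frobNorm_mul_transpose_le zero_le_one (opLe_of_orthonormal R.orthonormal) X) 2
    simp only [add_mul, one_mul, Finset.sum_add_distrib] at e1 e3 ⊢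
    nlinarith [R.sampling_one, mul_le_mul_of_nonneg_right R.sampling_one (sq_nonneg (frobNorm X))]
  have h3 := N.sum_second_le R hω
  rw [← hq] at h3
  set e₃ := ∑ i, (sampleWeight ω i + 1) * ‖q i‖ ^ 2
  have he₃ : 0 ≤ e₃ := Finset.sum_nonneg fun i _ =>
    mul_nonneg (by linarith [sampleWeight_nonneg ω i]) (sq_nonneg _)
  have h4 := abs_sum_sub_one_mul_le ω t q hα hβ (θ := b ^ 2 / (1000 * a ^ 2)) (by positivity) h1 h2
    (le_refl e₃)
  refine h4.trans ?_
  have h5 : 3 / 2 * (b ^ 2 / (1000 * a ^ 2)) * (9 * a ^ 2 * g) = 135 / 10000 * b ^ 2 * g := by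
    field_simp; ring
  have h6 : 3 / 2 / (b ^ 2 / (1000 * a ^ 2)) * e₃ ≤ 3 / 10 ^ 4 * b ^ 2 * g := by
    rw [show 3 / 2 / (b ^ 2 / (1000 * a ^ 2)) * e₃ = 1500 * (e₃ * a ^ 2) / b ^ 2 by
      field_simp; ring, div_le_iff₀ (by positivity)]
    nlinarith
  have h7 : e₃ ≤ 2 / 10 ^ 7 * b ^ 2 * g := by
    refine le_of_mul_le_mul_right ?_ (by positivity : 0 < a ^ 2)
    nlinarith [mul_le_mul_of_nonneg_left R.sq_le_sq (mul_nonneg (sq_nonneg b) hg)]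
  have h8 : 0 ≤ b ^ 2 * g := by positivity
  rw [add_mul, h5]
  linarith

end Local

section Descent

variable {ns r m : ℕ} {U : Matrix (Fin ns) (Fin r) ℂ} {y h : Fin (2 * ns - 1) → ℂ}
  {δ ν a b τ e g : ℝ} {ω : Fin m → Fin (2 * ns - 1)} {Q₁ Q₂ : Matrix (Fin r) (Fin r) ℂ}
  {Z : Matrix (Fin ns) (Fin r) ℂ}

theorem Gop_transpose (y : Fin (2 * ns - 1) → ℂ) : (Gop ns y)ᵀ = Gop ns y := by
  ext i j
  simp only [transpose_apply, Gop, add_comm]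

theorem frobInner_residual (Z W : Matrix (Fin ns) (Fin r) ℂ) :
    frobInner (Z * Zᵀ - Gop ns y) (W * Zᵀ) = frobInner (Z * Zᵀ - Gop ns y) (Z * Wᵀ) := by
  rw [← frobInner_transpose, transpose_sub, Gop_transpose, transpose_mul, transpose_mul,
    transpose_transpose]

theorem Near.mul_transpose_add (N : Near U y a b τ Q₁ Q₂ Z g) :
    (Z - U * Q₁) * Zᵀ + Z * (Z - U * Q₂)ᵀ
      = (Z * Zᵀ - Gop ns y) + (Z - U * Q₁) * (Z - U * Q₂)ᵀ := by
  rw [N.factor]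
  simp only [transpose_sub, Matrix.mul_sub, Matrix.sub_mul]
  abel

theorem re_star_add_mul (t q : ℂ) (k : ℝ) :
    (star (t + q) * (t + k * q)).re = ‖t‖ ^ 2 + (k + 1) * (star t * q).re + k * ‖q‖ ^ 2 := by
  simp only [Complex.star_def, Complex.mul_re, Complex.add_re, Complex.add_im, Complex.conj_re,
    Complex.conj_im, Complex.ofReal_re, Complex.ofReal_im, map_add, Complex.sq_norm,
    Complex.normSq_apply, Complex.mul_im]
  ring

theorem norm_add_sq_complex (t q : ℂ) :
    ‖t + q‖ ^ 2 = ‖t‖ ^ 2 + 2 * (star t * q).re + ‖q‖ ^ 2 := by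
  simp only [Complex.star_def, Complex.mul_re, Complex.add_re, Complex.add_im, Complex.conj_re,
    Complex.conj_im, Complex.sq_norm, Complex.normSq_apply]
  ring

theorem Near.Gadj_residual (N : Near U y a b τ Q₁ Q₂ Z g) :
    Gadj ns (Z * Zᵀ - Gop ns y)
      = Gadj ns (((Z - U * Q₂) * Q₁ᵀ + (Z - U * Q₁) * Q₂ᵀ) * Uᵀ)
        + Gadj ns ((Z - U * Q₁) * (Z - U * Q₂)ᵀ) := by
  rw [N.residual_eq, Gadj_add, Gadj_tangent]

theorem Near.frobInner_gradf_ge (N : Near U y a b τ Q₁ Q₂ Z g) (R : Regime U δ ν a b τ)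
    (hω : GoodSample U h δ ν e ω) :
    95 / 100 * frobNorm (Z * Zᵀ - Gop ns y) ^ 2 - 2 / 100 * b ^ 2 * g - 5 / 4 * g ^ 2
      ≤ frobInner (gradf ns r m y ω Z) ((Z - U * Q₁) + (Z - U * Q₂)) := by
  rw [frobInner_gradf]
  set D := Z * Zᵀ - Gop ns y with hD
  set E := (Z - U * Q₁) * (Z - U * Q₂)ᵀ with hE
  set t := Gadj ns (((Z - U * Q₂) * Q₁ᵀ + (Z - U * Q₁) * Q₂ᵀ) * Uᵀ) with ht
  set q := Gadj ns E with hq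
  have hz : Gadj ns D = t + q := N.Gadj_residual
  have h1 : frobInner D ((Z - U * Q₁ + (Z - U * Q₂)) * Zᵀ) = frobNorm D ^ 2 + frobInner D E := by
    rw [Matrix.add_mul, frobInner_add_right, frobInner_residual Z (Z - U * Q₂), ← frobInner_add_right,
      N.mul_transpose_add, frobInner_add_right, frobInner_self]
  have h2 : Gadj ns ((Z - U * Q₁ + (Z - U * Q₂)) * Zᵀ) = t + q + q := by
    rw [Matrix.add_mul, Gadj_add, ← Gadj_transpose ((Z - U * Q₂) * Zᵀ), transpose_mul,
      transpose_transpose, ← Gadj_add, N.mul_transpose_add, Gadj_add, ← hD, hz]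
  have h3 := N.abs_deviation_le R hω (α := 3) (β := 2) (by norm_num) (by norm_num) ht hq
  have h4 : ∑ i, (sampleWeight ω i - 1)
      * (star (Gadj ns D i) * Gadj ns ((Z - U * Q₁ + (Z - U * Q₂)) * Zᵀ) i).re
      = ∑ i, (sampleWeight ω i - 1) * (‖t i‖ ^ 2 + 3 * (star (t i) * q i).re + 2 * ‖q i‖ ^ 2) := by
    refine Finset.sum_congr rfl fun i _ => ?_
    rw [hz, h2, show (t + q + q) i = t i + ((2 : ℝ) : ℂ) * q i by
      simp only [Pi.add_apply]; push_cast; ring, Pi.add_apply, re_star_add_mul]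
    norm_num
  rw [h1, h4]
  have h5 := (abs_le.1 h3).1
  have h6 := (abs_le.1 (abs_frobInner_le D E)).1
  have h7 : frobNorm D * frobNorm E ≤ frobNorm D * (g / 2) :=
    mul_le_mul_of_nonneg_left N.frobNorm_second_le (frobNorm_nonneg _)
  nlinarith [sq_nonneg (frobNorm D - 5 * g)]

theorem Near.sum_sampled_residual_le (N : Near U y a b τ Q₁ Q₂ Z g) (R : Regime U δ ν a b τ)
    (hω : GoodSample U h δ ν e ω) :
    ∑ i, sampleWeight ω i * ‖Gadj ns (Z * Zᵀ - Gop ns y) i‖ ^ 2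
      ≤ frobNorm (Z * Zᵀ - Gop ns y) ^ 2 + 2 / 100 * b ^ 2 * g := by
  have h1 := sum_norm_Gadj_sq_le (Z * Zᵀ - Gop ns y)
  set t := Gadj ns (((Z - U * Q₂) * Q₁ᵀ + (Z - U * Q₁) * Q₂ᵀ) * Uᵀ) with ht
  set q := Gadj ns ((Z - U * Q₁) * (Z - U * Q₂)ᵀ) with hq
  have hz : Gadj ns (Z * Zᵀ - Gop ns y) = t + q := N.Gadj_residual
  have h3 := N.abs_deviation_le R hω (α := 2) (β := 1) (by norm_num) (by norm_num) ht hq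
  have h4 : ∑ i, (sampleWeight ω i - 1) * ‖Gadj ns (Z * Zᵀ - Gop ns y) i‖ ^ 2
      = ∑ i, (sampleWeight ω i - 1) * (‖t i‖ ^ 2 + 2 * (star (t i) * q i).re + 1 * ‖q i‖ ^ 2) := by
    refine Finset.sum_congr rfl fun i _ => ?_
    rw [hz, Pi.add_apply, one_mul, norm_add_sq_complex]
  have h5 := (abs_le.1 h3).2
  rw [← h4] at h5
  simp only [sub_mul, one_mul, Finset.sum_sub_distrib] at h5
  linarith

theorem Near.sum_sampled_product_le (N : Near U y a b τ Q₁ Q₂ Z g) (R : Regime U δ ν a b τ)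
    (hω : GoodSample U h δ ν e ω) (W : Matrix (Fin ns) (Fin r) ℂ) :
    ∑ i, sampleWeight ω i * ‖Gadj ns (W * Zᵀ) i‖ ^ 2 ≤ 4 * a ^ 2 * frobNorm W ^ 2 := by
  have ha := R.a_pos
  have hQ₁ : OpLe Q₁ (12 / 10 * a) := (N.opLe_left R).of_orthonormal_mul R.orthonormal
  have h1 := hω.sum_tangent_le R.orthonormal (W * Q₁ᵀ)
  have h2 := hω.sum_Gadj_mul_transpose_le W (Z - U * Q₁) (by positivity : 0 ≤ 4 * τ ^ 2)
    (N.row_sub_left R)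
  have h3 := sum_weight_add_sq_le Finset.univ (sampleWeight_nonneg ω) (Gadj ns (W * Q₁ᵀ * Uᵀ))
    (Gadj ns (W * (Z - U * Q₁)ᵀ))
  rw [← Gadj_add, Matrix.mul_assoc, ← transpose_mul, ← Matrix.mul_add, ← transpose_add,
    add_sub_cancel, transpose_mul, ← Matrix.mul_assoc] at h3
  have h4 := pow_le_pow_left₀ (frobNorm_nonneg _)
    (frobNorm_mul_transpose_le (by positivity) hQ₁ W) 2
  have h5 := N.frobNorm_sq_le
  have h6 := N.small_one R
  have h7 := R.sampling_one
  have hNδ : 0 ≤ ((2 * ns - 1 : ℕ) : ℝ) * δ := mul_nonneg (Nat.cast_nonneg _) R.δ_nonneg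
  have h8 := mul_le_mul_of_nonneg_left R.τ_le hNδ
  have h9 := R.sampling_sq
  have h10 := R.sq_le_sq
  have h11 : (1 + (2 * ns - 1 : ℕ) * δ * ν) * frobNorm (W * Q₁ᵀ) ^ 2
      ≤ (1 + 1 / 10 ^ 10) * (12 / 10 * a * frobNorm W) ^ 2 := by gcongr
  have h12 : frobNorm W ^ 2 * (3 * ((2 * ns - 1 : ℕ) * δ) * (4 * τ ^ 2)
      + 12 * frobNorm (Z - U * Q₁) ^ 2) ≤ frobNorm W ^ 2 * (1 / 100 * a ^ 2) := by
    gcongr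
    nlinarith
  nlinarith [mul_nonneg (sq_nonneg (frobNorm W)) (sq_nonneg a)]

theorem Near.frobNorm_gradf_sq_le (N : Near U y a b τ Q₁ Q₂ Z g) (R : Regime U δ ν a b τ)
    (hω : GoodSample U h δ ν e ω) :
    frobNorm (gradf ns r m y ω Z) ^ 2
      ≤ 1768 / 100 * a ^ 2 * frobNorm (Z * Zᵀ - Gop ns y) ^ 2 + 16 / 100 * a ^ 2 * (b ^ 2 * g) := by
  have ha := R.a_pos
  have hg := N.nonneg
  set D := Z * Zᵀ - Gop ns y with hD
  set W := gradf ns r m y ω Z with hW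
  have h1 := frobInner_gradf y ω Z W
  rw [← hW, frobInner_self, ← hD] at h1
  have hWZ := frobNorm_mul_transpose_le (by positivity) N.opLe W
  have h2 := (abs_le.1 (abs_frobInner_le D (W * Zᵀ))).2
  have h3 := abs_sum_mul_re_le Finset.univ (c := fun _ => 1) (fun _ => zero_le_one)
    (Gadj ns D) (Gadj ns (W * Zᵀ))
  have h4 := abs_sum_mul_re_le Finset.univ (sampleWeight_nonneg ω)
    (Gadj ns D) (Gadj ns (W * Zᵀ))
  simp only [one_mul] at h3
  have h5 : √(∑ i, ‖Gadj ns D i‖ ^ 2) ≤ frobNorm D :=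
    Real.sqrt_le_iff.2 ⟨frobNorm_nonneg _, sum_norm_Gadj_sq_le D⟩
  have h6 : √(∑ i, ‖Gadj ns (W * Zᵀ) i‖ ^ 2) ≤ frobNorm (W * Zᵀ) :=
    Real.sqrt_le_iff.2 ⟨frobNorm_nonneg _, sum_norm_Gadj_sq_le _⟩
  have h7 : √(∑ i, sampleWeight ω i * ‖Gadj ns (W * Zᵀ) i‖ ^ 2) ≤ 2 * a * frobNorm W :=
    Real.sqrt_le_iff.2 ⟨mul_nonneg (by positivity) (frobNorm_nonneg _),
      (N.sum_sampled_product_le R hω W).trans_eq (by ring)⟩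
  have h8 := N.sum_sampled_residual_le R hω
  rw [← hD] at h8
  set p := √(∑ i, sampleWeight ω i * ‖Gadj ns D i‖ ^ 2) with hp
  have hp2 : p ^ 2 ≤ frobNorm D ^ 2 + 2 / 100 * b ^ 2 * g := by
    rw [hp, Real.sq_sqrt (Finset.sum_nonneg fun i _ =>
      mul_nonneg (sampleWeight_nonneg ω i) (sq_nonneg _))]
    exact h8
  have hp0 : 0 ≤ p := Real.sqrt_nonneg _
  have hD0 := frobNorm_nonneg D
  have hW0 := frobNorm_nonneg W
  have h9 : ∑ i, (sampleWeight ω i - 1) * (star (Gadj ns D i) * Gadj ns (W * Zᵀ) i).re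
      ≤ p * (2 * a * frobNorm W) + frobNorm D * (11 / 10 * a * frobNorm W) := by
    simp only [sub_mul, one_mul, Finset.sum_sub_distrib]
    have e1 := (abs_le.1 h4).2.trans (mul_le_mul_of_nonneg_left h7 hp0)
    have e2 := (abs_le.1 h3).1
    have e3 := mul_le_mul h5 (h6.trans hWZ) (Real.sqrt_nonneg _) hD0
    linarith
  have h10 : frobNorm W ^ 2 ≤ (2 * a * p + 22 / 10 * a * frobNorm D) * frobNorm W := by
    have e1 := mul_le_mul_of_nonneg_left hWZ hD0
    nlinarith
  have h11 : frobNorm W ≤ 2 * a * p + 22 / 10 * a * frobNorm D := by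
    rcases hW0.eq_or_lt with h0 | h0
    · rw [← h0]; positivity
    · rw [sq] at h10; exact le_of_mul_le_mul_right h10 h0
  refine (pow_le_pow_left₀ hW0 h11 2).trans ?_
  have h12 : (2 * a * p + 22 / 10 * a * frobNorm D) ^ 2
      ≤ a ^ 2 * (8 * p ^ 2 + 968 / 100 * frobNorm D ^ 2) := by
    rw [show (2 * a * p + 22 / 10 * a * frobNorm D) ^ 2
      = a ^ 2 * (2 * p + 22 / 10 * frobNorm D) ^ 2 by ring]
    gcongr
    nlinarith [sq_nonneg (2 * p - 22 / 10 * frobNorm D)]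
  refine h12.trans ?_
  nlinarith [mul_le_mul_of_nonneg_left hp2 (sq_nonneg a)]

/-- One step of projected sampled gradient descent. -/
theorem Near.step_le (N : Near U y a b τ Q₁ Q₂ Z g) (R : Regime U δ ν a b τ)
    (hω : GoodSample U h δ ν e ω) {η' η : ℝ} (hη' : 0 < η') (hη54 : η' ≤ 1 / 54)
    (hη : η = η' / a ^ 2) :
    frobNorm (projC τ (Z - η • gradf ns r m y ω Z) - U * Q₁) ^ 2
      + frobNorm (projC τ (Z - η • gradf ns r m y ω Z) - U * Q₂) ^ 2
      ≤ g - 2 * η * (62 / 100 * frobNorm (Z * Zᵀ - Gop ns y) ^ 2 - 25 / 1000 * b ^ 2 * g) := by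
  have ha := R.a_pos
  have hg := N.nonneg
  have hη0 : 0 < η := by rw [hη]; positivity
  set D := Z * Zᵀ - Gop ns y with hD
  set G := gradf ns r m y ω Z with hG
  have h1 := pow_le_pow_left₀ (frobNorm_nonneg _)
    (frobNorm_projC_sub_le (N.row_left R) (Z - η • G)) 2
  have h2 := pow_le_pow_left₀ (frobNorm_nonneg _)
    (frobNorm_projC_sub_le (N.symm.row_left R) (Z - η • G)) 2
  rw [sub_right_comm, frobNorm_sub_smul_sq] at h1 h2
  have h3 := N.frobInner_gradf_ge R hω
  have h4 := N.frobNorm_gradf_sq_le R hω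
  rw [← hG, ← hD] at h3 h4
  rw [frobInner_add_right, frobInner_comm G, frobInner_comm G] at h3
  have h5 : η * frobNorm G ^ 2 ≤ 33 / 100 * frobNorm D ^ 2 + 3 / 1000 * (b ^ 2 * g) := by
    calc _ ≤ η * (1768 / 100 * a ^ 2 * frobNorm D ^ 2 + 16 / 100 * a ^ 2 * (b ^ 2 * g)) := by gcongr
      _ = η' * (1768 / 100 * frobNorm D ^ 2 + 16 / 100 * (b ^ 2 * g)) := by
          rw [hη]; field_simp
      _ ≤ 1 / 54 * (1768 / 100 * frobNorm D ^ 2 + 16 / 100 * (b ^ 2 * g)) := by gcongr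
      _ ≤ _ := by nlinarith [sq_nonneg (frobNorm D), mul_nonneg (sq_nonneg b) hg]
  have h6 := N.eq
  have h7 : 5 / 4 * g ^ 2 ≤ 1 / 1000 * (b ^ 2 * g) := by
    nlinarith [mul_le_mul_of_nonneg_right (N.small_one R) hg, mul_nonneg (sq_nonneg b) hg]
  have h8 : 2 * η * (62 / 100 * frobNorm D ^ 2 - 25 / 1000 * b ^ 2 * g)
      ≤ 2 * η * (frobInner (Z - U * Q₁) G + frobInner (Z - U * Q₂) G) - 2 * η * (η * frobNorm G ^ 2)
      := by
    rw [← mul_sub]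
    refine mul_le_mul_of_nonneg_left ?_ (by positivity)
    linarith [sq_nonneg (frobNorm D), mul_nonneg (sq_nonneg b) hg]
  nlinarith

theorem Near.frobNorm_residual_sq_le (N : Near U y a b τ Q₁ Q₂ Z g) (R : Regime U δ ν a b τ) :
    frobNorm (Z * Zᵀ - Gop ns y) ^ 2 ≤ 3 * a ^ 2 * g := by
  have ha := R.a_pos
  have hg := N.nonneg
  have h1 := frobNorm_mul_transpose_le (by positivity) (N.opLe_left R) (Z - U * Q₂)
  have h2 := frobNorm_mul_transpose_le (by positivity) (N.symm.opLe_left R) (Z - U * Q₁)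
  rw [← frobNorm_transpose, transpose_mul, transpose_transpose] at h1
  have h3 : frobNorm (Z * Zᵀ - Gop ns y)
      ≤ 12 / 10 * a * (frobNorm (Z - U * Q₁) + frobNorm (Z - U * Q₂)) + g / 2 := by
    rw [N.residual_eq]
    refine (frobNorm_add_le _ _).trans (add_le_add ((frobNorm_add_le _ _).trans ?_)
      N.frobNorm_second_le)
    linarith
  have h4 := N.eq
  have h5 : (frobNorm (Z - U * Q₁) + frobNorm (Z - U * Q₂)) ^ 2 ≤ 2 * g := by
    nlinarith [sq_nonneg (frobNorm (Z - U * Q₁) - frobNorm (Z - U * Q₂))]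
  have h6 : g ^ 2 ≤ a ^ 2 * g / 10 ^ 8 := by
    nlinarith [mul_le_mul_of_nonneg_right (N.small_one R) hg,
      mul_le_mul_of_nonneg_right R.sq_le_sq hg]
  refine (pow_le_pow_left₀ (frobNorm_nonneg _) h3 2).trans ?_
  set w := frobNorm (Z - U * Q₁) + frobNorm (Z - U * Q₂)
  nlinarith [sq_nonneg (12 / 10 * a * w - 100 * (g / 2)),
    mul_le_mul_of_nonneg_left h5 (sq_nonneg a)]

/-- The size of one step. -/
theorem Near.step_size_le (N : Near U y a b τ Q₁ Q₂ Z g) (R : Regime U δ ν a b τ)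
    (hω : GoodSample U h δ ν e ω) {η' η : ℝ} (hη' : 0 < η') (hη : η = η' / a ^ 2) :
    frobNorm (projC τ (Z - η • gradf ns r m y ω Z) - Z) ≤ 8 * η' * √g := by
  have ha := R.a_pos
  have hb := R.b_pos
  have hg := N.nonneg
  have hη0 : 0 < η := by rw [hη]; positivity
  have h1 := frobNorm_projC_sub_le N.row_le (Z - η • gradf ns r m y ω Z)
  have e1 : Z - η • gradf ns r m y ω Z - Z = -(η • gradf ns r m y ω Z) := by abel
  rw [e1, frobNorm_neg, frobNorm_smul, abs_of_pos hη0] at h1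
  refine h1.trans ?_
  have hD := N.frobNorm_residual_sq_le R
  have hG : frobNorm (gradf ns r m y ω Z) ≤ 8 * a ^ 2 * √g := by
    refine le_of_sq_le_sq ((N.frobNorm_gradf_sq_le R hω).trans ?_) (by positivity)
    rw [mul_pow, Real.sq_sqrt hg]
    nlinarith [mul_le_mul_of_nonneg_left hD (sq_nonneg a),
      mul_le_mul_of_nonneg_left R.sq_le_sq (mul_nonneg (sq_nonneg a) hg)]
  calc _ ≤ η * (8 * a ^ 2 * √g) := by gcongr
    _ = _ := by rw [hη]; field_simp

end Descent

section Alignment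

variable {ns r m : ℕ} {U : Matrix (Fin ns) (Fin r) ℂ} {S : Matrix (Fin r) (Fin r) ℂ}
  {y h : Fin (2 * ns - 1) → ℂ} {δ ν a b τ e : ℝ} {Z : Matrix (Fin ns) (Fin r) ℂ}

theorem opLe_one_sub_of_orthonormal (hU : Uᴴ * U = 1) : OpLe (1 - U * Uᴴ) 1 := fun v => by
  have h1 : (1 - U * Uᴴ)ᴴ * (1 - U * Uᴴ) = 1 - U * Uᴴ := by
    rw [conjTranspose_sub, conjTranspose_one, conjTranspose_mul, conjTranspose_conjTranspose,
      Matrix.sub_mul, Matrix.one_mul, Matrix.mul_sub, Matrix.mul_one, Matrix.mul_assoc U,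
      ← Matrix.mul_assoc Uᴴ U, hU, Matrix.one_mul, sub_self, sub_zero]
  have h2 : ((vecNorm ((1 - U * Uᴴ) *ᵥ v) ^ 2 : ℝ) : ℂ)
      = ((vecNorm v ^ 2 - vecNorm (Uᴴ *ᵥ v) ^ 2 : ℝ) : ℂ) := by
    rw [Complex.ofReal_sub, ← star_dotProduct_self, ← star_dotProduct_self, ← star_dotProduct_self,
      star_mulVec, ← dotProduct_mulVec, mulVec_mulVec, h1, sub_mulVec, one_mulVec, dotProduct_sub,
      star_mulVec, ← dotProduct_mulVec, mulVec_mulVec, conjTranspose_conjTranspose]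
  have h3 := Complex.ofReal_injective h2
  rw [one_mul]
  exact le_of_sq_le_sq (by linarith [sq_nonneg (vecNorm (Uᴴ *ᵥ v))]) (vecNorm_nonneg _)

/-- The squared misfit of `Z` to `U * S` under the alignment `P`. -/
def misfit (U : Matrix (Fin ns) (Fin r) ℂ) (S : Matrix (Fin r) (Fin r) ℂ)
    (Z : Matrix (Fin ns) (Fin r) ℂ) (P : Matrix (Fin r) (Fin r) ℂ) : ℝ :=
  frobNorm (Z - U * (S * P)) ^ 2 + frobNorm (Z - U * (S * (P⁻¹)ᵀ)) ^ 2

theorem distP_le_sqrt_misfit (Z : Matrix (Fin ns) (Fin r) ℂ) {P : Matrix (Fin r) (Fin r) ℂ}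
    (hP : IsUnit P) : distP Z (U * S) ≤ √(misfit U S Z P) := by
  refine csInf_le ⟨0, ?_⟩ ⟨P, hP, ?_⟩
  · rintro _ ⟨_, _, rfl⟩
    exact Real.sqrt_nonneg _
  · rw [misfit, Matrix.mul_assoc, Matrix.mul_assoc]

theorem factor_of_isUnit {P : Matrix (Fin r) (Fin r) ℂ} (hP : IsUnit P) :
    U * S * (U * S)ᵀ = U * (S * P) * (U * (S * (P⁻¹)ᵀ))ᵀ := by
  have hP' : IsUnit P.det := (Matrix.isUnit_iff_isUnit_det P).1 hP
  simp only [transpose_mul, transpose_transpose, Matrix.mul_assoc]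
  rw [Matrix.mul_nonsing_inv_cancel_left _ _ hP']

/-- A small residual yields a good alignment. -/
theorem exists_misfit_le (hU : Uᴴ * U = 1) (hS : OpGe S b) (hSt : Sᵀ = S) (hb : 0 < b)
    (hZ : OpGe Z (9 / 10 * b)) (hD : frobNorm (Z * Zᵀ - U * S * (U * S)ᵀ) ≤ b ^ 2 / 100) :
    ∃ P, IsUnit P ∧
      misfit U S Z P ≤ 26 / 10 * frobNorm (Z * Zᵀ - U * S * (U * S)ᵀ) ^ 2 / b ^ 2 := by
  set D := Z * Zᵀ - U * S * (U * S)ᵀ with hDdef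
  have hSu : IsUnit S := isUnit_of_opGe hb hS
  have hSd : IsUnit S.det := (Matrix.isUnit_iff_isUnit_det S).1 hSu
  set T := Uᴴ * Z with hT
  have hD0 := frobNorm_nonneg D
  have h1 : 9 / 10 * b * frobNorm (Z - U * T) ≤ frobNorm D := by
    have e1 : (1 - U * Uᴴ) * D = (Z - U * T) * Zᵀ := by
      have : (1 - U * Uᴴ) * U = 0 := by
        rw [Matrix.sub_mul, Matrix.one_mul, Matrix.mul_assoc, hU, Matrix.mul_one, sub_self]
      rw [hDdef, Matrix.mul_sub, Matrix.mul_assoc U S, ← Matrix.mul_assoc _ U, this, Matrix.zero_mul,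
        sub_zero, ← Matrix.mul_assoc, Matrix.sub_mul, Matrix.one_mul, Matrix.mul_assoc U]
    have e2 := frobNorm_mul_le zero_le_one (opLe_one_sub_of_orthonormal hU) D
    rw [e1, one_mul] at e2
    exact (le_frobNorm_mul_transpose (by positivity) hZ _).trans e2
  have hTge : OpGe T (88 / 100 * b) := by
    have e1 := hZ.sub (opLe_frobNorm (Z - U * T))
    rw [sub_sub_cancel] at e1
    refine (OpGe.of_orthonormal_mul hU e1).mono ?_
    have : frobNorm (Z - U * T) ≤ 2 / 100 * b := by
      refine le_of_mul_le_mul_left (h1.trans (hD.trans ?_)) (by positivity : 0 < 9 / 10 * b)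
      nlinarith [sq_nonneg b]
    linarith
  have hTu : IsUnit T := isUnit_of_opGe (by positivity) hTge
  have hTd : IsUnit T.det := (Matrix.isUnit_iff_isUnit_det T).1 hTu
  have hSi : IsUnit S⁻¹ := by rw [Matrix.isUnit_nonsing_inv_iff]; exact hSu
  refine ⟨S⁻¹ * T, hSi.mul hTu, ?_⟩
  rw [misfit, Matrix.mul_nonsing_inv_cancel_left _ _ hSd, Matrix.mul_inv_rev,
    Matrix.nonsing_inv_nonsing_inv _ hSd, transpose_mul, hSt]
  set Y := Z - U * (S * (S * (T⁻¹)ᵀ)) with hY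
  have h2 : 88 / 100 * b * frobNorm Y ≤ frobNorm D := by
    have hUU : Uᵀ * (Uᴴ)ᵀ = 1 := by
      rw [← transpose_mul, hU, transpose_one]
    have e1 : Y * Tᵀ = D * (Uᴴ)ᵀ := by
      rw [hY, hDdef, Matrix.sub_mul, Matrix.sub_mul, hT, transpose_mul Uᴴ Z, transpose_mul U S, hSt]
      congr 1
      · rw [Matrix.mul_assoc]
      · rw [← transpose_mul Uᴴ Z, ← hT]
        simp only [Matrix.mul_assoc]
        rw [← transpose_mul, Matrix.mul_nonsing_inv _ hTd, transpose_one, hUU]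
    have e2 := frobNorm_mul_transpose_le zero_le_one
      ((opLe_of_orthonormal hU).conjTranspose zero_le_one) D
    rw [← e1, one_mul] at e2
    exact (le_frobNorm_mul_transpose (by positivity) hTge _).trans e2
  have hYn := frobNorm_nonneg Y
  have hXn := frobNorm_nonneg (Z - U * T)
  have h3 := pow_le_pow_left₀ (by positivity) h1 2
  have h4 := pow_le_pow_left₀ (by positivity) h2 2
  rw [le_div_iff₀ (by positivity)]
  nlinarith

theorem exists_misfit_step_le {ω : Fin m → Fin (2 * ns - 1)} (R : Regime U δ ν a b τ)
    (hω : GoodSample U h δ ν e ω) (hy : Gop ns y = U * S * (U * S)ᵀ) (hS : OpGe S b) (hSt : Sᵀ = S)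
    (hle : OpLe Z (11 / 10 * a)) (hge : OpGe Z (9 / 10 * b)) (hrow : ∀ i, vecNorm (Z i) ≤ τ)
    {d : ℝ} (hd : 0 ≤ d) (hda : d ^ 2 * a ^ 4 ≤ b ^ 6 / 10 ^ 8)
    (hP : ∃ P, IsUnit P ∧ misfit U S Z P ≤ d ^ 2)
    {η' η : ℝ} (hη' : 0 < η') (hη54 : η' ≤ 1 / 54) (hη : η = η' / a ^ 2) :
    (∃ P, IsUnit P ∧ misfit U S (projC τ (Z - η • gradf ns r m y ω Z)) P
        ≤ ((1 - 11 * η' / (100 * (a ^ 2 / b ^ 2))) * d) ^ 2)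
      ∧ frobNorm (projC τ (Z - η • gradf ns r m y ω Z) - Z) ≤ 8 * η' * d := by
  have ha := R.a_pos
  have hb := R.b_pos
  have near : ∀ P, IsUnit P → misfit U S Z P ≤ d ^ 2 →
      Near U y a b τ (S * P) (S * (P⁻¹)ᵀ) Z (misfit U S Z P) := fun P hPu hPd =>
    ⟨by rw [hy]; exact factor_of_isUnit hPu, hle, hrow, rfl, le_trans (by gcongr) hda⟩
  obtain ⟨P, hPu, hPd⟩ := hP
  set x := η * b ^ 2 with hx
  have hη0 : 0 < η := by rw [hη]; positivity
  have hx0 : 0 < x := by positivity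
  have hx1 : x ≤ 1 / 54 := by
    rw [hx, hη, div_mul_eq_mul_div, div_le_iff₀ (by positivity)]
    nlinarith [R.sq_le_sq, sq_nonneg a]
  have hxe : 11 * η' / (100 * (a ^ 2 / b ^ 2)) = 11 / 100 * x := by
    rw [hx, hη]; field_simp
  rw [hxe]
  have hd2 : 0 ≤ d ^ 2 := sq_nonneg d
  have hρ : (1 - 22 / 100 * x) * d ^ 2 ≤ ((1 - 11 / 100 * x) * d) ^ 2 := by
    nlinarith [mul_nonneg (sq_nonneg x) hd2]
  constructor
  · rcases le_or_gt (35 / 100 * (b ^ 2 * d ^ 2)) (frobNorm (Z * Zᵀ - Gop ns y) ^ 2) with hD | hD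
    · refine ⟨P, hPu, ((near P hPu hPd).step_le R hω hη' hη54 hη).trans (le_trans ?_ hρ)⟩
      have hg := (near P hPu hPd).nonneg
      have h1 : 2 * η * (62 / 100 * (35 / 100 * (b ^ 2 * d ^ 2)) - 25 / 1000 * b ^ 2 * d ^ 2)
          ≤ 2 * η * (62 / 100 * frobNorm (Z * Zᵀ - Gop ns y) ^ 2
            - 25 / 1000 * b ^ 2 * misfit U S Z P) := by
        gcongr
      have h2 : 2 * η * (62 / 100 * (35 / 100 * (b ^ 2 * d ^ 2)) - 25 / 1000 * b ^ 2 * d ^ 2)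
          = 384 / 1000 * (x * d ^ 2) := by rw [hx]; ring
      nlinarith [mul_nonneg hx0.le hd2]
    · have hsmall : frobNorm (Z * Zᵀ - Gop ns y) ≤ b ^ 2 / 100 := by
        refine le_of_sq_le_sq (hD.le.trans ?_) (by positivity)
        have h1 : d ^ 2 ≤ b ^ 2 / 10 ^ 8 := by
          refine le_of_mul_le_mul_right (hda.trans ?_) (by positivity : 0 < a ^ 4)
          have := pow_le_pow_left₀ hb.le R.b_le 4
          nlinarith [mul_le_mul_of_nonneg_left this (sq_nonneg b)]
        nlinarith [mul_le_mul_of_nonneg_left h1 (sq_nonneg b), sq_nonneg (b ^ 2)]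
      rw [hy] at hsmall
      obtain ⟨P', hPu', hPd'⟩ := exists_misfit_le R.orthonormal hS hSt hb hge hsmall
      rw [← hy] at hPd'
      have h1 : misfit U S Z P' ≤ 91 / 100 * d ^ 2 := by
        refine hPd'.trans ?_
        rw [div_le_iff₀ (by positivity)]
        nlinarith
      have hn := near P' hPu' (h1.trans (by linarith))
      refine ⟨P', hPu', (hn.step_le R hω hη' hη54 hη).trans (le_trans ?_ hρ)⟩
      have hg := hn.nonneg
      have h2 : misfit U S Z P' - 2 * η * (62 / 100 * frobNorm (Z * Zᵀ - Gop ns y) ^ 2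
            - 25 / 1000 * b ^ 2 * misfit U S Z P')
          ≤ misfit U S Z P' + 5 / 100 * (x * misfit U S Z P') := by
        have : 0 ≤ η * frobNorm (Z * Zᵀ - Gop ns y) ^ 2 := by positivity
        rw [hx]
        nlinarith
      nlinarith [mul_le_mul_of_nonneg_left h1 hx0.le, mul_le_mul_of_nonneg_right hx1 hd2]
  · refine ((near P hPu hPd).step_size_le R hω hη' hη).trans ?_
    gcongr
    exact Real.sqrt_le_iff.2 ⟨hd, hPd⟩

/-- Linear convergence from a good initial point. -/
theorem distP_le_of_good {K : ℕ} {ω : Fin (K + 1) → Fin m → Fin (2 * ns - 1)}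
    (R : Regime U δ ν a b τ) (hω : ∀ k, GoodSample U h δ ν e (ω k))
    (hy : Gop ns y = U * S * (U * S)ᵀ) (hS : OpGe S b) (hSt : Sᵀ = S)
    {Z₀ : Matrix (Fin ns) (Fin r) ℂ}
    (hle : OpLe Z₀ (101 / 100 * a)) (hge : OpGe Z₀ (99 / 100 * b))
    {d : ℝ} (hd : 0 ≤ d) (hda : d ^ 2 * a ^ 4 ≤ b ^ 6 / 10 ^ 8)
    {Zseq : ℕ → Matrix (Fin ns) (Fin r) ℂ} (hrow : ∀ i, vecNorm (Zseq 0 i) ≤ τ)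
    (h0 : frobNorm (Zseq 0 - Z₀) ≤ 2 * d)
    (hP : ∃ P, IsUnit P ∧ misfit U S (Zseq 0) P ≤ d ^ 2)
    {η' η : ℝ} (hη' : 0 < η') (hη54 : η' ≤ 1 / 54) (hη : η = η' / a ^ 2)
    (hstep : ∀ k : ℕ, ∀ hk : k ≤ K, Zseq (k + 1)
      = projC τ (Zseq k - η • gradf ns r m y (ω ⟨k, by omega⟩) (Zseq k))) (k : ℕ) (hk : k ≤ K + 1) :
    distP (Zseq k) (U * S) ≤ (1 - 11 * η' / (100 * (a ^ 2 / b ^ 2))) ^ k * d := by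
  have ha := R.a_pos
  have hb := R.b_pos
  set ρ := 1 - 11 * η' / (100 * (a ^ 2 / b ^ 2)) with hρ
  have hκ : 1 ≤ a ^ 2 / b ^ 2 := (one_le_div (by positivity)).2 R.sq_le_sq
  have hx0 : 0 ≤ 11 * η' / (100 * (a ^ 2 / b ^ 2)) := by positivity
  have hρ0 : 0 ≤ ρ := by
    rw [hρ, sub_nonneg, div_le_one (by positivity)]
    linarith
  have hρ1 : ρ ≤ 1 := by rw [hρ]; linarith
  have inv : ∀ k ≤ K + 1, (∀ i, vecNorm (Zseq k i) ≤ τ)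
      ∧ (∃ P, IsUnit P ∧ misfit U S (Zseq k) P ≤ (ρ ^ k * d) ^ 2)
      ∧ frobNorm (Zseq k - Z₀) + 73 * (a ^ 2 / b ^ 2) * (ρ ^ k * d) ≤ 5 / 100 * b := by
    intro k
    induction k with
    | zero =>
      intro _
      refine ⟨hrow, by simpa using hP, ?_⟩
      have h1 : a ^ 2 / b ^ 2 * d ≤ b / 10 ^ 4 := by
        refine le_of_sq_le_sq ?_ (by positivity)
        rw [mul_pow, div_pow, div_mul_eq_mul_div, div_le_iff₀ (by positivity)]
        calc (a ^ 2) ^ 2 * d ^ 2 = d ^ 2 * a ^ 4 := by ring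
          _ ≤ b ^ 6 / 10 ^ 8 := hda
          _ = _ := by ring
      have h2 : d ≤ a ^ 2 / b ^ 2 * d := le_mul_of_one_le_left hd hκ
      rw [pow_zero, one_mul]
      linarith
    | succ k ih =>
      intro hk
      obtain ⟨i1, i2, i3⟩ := ih (by omega)
      have hdk : 0 ≤ ρ ^ k * d := by positivity
      have hdk' : ρ ^ k * d ≤ d := mul_le_of_le_one_left hd (pow_le_one₀ hρ0 hρ1)
      have hfr : frobNorm (Zseq k - Z₀) ≤ 5 / 100 * b := by
        have : 0 ≤ 73 * (a ^ 2 / b ^ 2) * (ρ ^ k * d) := by positivity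
        linarith
      have hle' : OpLe (Zseq k) (11 / 10 * a) := by
        have := hle.add (opLe_frobNorm (Zseq k - Z₀))
        rw [add_sub_cancel] at this
        exact this.mono (by linarith [R.b_le])
      have hge' : OpGe (Zseq k) (9 / 10 * b) := by
        have := hge.sub (opLe_frobNorm (Z₀ - Zseq k))
        rw [sub_sub_cancel, frobNorm_sub_comm] at this
        exact this.mono (by linarith)
      have key := exists_misfit_step_le R (hω ⟨k, by omega⟩) hy hS hSt hle' hge' i1 hdk
        (le_trans (by gcongr) hda) i2 hη' hη54 hη
      rw [← hstep k (by omega), ← hρ] at key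
      obtain ⟨k1, k2⟩ := key
      refine ⟨fun i => ?_, by simpa only [pow_succ' ρ, mul_assoc] using k1, ?_⟩
      · rw [hstep k (by omega)]
        exact vecNorm_projC_row_le R.τ_nonneg _ i
      · have h3 : frobNorm (Zseq (k + 1) - Z₀)
            ≤ frobNorm (Zseq (k + 1) - Zseq k) + frobNorm (Zseq k - Z₀) := by
          rw [← sub_add_sub_cancel (Zseq (k + 1)) (Zseq k) Z₀]
          exact frobNorm_add_le _ _
        have h4 : 73 * (a ^ 2 / b ^ 2) * (ρ ^ (k + 1) * d)
            = 73 * (a ^ 2 / b ^ 2) * (ρ ^ k * d) - 803 / 100 * η' * (ρ ^ k * d) := by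
          have h6 : a ^ 2 / b ^ 2 * ρ = a ^ 2 / b ^ 2 - 11 / 100 * η' := by
            rw [hρ]
            field_simp
          rw [pow_succ]
          linear_combination 73 * (ρ ^ k * d) * h6
        have h5 : 0 ≤ η' * (ρ ^ k * d) := by positivity
        rw [h4]
        linarith
  obtain ⟨_, ⟨P, hPu, hPd⟩, _⟩ := inv k hk
  exact (distP_le_sqrt_misfit (Zseq k) hPu).trans
    (Real.sqrt_le_iff.2 ⟨by positivity, hPd⟩)

end Alignment

/-! ### Spectral norm -/

section SpectralNorm

variable {m n : ℕ} {A : Matrix (Fin m) (Fin n) ℂ}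

theorem OpLe.specNorm_le {s : ℝ} (hs : 0 ≤ s) (hA : OpLe A s) : specNorm A ≤ s := by
  refine Real.sSup_le ?_ hs
  rintro _ ⟨v, hv, rfl⟩
  simpa [hv] using hA v

theorem opLe_specNorm (A : Matrix (Fin m) (Fin n) ℂ) : OpLe A (specNorm A) := fun v => by
  rcases eq_or_ne v 0 with rfl | hv
  · simp [vecNorm_zero]
  have hv0 : 0 < vecNorm v := (vecNorm_nonneg v).lt_of_ne fun h => hv (vecNorm_eq_zero.1 h.symm)
  have hbdd : BddAbove {t : ℝ | ∃ v : Fin n → ℂ, vecNorm v = 1 ∧ t = vecNorm (A *ᵥ v)} := by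
    refine ⟨frobNorm A, ?_⟩
    rintro _ ⟨w, hw, rfl⟩
    simpa [hw] using opLe_frobNorm A w
  have hnorm : ‖(((vecNorm v)⁻¹ : ℝ) : ℂ)‖ = (vecNorm v)⁻¹ := by
    rw [Complex.norm_real, Real.norm_of_nonneg (inv_nonneg.2 hv0.le)]
  have h : vecNorm (A *ᵥ ((((vecNorm v)⁻¹ : ℝ) : ℂ) • v)) ≤ specNorm A := by
    refine le_csSup hbdd ⟨_, ?_, rfl⟩
    rw [vecNorm_smul, hnorm, inv_mul_cancel₀ hv0.ne']
  rwa [mulVec_smul, vecNorm_smul, hnorm, inv_mul_le_iff₀ hv0, mul_comm] at h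

/-- A best approximation is at most twice as far from `B` as the data is. -/
theorem OpLe.sub_of_specNorm_le {A B D : Matrix (Fin m) (Fin n) ℂ} {s : ℝ} (hs : 0 ≤ s)
    (hB : OpLe (B - D) s) (hAB : specNorm (A - D) ≤ specNorm (B - D)) : OpLe (A - B) (2 * s) := by
  have h1 : OpLe (A - D) s := (opLe_specNorm _).mono (hAB.trans (hB.specNorm_le hs))
  have h2 := h1.sub hB
  rwa [sub_sub_sub_cancel_right, ← two_mul] at h2

end SpectralNorm

/-! ### Sampling error of a Hankel matrix -/

section HankelError

variable {ns r m : ℕ}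

theorem opLe_of_norm_hankel_form {A : Matrix (Fin ns) (Fin ns) ℂ} {B : ℝ} (hB : 0 ≤ B)
    (h : ∀ u v : Fin ns → ℂ, ‖u ⬝ᵥ A *ᵥ v‖ ≤ B * (vecNorm u * vecNorm v)) : OpLe A B := fun v => by
  have h1 := h (star (A *ᵥ v)) v
  rw [star_dotProduct_self, vecNorm_conj, Complex.norm_real,
    Real.norm_of_nonneg (sq_nonneg _)] at h1
  rcases (vecNorm_nonneg (A *ᵥ v)).eq_or_lt with h0 | h0
  · rw [← h0]
    exact mul_nonneg hB (vecNorm_nonneg v)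
  · refine le_of_mul_le_mul_left ?_ h0
    linarith

theorem sum_smul_Gop_single (y : Fin (2 * ns - 1) → ℂ) (ω : Fin m → Fin (2 * ns - 1)) :
    (((2 * ns - 1 : ℕ) : ℝ) / (m : ℝ)) • ∑ j : Fin m, y (ω j) • Gop ns (Pi.single (ω j) 1)
      = Gop ns (fun a => (sampleWeight ω a : ℂ) * y a) := by
  rw [← sampleWeight_smul_eq]
  ext i j
  simp [Gop, Matrix.sum_apply, Finset.sum_div, mul_div_assoc]

theorem GoodSample.opLe_error {U : Matrix (Fin ns) (Fin r) ℂ} {y : Fin (2 * ns - 1) → ℂ}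
    {δ ν e : ℝ} {ω : Fin m → Fin (2 * ns - 1)} (he : 0 ≤ e)
    (hω : GoodSample U (fun a => y a / (√(hw ns a) : ℝ)) δ ν e ω) :
    OpLe (Gop ns y - (((2 * ns - 1 : ℕ) : ℝ) / (m : ℝ)) •
      ∑ j : Fin m, y (ω j) • Gop ns (Pi.single (ω j) 1)) e := by
  rw [sum_smul_Gop_single, ← Gop_sub]
  refine opLe_of_norm_hankel_form he fun u v => ?_
  have h1 := norm_hankel_form_le
    (fun a => ((sampleWeight ω a - 1 : ℝ) : ℂ) * (y a / (√(hw ns a) : ℝ))) (B := e) (fun k => by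
      have := hω.symbol k
      simpa only [Complex.real_smul, mul_assoc] using this) u v
  have h2 : u ⬝ᵥ Gop ns (y - fun a => (sampleWeight ω a : ℂ) * y a) *ᵥ v
      = -∑ p : Fin ns × Fin ns, ((sampleWeight ω (skewIndex p) - 1 : ℝ) : ℂ)
        * (y (skewIndex p) / (√(hw ns (skewIndex p)) : ℝ)) * (u p.1 * v p.2) := by
    rw [Fintype.sum_prod_type, dotProduct, ← Finset.sum_neg_distrib]
    refine Finset.sum_congr rfl fun i _ => ?_
    rw [Matrix.mulVec, dotProduct, Finset.mul_sum, ← Finset.sum_neg_distrib]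
    refine Finset.sum_congr rfl fun j _ => ?_
    rw [Gop_apply _ (i, j)]
    simp only [Pi.sub_apply]
    push_cast
    ring
  rw [h2, norm_neg]
  exact h1

end HankelError

/-! ### Symmetric factorizations -/

section SymmetricFactorization

variable {ns r : ℕ} {U U₀ : Matrix (Fin ns) (Fin r) ℂ} {d d₀ : Fin r → ℝ}
  {M M₀ : Matrix (Fin ns) (Fin ns) ℂ} {s e : ℝ}

theorem transpose_mul_conjM (hU : Uᴴ * U = 1) : Uᵀ * conjM U = 1 := by
  have h := congrArg Matrix.transpose hU
  rwa [transpose_mul, transpose_one, ← transpose_conjM U, transpose_transpose] at h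

theorem orthonormal_conjM (hU : Uᴴ * U = 1) : (conjM U)ᴴ * conjM U = 1 := by
  have : (conjM U)ᴴ = Uᵀ := by ext i j; simp [conjM]
  rw [this, transpose_mul_conjM hU]

theorem frobNorm_sq_of_orthonormal (hU : Uᴴ * U = 1) : frobNorm U ^ 2 = r := by
  rw [frobNorm_sq_eq_cols]
  have h : ∀ j, vecNorm (U.col j) ^ 2 = 1 := fun j => by
    have h1 : star (U.col j) ⬝ᵥ U.col j = (Uᴴ * U) j j := rfl
    rw [hU, star_dotProduct_self, one_apply_eq] at h1
    exact_mod_cast h1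
  simp [h]

theorem frobNorm_of_orthonormal (hU : Uᴴ * U = 1) : frobNorm U = √r := by
  rw [← frobNorm_sq_of_orthonormal hU, Real.sqrt_sq (frobNorm_nonneg U)]

/-- The difference of two matrices of rank at most `r` is controlled in Frobenius norm by its
spectral norm. -/
theorem frobNorm_le_of_opLe (hU : Uᴴ * U = 1) (hU₀ : U₀ᴴ * U₀ = 1)
    {D D₀ : Matrix (Fin r) (Fin r) ℂ} (hM : M = U * D * Uᵀ) (hM₀ : M₀ = U₀ * D₀ * U₀ᵀ)
    (he : 0 ≤ e) (hE : OpLe (M₀ - M) e) : frobNorm (M₀ - M) ≤ 2 * (e * √r) := by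
  set E := M₀ - M with hEdef
  have h1 : E = U₀ * (U₀ᴴ * E) + (1 - U₀ * U₀ᴴ) * ((E * conjM U) * Uᵀ) := by
    have e1 : (1 - U₀ * U₀ᴴ) * M₀ = 0 := by
      rw [hM₀, Matrix.sub_mul, Matrix.one_mul, Matrix.mul_assoc U₀ U₀ᴴ, Matrix.mul_assoc U₀ D₀,
        ← Matrix.mul_assoc U₀ᴴ, hU₀, Matrix.one_mul, sub_self]
    have e2 : M * conjM U * Uᵀ = M := by
      rw [hM, Matrix.mul_assoc _ Uᵀ, transpose_mul_conjM hU, Matrix.mul_one]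
    have e3 : (1 - U₀ * U₀ᴴ) * ((E * conjM U) * Uᵀ) = (1 - U₀ * U₀ᴴ) * E := by
      rw [hEdef, Matrix.sub_mul M₀, Matrix.sub_mul (M₀ * _), e2, Matrix.mul_sub, Matrix.mul_sub, e1,
        Matrix.mul_assoc M₀, ← Matrix.mul_assoc _ M₀, e1, Matrix.zero_mul]
    rw [e3, Matrix.sub_mul, Matrix.one_mul, Matrix.mul_assoc, add_sub_cancel]
  have h2 : frobNorm (U₀ * (U₀ᴴ * E)) ≤ e * √r := by
    refine (frobNorm_mul_le zero_le_one (opLe_of_orthonormal hU₀) _).trans ?_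
    rw [one_mul, ← frobNorm_conjTranspose, conjTranspose_mul, conjTranspose_conjTranspose,
      ← frobNorm_of_orthonormal hU₀]
    exact frobNorm_mul_le he (hE.conjTranspose he) _
  have h3 : frobNorm ((1 - U₀ * U₀ᴴ) * ((E * conjM U) * Uᵀ)) ≤ e * √r := by
    refine (frobNorm_mul_le zero_le_one (opLe_one_sub_of_orthonormal hU₀) _).trans ?_
    refine le_trans (mul_le_mul_of_nonneg_left
      (frobNorm_mul_transpose_le zero_le_one (opLe_of_orthonormal hU) _) zero_le_one) ?_
    rw [one_mul, one_mul, ← frobNorm_of_orthonormal hU, ← frobNorm_conjM U]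
    exact frobNorm_mul_le he hE _
  rw [h1]
  linarith [frobNorm_add_le (U₀ * (U₀ᴴ * E)) ((1 - U₀ * U₀ᴴ) * ((E * conjM U) * Uᵀ))]

theorem mul_conjM_of_eq (hU : Uᴴ * U = 1) {D : Matrix (Fin r) (Fin r) ℂ} (hM : M = U * D * Uᵀ) :
    M * conjM U = U * D := by
  rw [hM, Matrix.mul_assoc _ Uᵀ, transpose_mul_conjM hU, Matrix.mul_one]

theorem vecNorm_single (k : Fin r) (c : ℂ) : vecNorm (Pi.single k c) = ‖c‖ := by
  have : vecNorm (Pi.single k c) ^ 2 = ‖c‖ ^ 2 := by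
    rw [vecNorm_sq, Finset.sum_eq_single k] <;> simp +contextual
  exact (pow_left_inj₀ (vecNorm_nonneg _) (norm_nonneg _) two_ne_zero).1 this

theorem vecNorm_mulVec_single (hU : Uᴴ * U = 1) (hd : ∀ k, 0 ≤ d k)
    (hM : M = U * diagonal (fun k => (d k : ℂ)) * Uᵀ) (k : Fin r) :
    vecNorm (M *ᵥ (conjM U *ᵥ Pi.single k 1)) = d k := by
  rw [mulVec_mulVec, mul_conjM_of_eq hU hM, ← mulVec_mulVec, vecNorm_mulVec_of_orthonormal hU,
    diagonal_mulVec_single, mul_one, vecNorm_single, Complex.norm_real, Real.norm_of_nonneg (hd k)]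

theorem le_of_opLe_factorization (hU : Uᴴ * U = 1) (hd : ∀ k, 0 ≤ d k)
    (hM : M = U * diagonal (fun k => (d k : ℂ)) * Uᵀ) (hs : OpLe M s) (k : Fin r) : d k ≤ s := by
  have h := hs (conjM U *ᵥ Pi.single k 1)
  rwa [vecNorm_mulVec_single hU hd hM, vecNorm_mulVec_of_orthonormal (orthonormal_conjM hU),
    vecNorm_single, norm_one, mul_one] at h

theorem opLe_factorization (hU : Uᴴ * U = 1) (hd : ∀ k, 0 ≤ d k)
    (hM : M = U * diagonal (fun k => (d k : ℂ)) * Uᵀ) (hs : 0 ≤ s) (h : ∀ k, d k ≤ s) :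
    OpLe M s := by
  have h1 : OpLe (diagonal fun k => (d k : ℂ)) s := opLe_diagonal hs fun k => by
    rw [Complex.norm_real, Real.norm_of_nonneg (hd k)]; exact h k
  have h2 := ((opLe_of_orthonormal hU).mul zero_le_one h1).mul (by linarith)
    ((opLe_of_orthonormal hU).transpose zero_le_one)
  rw [hM]
  simpa using h2

/-- Perturbation bound for the smallest singular value. -/
theorem le_of_opLe_sub (hU : Uᴴ * U = 1) (hU₀ : U₀ᴴ * U₀ = 1) (hd : ∀ k, s ≤ d k) (hs : 0 ≤ s)
    (hd₀ : ∀ k, 0 ≤ d₀ k) (hM : M = U * diagonal (fun k => (d k : ℂ)) * Uᵀ)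
    (hM₀ : M₀ = U₀ * diagonal (fun k => (d₀ k : ℂ)) * U₀ᵀ) (he : e < s) (hE : OpLe (M₀ - M) e)
    (k : Fin r) : s - e ≤ d₀ k := by
  set D₀ := diagonal fun k => (d₀ k : ℂ) with hD₀
  set B := U₀ᵀ * conjM U with hB
  have h1 : OpGe (M * conjM U) s := by
    rw [mul_conjM_of_eq hU hM]
    have := (opGe_of_orthonormal hU).mul zero_le_one (opGe_diagonal (d := fun k => (d k : ℂ)) hs
      fun k => by rw [Complex.norm_real, Real.norm_of_nonneg (hs.trans (hd k))]; exact hd k)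
    simpa using this
  have hcU := orthonormal_conjM hU
  have h2 : OpGe (M₀ * conjM U) (s - e) := by
    intro v
    have h3 := h1 v
    have h4 := hE (conjM U *ᵥ v)
    rw [vecNorm_mulVec_of_orthonormal hcU, sub_mulVec] at h4
    rw [← mulVec_mulVec] at h3 ⊢
    have h5 := vecNorm_sub_le (M₀ *ᵥ (conjM U *ᵥ v))
      (M₀ *ᵥ (conjM U *ᵥ v) - M *ᵥ (conjM U *ᵥ v))
    rw [sub_sub_cancel] at h5
    rw [sub_mul]
    linarith
  have h3 : OpGe (D₀ * B) (s - e) := by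
    rw [hM₀, Matrix.mul_assoc, Matrix.mul_assoc] at h2
    exact OpGe.of_orthonormal_mul hU₀ h2
  have hBu : IsUnit B := by
    have := (Matrix.isUnit_iff_isUnit_det _).1 (isUnit_of_opGe (sub_pos.2 he) h3)
    rw [det_mul] at this
    exact (Matrix.isUnit_iff_isUnit_det _).2 (isUnit_of_mul_isUnit_right this)
  have hBle : OpLe B 1 := by
    have := ((opLe_of_orthonormal hU₀).transpose zero_le_one).mul zero_le_one
      (opLe_of_orthonormal hcU)
    rwa [one_mul] at this
  have hBx : B *ᵥ (B⁻¹ *ᵥ Pi.single k 1) = Pi.single k 1 := by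
    rw [mulVec_mulVec, Matrix.mul_nonsing_inv _ ((Matrix.isUnit_iff_isUnit_det _).1 hBu),
      one_mulVec]
  have h4 := h3 (B⁻¹ *ᵥ Pi.single k 1)
  have h5 := hBle (B⁻¹ *ᵥ Pi.single k 1)
  rw [hBx, vecNorm_single, norm_one, one_mul] at h5
  rw [← mulVec_mulVec, hBx, hD₀, diagonal_mulVec_single, mul_one, vecNorm_single, Complex.norm_real,
    Real.norm_of_nonneg (hd₀ k)] at h4
  exact (le_mul_of_one_le_right (sub_pos.2 he).le h5).trans h4

end SymmetricFactorization

/-! ### Initialization -/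

section Initialization

variable {ns r m : ℕ} {U U₀ : Matrix (Fin ns) (Fin r) ℂ} {S : Matrix (Fin r) (Fin r) ℂ}
  {d d₀ : Fin r → ℝ} {M M₀ : Matrix (Fin ns) (Fin ns) ℂ} {Z : Matrix (Fin ns) (Fin r) ℂ}
  {δ ν a b τ e ε : ℝ}

theorem exists_misfit_projC_le (R : Regime U δ ν a b τ) (hS : OpGe S b) (hSt : Sᵀ = S)
    (hle : OpLe Z (101 / 100 * a)) (hge : OpGe Z (99 / 100 * b))
    (hD : frobNorm (Z * Zᵀ - U * S * (U * S)ᵀ) * a ^ 2 ≤ 6 / 10 ^ 5 * b ^ 4) :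
    (∃ P, IsUnit P ∧ misfit U S (projC τ Z) P ≤ (b ^ 3 / a ^ 2 / 10 ^ 4) ^ 2) ∧
      frobNorm (projC τ Z - Z) ≤ 2 * (b ^ 3 / a ^ 2 / 10 ^ 4) := by
  have ha := R.a_pos
  have hb := R.b_pos
  have hab := R.sq_le_sq
  have hF := frobNorm_nonneg (Z * Zᵀ - U * S * (U * S)ᵀ)
  set F := frobNorm (Z * Zᵀ - U * S * (U * S)ᵀ)
  set g := b ^ 3 / a ^ 2 / 10 ^ 4 with hg
  have hg0 : 0 ≤ g := by positivity
  have hF1 : F ≤ b ^ 2 / 100 := by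
    refine le_of_mul_le_mul_right (hD.trans ?_) (by positivity : 0 < a ^ 2)
    nlinarith [mul_le_mul_of_nonneg_left hab (sq_nonneg b)]
  obtain ⟨P, hPu, hP⟩ := exists_misfit_le R.orthonormal hS hSt hb
    (fun v => (mul_le_mul_of_nonneg_right (by linarith) (vecNorm_nonneg v)).trans (hge v)) hF1
  have hFg : 26 / 10 * F ^ 2 / b ^ 2 ≤ g ^ 2 := by
    rw [hg, div_pow, div_pow, div_div, div_le_div_iff₀ (by positivity) (by positivity)]
    have h1 : (F * a ^ 2) ^ 2 ≤ (6 / 10 ^ 5 * b ^ 4) ^ 2 := by gcongr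
    nlinarith [pow_pos hb 8]
  have hga : g ≤ a / 10 := by
    rw [hg, div_div, div_le_iff₀ (by positivity)]
    have h1 : b ^ 3 ≤ a ^ 3 := pow_le_pow_left₀ hb.le R.b_le 3
    nlinarith [pow_pos ha 3]
  have row : ∀ Q : Matrix (Fin r) (Fin r) ℂ, frobNorm (Z - U * Q) ≤ g →
      ∀ i, vecNorm ((U * Q) i) ≤ τ := fun Q hQ i => by
    have h1 := hle.sub (opLe_frobNorm (Z - U * Q))
    rw [sub_sub_cancel] at h1
    have h2 : OpLe Q (12 / 10 * a) :=
      (OpLe.of_orthonormal_mul R.orthonormal h1).mono (by linarith)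
    refine le_of_sq_le_sq ?_ R.τ_nonneg
    calc vecNorm ((U * Q) i) ^ 2 ≤ (vecNorm (U i) * (12 / 10 * a)) ^ 2 :=
          pow_le_pow_left₀ (vecNorm_nonneg _) (vecNorm_row_mul_le (by positivity) h2 U i) 2
      _ = vecNorm (U i) ^ 2 * (144 / 100 * a ^ 2) := by ring
      _ ≤ ν * (144 / 100 * a ^ 2) := mul_le_mul_of_nonneg_right (R.row_le i) (by positivity)
      _ ≤ 2 * (ν * a ^ 2) := by nlinarith [mul_nonneg R.ν_nonneg (sq_nonneg a)]
      _ ≤ τ ^ 2 := R.le_τ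
  have hPg := hP.trans hFg
  rw [misfit] at hPg
  have b1 : frobNorm (Z - U * (S * P)) ≤ g := le_of_sq_le_sq
    (by linarith [sq_nonneg (frobNorm (Z - U * (S * (P⁻¹)ᵀ)))]) hg0
  have b2 : frobNorm (Z - U * (S * (P⁻¹)ᵀ)) ≤ g := le_of_sq_le_sq
    (by linarith [sq_nonneg (frobNorm (Z - U * (S * P)))]) hg0
  have p1 := frobNorm_projC_sub_le (row _ b1) Z
  have p2 := frobNorm_projC_sub_le (row _ b2) Z
  refine ⟨⟨P, hPu, le_trans ?_ hPg⟩, ?_⟩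
  · rw [misfit]
    exact add_le_add (pow_le_pow_left₀ (frobNorm_nonneg _) p1 2)
      (pow_le_pow_left₀ (frobNorm_nonneg _) p2 2)
  · have h1 := frobNorm_sub_le (projC τ Z - U * (S * P)) (Z - U * (S * P))
    rw [sub_sub_sub_cancel_right] at h1
    linarith

/-- The spectral norm of a good approximation localizes the largest singular value. -/
theorem specNorm_div_mem (hU : Uᴴ * U = 1) (hd : ∀ k, 0 ≤ d k) (hda : ∀ k, d k ≤ a ^ 2)
    (k : Fin r) (hk : d k = a ^ 2) (hM : M = U * diagonal (fun k => (d k : ℂ)) * Uᵀ)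
    (hE : OpLe (M₀ - M) e) (hε : 0 < ε) (hε1 : ε ≤ 1 / 100) (he : 0 ≤ e) (heε : e ≤ ε * a ^ 2) :
    a ^ 2 ≤ specNorm M₀ / (1 - ε) ∧ specNorm M₀ / (1 - ε) ≤ 11 / 10 * a ^ 2 := by
  have hup : specNorm M₀ ≤ a ^ 2 + e := by
    have := (opLe_factorization hU hd hM (sq_nonneg a) hda).add hE
    rw [add_sub_cancel] at this
    exact this.specNorm_le (by positivity)
  have hlow : a ^ 2 - e ≤ specNorm M₀ := by
    have h1 := ((opLe_specNorm M₀).sub hE)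
    rw [sub_sub_cancel] at h1
    linarith [le_of_opLe_factorization hU hd hM h1 k]
  have h1 : 0 < 1 - ε := by linarith
  rw [le_div_iff₀ h1, div_le_iff₀ h1]
  constructor <;> nlinarith [sq_nonneg a]

theorem diagonal_sqrt_mul_self (hd : ∀ k, 0 ≤ d k) :
    diagonal (fun k => (√(d k) : ℂ)) * (diagonal (fun k => (√(d k) : ℂ)))ᵀ
      = diagonal (fun k => (d k : ℂ)) := by
  rw [diagonal_transpose, diagonal_mul_diagonal]
  congr 1
  ext k
  rw [← Complex.ofReal_mul, Real.mul_self_sqrt (hd k)]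

theorem factorization_eq_sqrt (hd : ∀ k, 0 ≤ d k) :
    U * diagonal (fun k => (d k : ℂ)) * Uᵀ
      = U * diagonal (fun k => (√(d k) : ℂ)) * (U * diagonal (fun k => (√(d k) : ℂ)))ᵀ := by
  rw [transpose_mul, ← diagonal_sqrt_mul_self hd]
  simp only [Matrix.mul_assoc]

theorem opGe_diagonal_sqrt {s : ℝ} (hs : 0 ≤ s) (hd : ∀ k, s ^ 2 ≤ d k) :
    OpGe (diagonal (fun k => (√(d k) : ℂ))) s := opGe_diagonal hs fun k => by
  rw [Complex.norm_real, Real.norm_of_nonneg (Real.sqrt_nonneg _)]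
  exact Real.le_sqrt_of_sq_le (hd k)

theorem opLe_diagonal_sqrt {s : ℝ} (hs : 0 ≤ s) (hd : ∀ k, d k ≤ s ^ 2) :
    OpLe (diagonal (fun k => (√(d k) : ℂ))) s := opLe_diagonal hs fun k => by
  rw [Complex.norm_real, Real.norm_of_nonneg (Real.sqrt_nonneg _)]
  exact Real.sqrt_le_iff.2 ⟨hs, hd k⟩

/-- Linear convergence from a good spectral initialization. -/
theorem distP_le_of_init {y h : Fin (2 * ns - 1) → ℂ} {K : ℕ} {E : ℝ}
    {ω : Fin (K + 1) → Fin m → Fin (2 * ns - 1)}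
    (R : Regime U δ ν a b τ) (hω : ∀ k, GoodSample U h δ ν E (ω k))
    (hdb : ∀ k, b ^ 2 ≤ d k) (hda : ∀ k, d k ≤ a ^ 2)
    (hy : Gop ns y = U * diagonal (fun k => (d k : ℂ)) * Uᵀ)
    (hU₀ : U₀ᴴ * U₀ = 1) (hd₀ : ∀ k, 0 ≤ d₀ k)
    (hM₀ : M₀ = U₀ * diagonal (fun k => (d₀ k : ℂ)) * U₀ᵀ)
    (hE : OpLe (M₀ - Gop ns y) e) (he : 0 ≤ e) (hr : 1 ≤ r)
    (her : e * √r * a ^ 2 ≤ 3 / 10 ^ 5 * b ^ 4)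
    {Zseq : ℕ → Matrix (Fin ns) (Fin r) ℂ}
    (hZ₀ : Zseq 0 = projC τ (U₀ * diagonal (fun k => (√(d₀ k) : ℂ))))
    {η' η : ℝ} (hη' : 0 < η') (hη54 : η' ≤ 1 / 54) (hη : η = η' / a ^ 2)
    (hstep : ∀ k : ℕ, ∀ hk : k ≤ K, Zseq (k + 1)
      = projC τ (Zseq k - η • gradf ns r m y (ω ⟨k, by omega⟩) (Zseq k))) (k : ℕ) (hk : k ≤ K + 1) :
    distP (Zseq k) (U * diagonal (fun k => (√(d k) : ℂ)))
      ≤ (1 - 11 * η' / (100 * (a ^ 2 / b ^ 2))) ^ k * (b ^ 3 / a ^ 2 / 10 ^ 4) := by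
  have ha := R.a_pos
  have hb := R.b_pos
  have hab := R.sq_le_sq
  have hd : ∀ k, 0 ≤ d k := fun k => (sq_nonneg b).trans (hdb k)
  have hr1 : 1 ≤ √(r : ℝ) := Real.one_le_sqrt.2 (by exact_mod_cast hr)
  have heb : e ≤ b ^ 2 / 10 ^ 4 := by
    refine le_of_mul_le_mul_right ?_ (by positivity : 0 < a ^ 2)
    have h1 : e * a ^ 2 ≤ e * √r * a ^ 2 :=
      mul_le_mul_of_nonneg_right (le_mul_of_one_le_right he hr1) (sq_nonneg a)
    nlinarith [mul_le_mul_of_nonneg_left hab (sq_nonneg b)]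
  set Z₀ := U₀ * diagonal (fun k => (√(d₀ k) : ℂ)) with hZ₀def
  have hle : OpLe Z₀ (101 / 100 * a) := by
    have h1 : OpLe M₀ (a ^ 2 + e) := by
      have := (opLe_factorization R.orthonormal hd hy (sq_nonneg a) hda).add hE
      rwa [add_sub_cancel] at this
    have := (opLe_of_orthonormal hU₀).mul zero_le_one (opLe_diagonal_sqrt (d := d₀)
      (s := 101 / 100 * a) (by positivity)
      fun k => (le_of_opLe_factorization hU₀ hd₀ hM₀ h1 k).trans (by nlinarith))
    rwa [one_mul] at this
  have hge : OpGe Z₀ (99 / 100 * b) := by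
    have h1 := le_of_opLe_sub R.orthonormal hU₀ hdb (sq_nonneg b) hd₀ hy hM₀
      (by nlinarith [pow_pos hb 2]) hE
    have := (opGe_of_orthonormal hU₀).mul zero_le_one (opGe_diagonal_sqrt (d := d₀)
      (s := 99 / 100 * b) (by positivity) fun k => le_trans (by nlinarith [pow_pos hb 2]) (h1 k))
    rwa [one_mul] at this
  have hS := opGe_diagonal_sqrt hb.le hdb
  have hSt : (diagonal (fun k => (√(d k) : ℂ)))ᵀ = diagonal (fun k => (√(d k) : ℂ)) :=
    diagonal_transpose _
  have hD : frobNorm (Z₀ * Z₀ᵀ - U * diagonal (fun k => (√(d k) : ℂ))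
      * (U * diagonal (fun k => (√(d k) : ℂ)))ᵀ) * a ^ 2 ≤ 6 / 10 ^ 5 * b ^ 4 := by
    rw [hZ₀def, ← factorization_eq_sqrt hd, ← factorization_eq_sqrt hd₀, ← hM₀, ← hy]
    have := frobNorm_le_of_opLe R.orthonormal hU₀ hy hM₀ he hE
    nlinarith [mul_le_mul_of_nonneg_right this (sq_nonneg a)]
  obtain ⟨hP, hproj⟩ := exists_misfit_projC_le R hS hSt hle hge hD
  rw [← hZ₀] at hP hproj
  refine distP_le_of_good R hω (by rw [hy, factorization_eq_sqrt hd]) hS hSt hle hge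
    (by positivity) (le_of_eq ?_) (fun i => ?_) hproj hP hη' hη54 hη hstep k hk
  · field_simp
  · rw [hZ₀]
    exact vecNorm_projC_row_le R.τ_nonneg _ i

end Initialization

/-! ### Entries of an incoherent Hankel matrix -/

section Incoherence

variable {ns r m : ℕ} {U U₀ : Matrix (Fin ns) (Fin r) ℂ} {d d₀ : Fin r → ℝ}
  {y : Fin (2 * ns - 1) → ℂ} {δ ν a b τ ε μ E : ℝ}

theorem vecNorm_row_le_norm2inf (i : Fin ns) : vecNorm (U i) ≤ norm2inf U :=
  le_ciSup (f := fun i => vecNorm (U i)) (Set.finite_range _).bddAbove i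

theorem exists_skewIndex_eq (c : Fin (2 * ns - 1)) : ∃ p : Fin ns × Fin ns, skewIndex p = c := by
  have h := hw_pos c
  rw [← card_skewDiag, Finset.card_pos] at h
  obtain ⟨p, hp⟩ := h
  exact ⟨p, mem_skewDiag.1 hp⟩

theorem sum_le_sum_first_add_sum_last (hns : 0 < ns) {f : Fin (2 * ns - 1) → ℝ}
    (hf : ∀ c, 0 ≤ f c) :
    ∑ c, f c ≤ ∑ j : Fin ns, f (skewIndex (⟨0, hns⟩, j))
      + ∑ j : Fin ns, f (skewIndex (⟨ns - 1, by omega⟩, j)) := by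
  let g : Fin ns ⊕ Fin ns → Fin (2 * ns - 1) :=
    Sum.elim (fun j => skewIndex (⟨0, hns⟩, j)) (fun j => skewIndex (⟨ns - 1, by omega⟩, j))
  have h1 : ∑ j : Fin ns, f (skewIndex (⟨0, hns⟩, j))
      + ∑ j : Fin ns, f (skewIndex (⟨ns - 1, by omega⟩, j)) = ∑ x, f (g x) := by
    rw [Fintype.sum_sum_type]; rfl
  rw [h1, ← Finset.sum_fiberwise Finset.univ g]
  refine Finset.sum_le_sum fun c _ => ?_
  have hg : ∃ x, g x = c := by
    rcases lt_or_ge (c : ℕ) ns with hc | hc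
    · exact ⟨Sum.inl ⟨c, hc⟩, by simp [g, skewIndex]⟩
    · refine ⟨Sum.inr ⟨c - (ns - 1), by have := c.isLt; omega⟩, ?_⟩
      simp only [g, skewIndex, Fin.ext_iff, Sum.elim_inr]
      omega
  obtain ⟨x, hx⟩ := hg
  calc f c = f (g x) := by rw [hx]
    _ ≤ _ := Finset.single_le_sum (f := fun x => f (g x)) (fun _ _ => hf _) (by simp [hx])

theorem vecNorm_row_factorization_le (hU : Uᴴ * U = 1) (hd : ∀ k, 0 ≤ d k) (hda : ∀ k, d k ≤ a ^ 2)
    (i : Fin ns) :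
    vecNorm ((U * diagonal (fun k => (d k : ℂ)) * Uᵀ) i) ≤ vecNorm (U i) * a ^ 2 := by
  have h1 : OpLe (diagonal (fun k => (d k : ℂ))) (a ^ 2) := opLe_diagonal (sq_nonneg a) fun k => by
    rw [Complex.norm_real, Real.norm_of_nonneg (hd k)]; exact hda k
  have h2 := h1.mul (sq_nonneg a) ((opLe_of_orthonormal hU).transpose zero_le_one)
  rw [mul_one] at h2
  rw [Matrix.mul_assoc]
  exact vecNorm_row_mul_le (sq_nonneg a) h2 U i

theorem norm_factorization_apply_le (hd : ∀ k, 0 ≤ d k) (hda : ∀ k, d k ≤ a ^ 2)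
    (hrow : ∀ i, vecNorm (U i) ^ 2 ≤ ν) (i j : Fin ns) :
    ‖(U * diagonal (fun k => (d k : ℂ)) * Uᵀ) i j‖ ≤ a ^ 2 * ν := by
  have h1 : OpLe (diagonal (fun k => (d k : ℂ))) (a ^ 2) := opLe_diagonal (sq_nonneg a) fun k => by
    rw [Complex.norm_real, Real.norm_of_nonneg (hd k)]; exact hda k
  have h2 : (U * diagonal (fun k => (d k : ℂ)) * Uᵀ) i j
      = (U * diagonal (fun k => (d k : ℂ))) i ⬝ᵥ U j := rfl
  rw [h2]
  have h3 := norm_dotProduct_le ((U * diagonal (fun k => (d k : ℂ))) i) (U j)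
  have h4 := vecNorm_row_mul_le (sq_nonneg a) h1 U i
  have h5 := mul_le_mul_of_nonneg_right h4 (vecNorm_nonneg (U j))
  have h6 : vecNorm (U i) * vecNorm (U j) ≤ ν := by
    nlinarith [hrow i, hrow j, sq_nonneg (vecNorm (U i) - vecNorm (U j))]
  nlinarith [mul_le_mul_of_nonneg_left h6 (sq_nonneg a)]

theorem norm_symbol_le (hd : ∀ k, 0 ≤ d k) (hda : ∀ k, d k ≤ a ^ 2)
    (hrow : ∀ i, vecNorm (U i) ^ 2 ≤ ν) (hy : Gop ns y = U * diagonal (fun k => (d k : ℂ)) * Uᵀ)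
    (c : Fin (2 * ns - 1)) : ‖y c / (√(hw ns c) : ℝ)‖ ≤ a ^ 2 * ν := by
  obtain ⟨p, rfl⟩ := exists_skewIndex_eq c
  rw [← Gop_apply, hy]
  exact norm_factorization_apply_le hd hda hrow _ _

theorem sum_norm_symbol_sq_le (hns : 0 < ns) (hU : Uᴴ * U = 1) (hd : ∀ k, 0 ≤ d k)
    (hda : ∀ k, d k ≤ a ^ 2) (hrow : ∀ i, vecNorm (U i) ^ 2 ≤ ν)
    (hy : Gop ns y = U * diagonal (fun k => (d k : ℂ)) * Uᵀ) :
    ∑ c, ‖y c / (√(hw ns c) : ℝ)‖ ^ 2 ≤ 2 * (a ^ 4 * ν) := by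
  have h1 := sum_le_sum_first_add_sum_last hns
    (f := fun c => ‖y c / (√(hw ns c) : ℝ)‖ ^ 2) fun _ => sq_nonneg _
  have h2 : ∀ i : Fin ns, ∑ j, ‖y (skewIndex (i, j)) / (√(hw ns (skewIndex (i, j))) : ℝ)‖ ^ 2
      ≤ a ^ 4 * ν := fun i => by
    have e1 : ∑ j, ‖y (skewIndex (i, j)) / (√(hw ns (skewIndex (i, j))) : ℝ)‖ ^ 2
        = vecNorm (Gop ns y i) ^ 2 := by rw [vecNorm_sq]; rfl
    rw [e1, hy]
    calc _ ≤ (vecNorm (U i) * a ^ 2) ^ 2 :=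
          pow_le_pow_left₀ (vecNorm_nonneg _) (vecNorm_row_factorization_le hU hd hda i) 2
      _ = a ^ 4 * vecNorm (U i) ^ 2 := by ring
      _ ≤ a ^ 4 * ν := mul_le_mul_of_nonneg_left (hrow i) (by positivity)
  linarith [h2 ⟨0, hns⟩, h2 ⟨ns - 1, by omega⟩]

/-- The incoherence parameter is at least `1 / 2`. -/
theorem half_le_of_row_le (hns : 1 ≤ ns) (hr : 1 ≤ r) (hU : Uᴴ * U = 1)
    (hrow : ∀ i, vecNorm (U i) ^ 2 ≤ 2 * μ * r / (2 * ns - 1 : ℕ)) : 1 / 2 ≤ μ := by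
  have h1 : (r : ℝ) ≤ ns * (2 * μ * r / (2 * ns - 1 : ℕ)) := by
    have := Finset.sum_le_sum fun i (_ : i ∈ Finset.univ) => hrow i
    rwa [← frobNorm_sq_eq_rows, frobNorm_sq_of_orthonormal hU, Finset.sum_const, Finset.card_univ,
      Fintype.card_fin, nsmul_eq_mul] at this
  have hN : (ns : ℝ) ≤ (2 * ns - 1 : ℕ) := by exact_mod_cast (by omega : ns ≤ 2 * ns - 1)
  have hn0 : (0 : ℝ) < ns := by exact_mod_cast hns
  have hN0 : (0 : ℝ) < (2 * ns - 1 : ℕ) := hn0.trans_le hN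
  have hr0 : (0 : ℝ) < r := by exact_mod_cast hr
  rw [mul_div_assoc', le_div_iff₀ hN0] at h1
  have h2 : (r : ℝ) * ns ≤ r * (2 * μ * ns) := by
    nlinarith [mul_le_mul_of_nonneg_left hN hr0.le]
  have h3 := le_of_mul_le_mul_left h2 hr0
  by_contra! hμ
  nlinarith

end Incoherence

/-! ### Convergence on the good event -/

section GoodEvent

variable {ns r m : ℕ} {U U₀ : Matrix (Fin ns) (Fin r) ℂ} {d d₀ : Fin r → ℝ}
  {M₀ : Matrix (Fin ns) (Fin ns) ℂ} {y : Fin (2 * ns - 1) → ℂ} {δ ν a b τ ε μ : ℝ}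

/-- Numerical consequences of the sampling level. -/
theorem deviation_le {E x R : ℝ} (ha : 0 < a) (hb : 0 < b) (hab : b ^ 4 ≤ a ^ 4) (hε : 0 < ε)
    (hε1 : ε ≤ 1 / 100) (hδ : 0 ≤ δ) (hx : 1 / 2 ≤ x) (hRx : R ≤ 2 * x) (hR : 1 ≤ R)
    (hE2 : E ^ 2 = 4 * (δ ^ 2 * x * a ^ 4)) (hδε : δ * (x * a ^ 4) ≤ ε / 10 ^ 9 * b ^ 4) :
    2 * E ≤ ε * a ^ 2 ∧ 2 * E * √R * a ^ 2 ≤ 3 / 10 ^ 5 * b ^ 4 := by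
  have hx0 : 0 < x := by linarith
  have hsq : (δ * (x * a ^ 4)) ^ 2 ≤ (ε / 10 ^ 9 * b ^ 4) ^ 2 :=
    pow_le_pow_left₀ (by positivity) hδε 2
  have hxx : x * 1 ≤ 2 * x ^ 2 := by nlinarith
  have hxR : x * R ≤ 2 * x ^ 2 := by nlinarith
  have main : ∀ t, x * t ≤ 2 * x ^ 2 → 4 * E ^ 2 * t * a ^ 4 ≤ 32 * (ε / 10 ^ 9 * b ^ 4) ^ 2 := by
    intro t ht
    calc 4 * E ^ 2 * t * a ^ 4 = 16 * δ ^ 2 * a ^ 8 * (x * t) := by rw [hE2]; ring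
      _ ≤ 16 * δ ^ 2 * a ^ 8 * (2 * x ^ 2) := mul_le_mul_of_nonneg_left ht (by positivity)
      _ = 32 * (δ * (x * a ^ 4)) ^ 2 := by ring
      _ ≤ _ := mul_le_mul_of_nonneg_left hsq (by norm_num)
  constructor
  · refine le_of_sq_le_sq (le_of_mul_le_mul_right ?_ (by positivity : 0 < a ^ 4)) (by positivity)
    calc (2 * E) ^ 2 * a ^ 4 = 4 * E ^ 2 * 1 * a ^ 4 := by ring
      _ ≤ 32 * (ε / 10 ^ 9 * b ^ 4) ^ 2 := main 1 hxx
      _ ≤ 32 * (ε / 10 ^ 9 * a ^ 4) ^ 2 := by gcongr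
      _ = 32 / 10 ^ 18 * ((ε * a ^ 2) ^ 2 * a ^ 4) := by ring
      _ ≤ (ε * a ^ 2) ^ 2 * a ^ 4 := mul_le_of_le_one_left (by positivity) (by norm_num)
  · refine le_of_sq_le_sq ?_ (by positivity)
    calc (2 * E * √R * a ^ 2) ^ 2 = 4 * E ^ 2 * √R ^ 2 * a ^ 4 := by ring
      _ = 4 * E ^ 2 * R * a ^ 4 := by rw [Real.sq_sqrt (by linarith)]
      _ ≤ 32 * (ε / 10 ^ 9 * b ^ 4) ^ 2 := main R hxR
      _ ≤ 32 * (1 / 100 / 10 ^ 9 * b ^ 4) ^ 2 := by gcongr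
      _ = 32 / 10 ^ 22 * (b ^ 4) ^ 2 := by ring
      _ ≤ 9 / 10 ^ 10 * (b ^ 4) ^ 2 := mul_le_mul_of_nonneg_right (by norm_num) (by positivity)
      _ = _ := by ring

theorem distP_le_of_goodSample {K : ℕ} {ω : Fin (K + 2) → Fin m → Fin (2 * ns - 1)}
    (hns : 1 ≤ ns) (hr : 1 ≤ r) (hU : Uᴴ * U = 1)
    (hrow : ∀ i, vecNorm (U i) ^ 2 ≤ ν) (hν : ν = 2 * μ * r / (2 * ns - 1 : ℕ)) (hμ : 1 / 2 ≤ μ)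
    (hb : 0 < b) (hba : b ≤ a) (hdb : ∀ k, b ^ 2 ≤ d k) (hda : ∀ k, d k ≤ a ^ 2) (k₀ : Fin r)
    (hk₀ : d k₀ = a ^ 2) (hy : Gop ns y = U * diagonal (fun k => (d k : ℂ)) * Uᵀ)
    (hε : 0 < ε) (hε1 : ε ≤ 1 / 100) (hδ : 0 ≤ δ) (hδε : δ * (μ * r * a ^ 4) ≤ ε / 10 ^ 9 * b ^ 4)
    (hω : ∀ k, GoodSample U (fun c => y c / (√(hw ns c) : ℝ)) δ ν
      ((2 * ns - 1 : ℕ) * δ * √(2 * (a ^ 4 * ν) / (2 * ns - 1 : ℕ))) (ω k))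
    (hM : specNorm (M₀ - (((2 * ns - 1 : ℕ) : ℝ) / (m : ℝ)) •
          ∑ j : Fin m, y (ω 0 j) • Gop ns (Pi.single (ω 0 j) 1))
        ≤ specNorm (Gop ns y - (((2 * ns - 1 : ℕ) : ℝ) / (m : ℝ)) •
          ∑ j : Fin m, y (ω 0 j) • Gop ns (Pi.single (ω 0 j) 1)))
    (hU₀ : U₀ᴴ * U₀ = 1) (hd₀ : ∀ k, 0 ≤ d₀ k)
    (hM₀ : M₀ = U₀ * diagonal (fun k => (d₀ k : ℂ)) * U₀ᵀ)
    {σ : ℝ} (hσ : σ = specNorm M₀ / (1 - ε)) (hτ : τ = 2 * √(μ * r * σ / (2 * ns - 1 : ℕ)))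
    {Zseq : ℕ → Matrix (Fin ns) (Fin r) ℂ}
    (hZ₀ : Zseq 0 = projC τ (U₀ * diagonal (fun k => (√(d₀ k) : ℂ))))
    {η' η : ℝ} (hη' : 0 < η') (hη54 : η' ≤ 1 / 54) (hη : η = η' / a ^ 2)
    (hstep : ∀ k : Fin (K + 1), Zseq (k + 1)
      = projC τ (Zseq k - η • gradf ns r m y (ω k.succ) (Zseq k)))
    (k : ℕ) (hk : k ≤ K + 1) :
    distP (Zseq k) (U * diagonal (fun k => (√(d k) : ℂ)))
      ≤ (1 - 11 * η' / (100 * (a ^ 2 / b ^ 2))) ^ k * b := by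
  have ha : 0 < a := hb.trans_le hba
  have hab : b ^ 2 ≤ a ^ 2 := pow_le_pow_left₀ hb.le hba 2
  have hab4 : b ^ 4 ≤ a ^ 4 := pow_le_pow_left₀ hb.le hba 4
  have hd : ∀ k, 0 ≤ d k := fun k => (sq_nonneg b).trans (hdb k)
  have hN : (0 : ℝ) < (2 * ns - 1 : ℕ) := by exact_mod_cast (show 0 < 2 * ns - 1 by omega)
  set N : ℝ := ((2 * ns - 1 : ℕ) : ℝ)
  have hr1 : (1 : ℝ) ≤ r := by exact_mod_cast hr
  have hμ0 : 0 < μ := by linarith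
  have hν0 : 0 < ν := by rw [hν]; positivity
  have hNν : N * ν = 2 * (μ * r) := by rw [hν]; field_simp
  set x := μ * r with hx
  have hx2 : 1 / 2 ≤ x := hμ.trans (le_mul_of_one_le_right hμ0.le hr1)
  have hrx : r ≤ 2 * x := by linarith [mul_le_mul_of_nonneg_right hμ (zero_le_one.trans hr1)]
  set E := N * δ * √(2 * (a ^ 4 * ν) / N)
  have hE0 : 0 ≤ E := by positivity
  have hE2 : E ^ 2 = 4 * (δ ^ 2 * x * a ^ 4) := by
    rw [mul_pow, Real.sq_sqrt (by positivity)]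
    calc (N * δ) ^ 2 * (2 * (a ^ 4 * ν) / N) = 2 * δ ^ 2 * a ^ 4 * (N * ν) := by field_simp
      _ = _ := by rw [hNν]; ring
  obtain ⟨hEε, hEr⟩ := deviation_le ha hb hab4 hε hε1 hδ hx2 hrx hr1 hE2 hδε
  have hErr : OpLe (M₀ - Gop ns y) (2 * E) :=
    OpLe.sub_of_specNorm_le hE0 ((hω 0).opLe_error hE0) hM
  obtain ⟨s1, s2⟩ := specNorm_div_mem hU hd hda k₀ hk₀ hy hErr hε hε1 (by positivity) hEε
  rw [← hσ] at s1 s2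
  have hσ0 : 0 ≤ σ := (sq_nonneg a).trans s1
  have hτ2 : τ ^ 2 = 2 * (ν * σ) := by
    rw [hτ, mul_pow, Real.sq_sqrt (by positivity), hν, hx]
    ring
  have R : Regime U δ ν a b τ :=
    { orthonormal := hU
      row_le := hrow
      b_pos := hb
      b_le := hba
      δ_nonneg := hδ
      ν_nonneg := hν0.le
      τ_nonneg := by rw [hτ]; positivity
      le_τ := by
        rw [hτ2]
        gcongr
      τ_le := by
        rw [hτ2]
        linarith [mul_le_mul_of_nonneg_left s2 hν0.le]
      sampling := by
        change N * δ * ν * a ^ 4 ≤ _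
        have : N * δ * ν * a ^ 4 = 2 * (δ * (x * a ^ 4)) := by
          linear_combination δ * a ^ 4 * hNν
        rw [this]
        linarith [mul_le_mul_of_nonneg_right hε1 (by positivity : 0 ≤ b ^ 4), pow_pos hb 4] }
  have key := distP_le_of_init R (ω := fun k : Fin (K + 1) => ω k.succ) (fun k => hω _) hdb hda hy
    hU₀ hd₀ hM₀ hErr (by positivity) hr hEr hZ₀ hη' hη54 hη (fun k hk => hstep ⟨k, by omega⟩) k hk
  refine key.trans (mul_le_mul_of_nonneg_left ?_ (pow_nonneg ?_ k))
  · rw [div_div, div_le_iff₀ (by positivity)]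
    have : b * b ^ 2 ≤ b * a ^ 2 := mul_le_mul_of_nonneg_left hab hb.le
    linarith [mul_pos hb (pow_pos ha 2)]
  · have h1 : 1 ≤ a ^ 2 / b ^ 2 := (one_le_div (by positivity)).2 hab
    rw [sub_nonneg, div_le_one (by positivity)]
    linarith

/-- The deviation level at which `m` samples are good. -/
theorem exists_sampling_level {L x : ℝ} (hL : 0 < L) (hx : 0 < x) (hε : 0 < ε)
    (hm : 12 * 10 ^ 18 * ε⁻¹ ^ 2 * x ^ 2 * L ≤ m) :
    0 < m ∧ ∃ δ : ℝ, 0 < δ ∧ m * δ ^ 2 = 12 * L ∧ δ * x ≤ ε / 10 ^ 9 := by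
  have hm0 : (0 : ℝ) < m := lt_of_lt_of_le (by positivity) hm
  refine ⟨by exact_mod_cast hm0, √(12 * L / m), by positivity, ?_, ?_⟩
  · rw [Real.sq_sqrt (by positivity)]
    field_simp
  · refine le_of_sq_le_sq ?_ (by positivity)
    rw [mul_pow, Real.sq_sqrt (by positivity), div_mul_eq_mul_div, div_le_iff₀ hm0]
    have h1 := mul_le_mul_of_nonneg_left hm (by positivity : 0 ≤ ε ^ 2 / (10 ^ 9) ^ 2)
    have h2 : ε ^ 2 / (10 ^ 9) ^ 2 * (12 * 10 ^ 18 * ε⁻¹ ^ 2 * x ^ 2 * L) = 12 * L * x ^ 2 := by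
      field_simp
    rw [h2] at h1
    rwa [div_pow]

end GoodEvent

/-- Theorem 1: linear convergence of SHGD with `O(ε₀⁻²μ²κ⁴r²log n)` samples, with
independent uniform sampling expressed by counting tuples
`ω : Fin (K+2) → Fin m̂ → Fin n`. -/
theorem shgd_linear_convergence :
    ∃ C c₁ c₂ εbar : ℝ, 0 < C ∧ 0 < c₁ ∧ 0 < c₂ ∧ 0 < εbar ∧ εbar < 1 ∧
    ∀ ε₀ : ℝ, 0 < ε₀ → ε₀ ≤ εbar →
    ∀ ns r : ℕ, ∀ hns : 1 ≤ ns, ∀ hr : 1 ≤ r,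
    ∀ y : Fin (2 * ns - 1) → ℂ,
    ∀ Us : Matrix (Fin ns) (Fin r) ℂ, ∀ σvec : Fin r → ℝ,
    Usᴴ * Us = 1 →
    (∀ i j : Fin r, i ≤ j → σvec j ≤ σvec i) →
    ∀ σ1 σr κ : ℝ, σ1 = σvec ⟨0, by omega⟩ → σr = σvec ⟨r - 1, by omega⟩ →
    0 < σr → κ = σ1 / σr →
    Gop ns y = Us * Matrix.diagonal (fun k => (σvec k : ℂ)) * Usᵀ →
    ∀ μ₀ : ℝ, 0 < μ₀ →
    norm2inf Us ≤ Real.sqrt (2 * μ₀ * r / (2 * ns - 1 : ℕ)) →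
    ∀ μ : ℝ, μ₀ ≤ μ →
    ∀ η' η : ℝ, 0 < η' → η' ≤ 1 / 54 → η = η' / σ1 →
    ∀ K : ℕ,
    ∀ mhat : ℕ, C * ε₀⁻¹ ^ 2 * μ ^ 2 * κ ^ 4 * r ^ 2 * Real.log (2 * ns - 1 : ℕ) ≤ mhat →
    ((Finset.univ.filter (fun ω : Fin (K + 2) → Fin mhat → Fin (2 * ns - 1) =>
      ∀ M0 : Matrix (Fin ns) (Fin ns) ℂ,
        M0.rank ≤ r →
        (∀ M' : Matrix (Fin ns) (Fin ns) ℂ, M'.rank ≤ r →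
          specNorm (M0 - (((2 * ns - 1 : ℕ) : ℝ) / (mhat : ℝ)) •
              ∑ j : Fin mhat, y (ω 0 j) • Gop ns (Pi.single (ω 0 j) 1))
            ≤ specNorm (M' - (((2 * ns - 1 : ℕ) : ℝ) / (mhat : ℝ)) •
              ∑ j : Fin mhat, y (ω 0 j) • Gop ns (Pi.single (ω 0 j) 1))) →
      ∀ U0 : Matrix (Fin ns) (Fin r) ℂ, ∀ Sig0 : Fin r → ℝ,
        U0ᴴ * U0 = 1 → (∀ k, 0 ≤ Sig0 k) →
        M0 = U0 * Matrix.diagonal (fun k => (Sig0 k : ℂ)) * U0ᵀ →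
      ∀ σ τ : ℝ, σ = specNorm M0 / (1 - ε₀) →
        τ = 2 * Real.sqrt (μ * r * σ / (2 * ns - 1 : ℕ)) →
      ∀ Zseq : ℕ → Matrix (Fin ns) (Fin r) ℂ,
        Zseq 0 = projC τ (U0 * Matrix.diagonal (fun k => (Real.sqrt (Sig0 k) : ℂ))) →
        (∀ k : ℕ, ∀ hk : k ≤ K,
          Zseq (k + 1) = projC τ
            (Zseq k - η • gradf ns r mhat y (ω ⟨k + 1, by omega⟩) (Zseq k))) →
      ∀ k : ℕ, k ≤ K + 1 →
        distP (Zseq k) (Us * Matrix.diagonal (fun j => (Real.sqrt (σvec j) : ℂ)))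
          ≤ (1 - 11 * η' / (100 * κ)) ^ k * c₁ * Real.sqrt σr)).card : ℝ)
      ≥ (1 - c₂ * (K + 2) * (((2 * ns - 1 : ℕ) : ℝ) ^ (2 : ℕ))⁻¹)
        * Fintype.card (Fin (K + 2) → Fin mhat → Fin (2 * ns - 1)) := by
  refine ⟨12 * 10 ^ 18, 1, 8, 1 / 100, by norm_num, one_pos, by norm_num, by norm_num,
    by norm_num, ?_⟩
  intro ε₀ hε hε1 ns r hns hr y Us σvec hU hmono σ1 σr κ hσ1 hσr hσr0 hκ hy μ₀ hμ₀ hinc μ hμ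
    η' η hη' hη54 hη K m hm
  rcases hns.eq_or_lt with rfl | hns2
  · have hneg : 1 - 8 * ((K : ℝ) + 2) * (((2 * 1 - 1 : ℕ) : ℝ) ^ 2)⁻¹ ≤ 0 := by
      have : (0 : ℝ) ≤ K := Nat.cast_nonneg K
      norm_num
      linarith
    exact (mul_nonpos_of_nonpos_of_nonneg hneg (Nat.cast_nonneg _)).trans (Nat.cast_nonneg _)
  have hN3 : (3 : ℝ) ≤ (2 * ns - 1 : ℕ) := by exact_mod_cast (show 3 ≤ 2 * ns - 1 by omega)
  have hN0 : (0 : ℝ) < (2 * ns - 1 : ℕ) := by linarith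
  have hr1 : (1 : ℝ) ≤ r := by exact_mod_cast hr
  have hrow₀ : ∀ i, vecNorm (Us i) ^ 2 ≤ 2 * μ₀ * r / (2 * ns - 1 : ℕ) := fun i => by
    have h := pow_le_pow_left₀ (vecNorm_nonneg _) ((vecNorm_row_le_norm2inf i).trans hinc) 2
    rwa [Real.sq_sqrt (by positivity)] at h
  have hμ2 : 1 / 2 ≤ μ := (half_le_of_row_le hns hr hU hrow₀).trans hμ
  have hμ0 : 0 < μ := by linarith
  set ν : ℝ := 2 * μ * r / (2 * ns - 1 : ℕ) with hν
  have hrow : ∀ i, vecNorm (Us i) ^ 2 ≤ ν := fun i => (hrow₀ i).trans (by rw [hν]; gcongr)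
  have hν0 : 0 < ν := by positivity
  have hlow : ∀ k, σr ≤ σvec k := fun k => by
    rw [hσr]; exact hmono _ _ (by rw [Fin.le_def]; change (k : ℕ) ≤ r - 1; omega)
  have hhigh : ∀ k, σvec k ≤ σ1 := fun k => by
    rw [hσ1]; exact hmono _ _ (by rw [Fin.le_def]; exact Nat.zero_le _)
  have hσ10 : 0 < σ1 := hσr0.trans_le ((hlow _).trans (hhigh ⟨0, by omega⟩))
  have ha2 : √σ1 ^ 2 = σ1 := Real.sq_sqrt hσ10.le
  have hb2 : √σr ^ 2 = σr := Real.sq_sqrt hσr0.le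
  have hb : 0 < √σr := Real.sqrt_pos.2 hσr0
  have hba : √σr ≤ √σ1 := Real.sqrt_le_sqrt ((hlow _).trans (hhigh ⟨0, by omega⟩))
  have hκ1 : 1 ≤ κ := by
    rw [hκ, one_le_div hσr0]
    exact (hlow _).trans (hhigh ⟨0, by omega⟩)
  have ha4 : √σ1 ^ 4 = κ ^ 2 * √σr ^ 4 := by
    rw [show √σ1 ^ 4 = (√σ1 ^ 2) ^ 2 by ring, show √σr ^ 4 = (√σr ^ 2) ^ 2 by ring, ha2, hb2, hκ]
    field_simp
  obtain ⟨hm0, δ, hδ, hδm, hδx⟩ := exists_sampling_level (m := m)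
    (Real.log_pos (by linarith : (1 : ℝ) < (2 * ns - 1 : ℕ)))
    (by positivity : 0 < μ * r * κ ^ 2) hε (le_trans (le_of_eq (by ring)) hm)
  have hδμ : δ * (μ * r) ≤ ε₀ / 10 ^ 9 :=
    (mul_le_mul_of_nonneg_left (le_mul_of_one_le_right (by positivity) (one_le_pow₀ hκ1))
      hδ.le).trans hδx
  have hδ1 : δ ≤ 1 / 2 := by
    have h1 : 1 / 2 ≤ μ * r := hμ2.trans (le_mul_of_one_le_right hμ0.le hr1)
    have := mul_le_mul_of_nonneg_left h1 hδ.le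
    linarith
  have hd : ∀ k, 0 ≤ σvec k := fun k => hσr0.le.trans (hlow k)
  have hda : ∀ k, σvec k ≤ √σ1 ^ 2 := fun k => (hhigh k).trans_eq ha2.symm
  set V : ℝ := 2 * (√σ1 ^ 4 * ν) / (2 * ns - 1 : ℕ) with hV
  have hLV : δ * (√σ1 ^ 2 * ν) ≤ √V := by
    refine Real.le_sqrt_of_sq_le ?_
    have h1 : (δ * (√σ1 ^ 2 * ν)) ^ 2 = V * (δ * (δ * (μ * r))) := by
      rw [hV, hν]
      field_simp
    rw [h1]
    refine mul_le_of_le_one_right (by positivity) (mul_le_one₀ (by linarith) (by positivity) ?_)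
    linarith
  have hcard := card_not_goodSample_le (m := m) hns2 hm0 (U := Us)
    (h := fun c => y c / (√(hw ns c) : ℝ)) hδ hδ1 hν0 (by positivity : 0 < V) hrow
    (fun c => norm_symbol_le hd hda hrow hy c)
    ((sum_norm_symbol_sq_le hns hU hd hda hrow hy).trans_eq (by rw [hV]; field_simp)) hLV hδm
  refine ge_iff_le.2 (le_trans (le_trans (le_of_eq ?_) (card_forall_ge _
    (p := 8 * (((2 * ns - 1 : ℕ) : ℝ) ^ 2)⁻¹) (hcard.trans_eq ?_) (K + 2))) ?_)
  · push_cast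
    ring
  · rw [Fintype.card_fun, Fintype.card_fin, Fintype.card_fin]
    push_cast
    ring
  refine Nat.cast_le.2 (Finset.card_le_card (Finset.monotone_filter_right _ fun ω _ hω => ?_))
  intro M0 _ hbest U0 Sig0 hU0 hSig0 hM0 σ τ hσ hτ Zseq hZ0 hstep k hk
  have hrank : (Gop ns y).rank ≤ r := by
    rw [hy]
    exact (Matrix.rank_mul_le_right _ _).trans (Matrix.rank_le_height _)
  have key := distP_le_of_goodSample hns hr hU hrow hν hμ2 hb hba
    (fun k => hb2.trans_le (hlow k)) hda ⟨0, by omega⟩ (hσ1.symm.trans ha2.symm) hy hε hε1 hδ.le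
    (by
      rw [ha4]
      have := mul_le_mul_of_nonneg_right hδx (by positivity : 0 ≤ √σr ^ 4)
      linarith)
    hω (hbest _ hrank) hU0 hSig0 hM0 hσ hτ hZ0 hη' hη54 (by rw [ha2, hη])
    (fun k => hstep k (Nat.le_of_lt_succ k.isLt)) k hk
  rwa [ha2, hb2, ← hκ, ← mul_one ((1 - 11 * η' / (100 * κ)) ^ k)] at key
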